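/- arXiv:1909.01797 — 4 statements merged into one kernel-verified Lean document; each statement's English description precedes it below -/
import Mathlib

section
/- Fix $p \in (0,1]$. There exists a constant $C = C(p) > 0$ such that the following holds. Let $X = [X_1; X_2]$ be a random vector in $\mathbb{R}^{d_1} \times \mathbb{R}^{d_2}$ with $\|X - \mathbb{E}X\|_{2,\infty} \le \beta$ almost surely and $\min_{i \in \{1,2\}} \lambda_{\min}(\Sigma_{X_i}) \ge \sigma^2 > 0$. Fix $k \in \mathbb{N}$ and $\epsilon \in (0,1]$, and let $\hat{X}$ denote the empirical random vector built from $n$ i.i.d. realizations of $X$. If $n \ge C\big((d_1 + d_2) \cdot \frac{k}{\epsilon^2}\log(\frac{k}{\epsilon^2}) + (\frac{\beta}{\epsilon\sigma})^4 \cdot \log(d_1 + d_2)\big)$, then with probability at least $1 - p$, $\big|\min_{A \in S_{\hat{X}}} f_{\hat{X}}(A) - \min_{A \in S_X} f_X(A)\big| \le \epsilon \cdot \frac{\beta^2}{\sigma^2}$. -/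
open Matrix MeasureTheory

/-- Empirical mean of `n` vectors in `ℝ^d`. -/
noncomputable def empMean (n d : ℕ) (v : Fin n → Fin d → ℝ) : Fin d → ℝ :=
  (n : ℝ)⁻¹ • ∑ j, v j

/-- Empirical covariance of `n` vectors in `ℝ^d`. -/
noncomputable def empCov (n d : ℕ) (v : Fin n → Fin d → ℝ) : Matrix (Fin d) (Fin d) ℝ :=
  Matrix.of fun a b =>
    (n : ℝ)⁻¹ * ∑ j, (v j a - empMean n d v a) * (v j b - empMean n d v b)

/-- Empirical MCA objective: `f_{X̂}(A) = (1/n) ∑ⱼ ‖A₁(x₁ⱼ - μ̂₁) - A₂(x₂ⱼ - μ̂₂)‖₂²`. -/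
noncomputable def empObj (n d₁ d₂ k : ℕ) (v₁ : Fin n → Fin d₁ → ℝ) (v₂ : Fin n → Fin d₂ → ℝ)
    (A : Matrix (Fin k) (Fin d₁) ℝ × Matrix (Fin k) (Fin d₂) ℝ) : ℝ :=
  (n : ℝ)⁻¹ * ∑ j, ∑ i,
    ((A.1 *ᵥ (v₁ j - empMean n d₁ v₁) - A.2 *ᵥ (v₂ j - empMean n d₂ v₂)) i) ^ 2

/-- Empirical feasible set `S_{X̂} = {(A₁,A₂) : Aᵢ Σ̂ᵢ Aᵢᵀ = I_k}`. -/
def empFeasible (n d₁ d₂ k : ℕ) (v₁ : Fin n → Fin d₁ → ℝ) (v₂ : Fin n → Fin d₂ → ℝ) :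
    Set (Matrix (Fin k) (Fin d₁) ℝ × Matrix (Fin k) (Fin d₂) ℝ) :=
  {A | A.1 * empCov n d₁ v₁ * A.1ᵀ = 1 ∧ A.2 * empCov n d₂ v₂ * A.2ᵀ = 1}


lemma aux_spec {k : ℕ} (M : Matrix (Fin k) (Fin k) ℝ) (hM : M.IsHermitian) (t : ℝ)
    (ht : t ≤ 1/2) (h : ∀ w : Fin k → ℝ, |w ⬝ᵥ M *ᵥ w - w ⬝ᵥ w| ≤ t * (w ⬝ᵥ w)) :
    ∃ N : Matrix (Fin k) (Fin k) ℝ, N * M * Nᵀ = 1 ∧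
      trace ((N - 1) * M * (N - 1)ᵀ) ≤ k * t ^ 2 := by
  classical
  have hev : ∀ i, |hM.eigenvalues i - 1| ≤ t := by
    intro i
    have h1 := h (hM.eigenvectorBasis i)
    rw [hM.mulVec_eigenvectorBasis i, dotProduct_smul] at h1
    have h2 : ((hM.eigenvectorBasis i : EuclideanSpace ℝ (Fin k)) : Fin k → ℝ) ⬝ᵥ
        ((hM.eigenvectorBasis i : EuclideanSpace ℝ (Fin k)) : Fin k → ℝ) = 1 := by
      have := hM.eigenvectorBasis.orthonormal.1 i
      have h3 : inner ℝ (hM.eigenvectorBasis i) (hM.eigenvectorBasis i) = (1:ℝ) := by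
        rw [real_inner_self_eq_norm_sq, this]; norm_num
      rw [← h3, EuclideanSpace.inner_eq_star_dotProduct]
      simp
    rw [h2] at h1
    simpa using h1
  set U : Matrix (Fin k) (Fin k) ℝ := (hM.eigenvectorUnitary : Matrix (Fin k) (Fin k) ℝ) with hU
  have hUU : U * Uᵀ = 1 := by
    have := Unitary.coe_mul_star_self hM.eigenvectorUnitary
    simpa [Matrix.star_eq_conjTranspose] using this
  have hUU' : Uᵀ * U = 1 := by
    have := Unitary.coe_star_mul_self hM.eigenvectorUnitary
    simpa [Matrix.star_eq_conjTranspose] using this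
  have hspec : M = U * diagonal hM.eigenvalues * Uᵀ := by
    have := hM.spectral_theorem
    rw [Unitary.conjStarAlgAut_apply] at this
    conv_lhs => rw [this]
    simp [hU, Matrix.star_eq_conjTranspose]
  generalize hM.eigenvalues = l at *
  have hl : ∀ i, 0 < l i := fun i => by have := abs_le.1 (hev i); linarith
  have key : ∀ g : Fin k → ℝ, (U * diagonal g * Uᵀ) * M * (U * diagonal g * Uᵀ)ᵀ
      = U * diagonal (fun i => g i * l i * g i) * Uᵀ := by
    intro g
    rw [hspec]
    simp only [transpose_mul, transpose_transpose, diagonal_transpose]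
    calc _ = U * (diagonal g * (Uᵀ * U) * diagonal l * (Uᵀ * U) * diagonal g) * Uᵀ := by
          simp only [Matrix.mul_assoc]
      _ = _ := by
          rw [hUU']; simp [diagonal_mul_diagonal]
  refine ⟨U * diagonal (fun i => (Real.sqrt (l i))⁻¹) * Uᵀ, ?_, ?_⟩
  · rw [key]
    have : (fun i => (Real.sqrt (l i))⁻¹ * l i * (Real.sqrt (l i))⁻¹) = fun _ => 1 := by
      funext i
      have := Real.sqrt_pos.2 (hl i)
      have h2 := Real.mul_self_sqrt (hl i).le
      field_simp
      nlinarith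
    rw [this, diagonal_one, Matrix.mul_one, hUU]
  · have : U * diagonal (fun i => (Real.sqrt (l i))⁻¹) * Uᵀ - 1
        = U * diagonal (fun i => (Real.sqrt (l i))⁻¹ - 1) * Uᵀ := by
      rw [← diagonal_sub, diagonal_one, Matrix.mul_sub, Matrix.sub_mul, Matrix.mul_one, hUU]
    rw [this, key, trace_mul_comm, ← Matrix.mul_assoc, hUU', Matrix.one_mul, trace_diagonal]
    calc _ ≤ ∑ i : Fin k, t ^ 2 := by
          refine Finset.sum_le_sum fun i _ => ?_
          have h0 := Real.sqrt_pos.2 (hl i)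
          have h2 := Real.mul_self_sqrt (hl i).le
          set r := Real.sqrt (l i)
          have h3 := hev i
          rw [← h2] at h3 ⊢
          have e : (r⁻¹ - 1) * (r * r) * (r⁻¹ - 1) = (1 - r)^2 := by field_simp
          rw [e, ← sq_abs (1 - r)]
          refine pow_le_pow_left₀ (abs_nonneg _) (le_trans ?_ h3) 2
          have : r * r - 1 = (1 - r) * (-(1 + r)) := by ring
          rw [this, abs_mul, abs_neg, abs_of_pos (by linarith : 0 < 1 + r)]
          nlinarith [abs_nonneg (1 - r)]
      _ = _ := by simp

/-- quadratic form -/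
def QF {ι : Type} [Fintype ι] (G : Matrix ι ι ℝ) (v : ι → ℝ) : ℝ := v ⬝ᵥ G *ᵥ v

lemma QF_eq_sum {ι : Type} [Fintype ι] (G : Matrix ι ι ℝ) (v : ι → ℝ) :
    QF G v = ∑ a, ∑ b, v a * G a b * v b := by
  simp [QF, dotProduct, mulVec, Finset.mul_sum, mul_assoc]

lemma trace_QF {ι : Type} [Fintype ι] {k : ℕ} (G : Matrix ι ι ℝ) (A : Matrix (Fin k) ι ℝ) :
    trace (A * G * Aᵀ) = ∑ r, QF G (A r) := by
  simp only [trace, diag]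
  refine Finset.sum_congr rfl fun r _ => ?_
  rw [QF, Matrix.mul_assoc]
  simp [dotProduct, mulVec, Matrix.mul_apply]

lemma diag_QF {ι : Type} [Fintype ι] {k : ℕ} (G : Matrix ι ι ℝ) (A : Matrix (Fin k) ι ℝ)
    (h : A * G * Aᵀ = 1) (r : Fin k) : QF G (A r) = 1 := by
  have : (A * G * Aᵀ) r r = 1 := by rw [h]; simp
  rw [← this, QF, Matrix.mul_assoc]
  simp [dotProduct, mulVec, Matrix.mul_apply]

lemma QF_add_le {ι : Type} [Fintype ι] (G : Matrix ι ι ℝ) (hG : Gᵀ = G)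
    (hp : ∀ v, 0 ≤ QF G v) (t : ℝ) (ht : 0 < t) (b d : ι → ℝ) :
    QF G (b + d) ≤ (1 + t) * QF G b + (1 + 1 / t) * QF G d := by
  have hc : d ⬝ᵥ G *ᵥ b = b ⬝ᵥ G *ᵥ d := by
    conv_lhs => rw [← hG]
    rw [mulVec_transpose, dotProduct_comm, ← dotProduct_mulVec]
  have h := hp (t • b - d)
  have e1 : QF G (t • b - d) = t ^ 2 * QF G b - 2 * t * (b ⬝ᵥ G *ᵥ d) + QF G d := by
    simp only [QF, mulVec_sub, mulVec_smul, sub_dotProduct, dotProduct_sub, smul_dotProduct,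
      dotProduct_smul, smul_eq_mul, hc]
    ring
  have e2 : QF G (b + d) = QF G b + 2 * (b ⬝ᵥ G *ᵥ d) + QF G d := by
    simp only [QF, mulVec_add, add_dotProduct, dotProduct_add, hc]
    ring
  rw [e1] at h
  rw [e2]
  have : 2 * (b ⬝ᵥ G *ᵥ d) ≤ t * QF G b + 1 / t * QF G d := by
    rw [← mul_le_mul_iff_right₀ ht]
    have : t * (t * QF G b + 1 / t * QF G d) = t^2 * QF G b + QF G d := by field_simp
    rw [this]; linarith
  linarith

lemma QF_inl {d₁ d₂ : ℕ} (G : Matrix (Fin d₁ ⊕ Fin d₂) (Fin d₁ ⊕ Fin d₂) ℝ) (v : Fin d₁ → ℝ) :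
    QF G (Sum.elim v 0) = QF G.toBlocks₁₁ v := by
  simp [QF_eq_sum, toBlocks₁₁]

lemma QF_inr {d₁ d₂ : ℕ} (G : Matrix (Fin d₁ ⊕ Fin d₂) (Fin d₁ ⊕ Fin d₂) ℝ) (v : Fin d₂ → ℝ) :
    QF G (Sum.elim 0 v) = QF G.toBlocks₂₂ v := by
  simp [QF_eq_sum, toBlocks₂₂]

lemma elim_split {d₁ d₂ : ℕ} (v : Fin d₁ → ℝ) (w : Fin d₂ → ℝ) :
    Sum.elim v w = Sum.elim v (0 : Fin d₂ → ℝ) + Sum.elim (0 : Fin d₁ → ℝ) w := by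
  ext i; cases i <;> simp

/-- whitening a single block -/
lemma aux_block {d k : ℕ} (G G' : Matrix (Fin d) (Fin d) ℝ) (hG' : G'ᵀ = G') (s τ : ℝ)
    (hs : 0 < s) (hτ : 0 ≤ τ) (hts : τ / s ≤ 1/2)
    (hlow : ∀ w : Fin d → ℝ, s * (w ⬝ᵥ w) ≤ QF G w)
    (hd : ∀ w : Fin d → ℝ, |QF G' w - QF G w| ≤ τ * (w ⬝ᵥ w))
    (A : Matrix (Fin k) (Fin d) ℝ) (hA : A * G * Aᵀ = 1) :
    ∃ D : Matrix (Fin k) (Fin d) ℝ, (A + D) * G' * (A + D)ᵀ = 1 ∧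
      ∑ r, QF G' (D r) ≤ k * (τ / s) ^ 2 := by
  have conj : ∀ (H : Matrix (Fin d) (Fin d) ℝ) (w : Fin k → ℝ),
      w ⬝ᵥ (A * H * Aᵀ) *ᵥ w = QF H (Aᵀ *ᵥ w) := by
    intro H w
    rw [QF, ← mulVec_mulVec, ← mulVec_mulVec, dotProduct_mulVec, ← mulVec_transpose]
  obtain ⟨N, hN1, hN2⟩ := aux_spec (A * G' * Aᵀ) (by
      rw [IsHermitian, conjTranspose_eq_transpose_of_trivial]
      simp [transpose_mul, hG', Matrix.mul_assoc]) (τ / s) hts (by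
      intro w
      have h1 := conj G w
      rw [hA, one_mulVec] at h1
      rw [conj, h1]
      have h2 := hlow (Aᵀ *ᵥ w)
      refine (hd _).trans ?_
      rw [div_mul_eq_mul_div, le_div_iff₀ hs]
      nlinarith)
  refine ⟨(N - 1) * A, ?_, ?_⟩
  · have : A + (N - 1) * A = N * A := by rw [Matrix.sub_mul]; simp
    rw [this, ← hN1]
    simp only [transpose_mul, Matrix.mul_assoc]
  · rw [← trace_QF]
    refine le_trans (le_of_eq ?_) hN2
    simp only [transpose_mul, Matrix.mul_assoc]

/-- objective from a joint covariance -/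
def objG {d₁ d₂ k : ℕ} (G : Matrix (Fin d₁ ⊕ Fin d₂) (Fin d₁ ⊕ Fin d₂) ℝ)
    (A : Matrix (Fin k) (Fin d₁) ℝ × Matrix (Fin k) (Fin d₂) ℝ) : ℝ :=
  ∑ r, QF G (Sum.elim (A.1 r) (A.2 r))

/-- feasible set from a joint covariance -/
def feasG {d₁ d₂ : ℕ} (k : ℕ) (G : Matrix (Fin d₁ ⊕ Fin d₂) (Fin d₁ ⊕ Fin d₂) ℝ) :
    Set (Matrix (Fin k) (Fin d₁) ℝ × Matrix (Fin k) (Fin d₂) ℝ) :=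
  {A | A.1 * G.toBlocks₁₁ * A.1ᵀ = 1 ∧ A.2 * G.toBlocks₂₂ * A.2ᵀ = 1}

lemma aux_perturb {d₁ d₂ k : ℕ} (G G' : Matrix (Fin d₁ ⊕ Fin d₂) (Fin d₁ ⊕ Fin d₂) ℝ)
    (hG : Gᵀ = G) (hp : ∀ v, 0 ≤ QF G v)
    (hG' : G'ᵀ = G') (hp' : ∀ v, 0 ≤ QF G' v) (s τ : ℝ)
    (hs : 0 < s) (hτ : 0 < τ) (hts : τ / s ≤ 1/2)
    (hlow1 : ∀ w, s * (w ⬝ᵥ w) ≤ QF G.toBlocks₁₁ w)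
    (hlow2 : ∀ w, s * (w ⬝ᵥ w) ≤ QF G.toBlocks₂₂ w)
    (hd : ∀ w, |QF G' w - QF G w| ≤ τ * (w ⬝ᵥ w))
    (A : Matrix (Fin k) (Fin d₁) ℝ × Matrix (Fin k) (Fin d₂) ℝ) (hA : A ∈ feasG k G) :
    ∃ A' ∈ feasG k G', objG G' A' ≤ objG G A + 13 * k * (τ / s) := by
  have hd1 : ∀ w, |QF G'.toBlocks₁₁ w - QF G.toBlocks₁₁ w| ≤ τ * (w ⬝ᵥ w) := by
    intro w
    rw [← QF_inl, ← QF_inl]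
    refine (hd _).trans (le_of_eq ?_)
    simp [dotProduct]
  have hd2 : ∀ w, |QF G'.toBlocks₂₂ w - QF G.toBlocks₂₂ w| ≤ τ * (w ⬝ᵥ w) := by
    intro w
    rw [← QF_inr, ← QF_inr]
    refine (hd _).trans (le_of_eq ?_)
    simp [dotProduct]
  have hs1 : G'.toBlocks₁₁ᵀ = G'.toBlocks₁₁ := by
    ext a b; exact congrFun (congrFun hG' (Sum.inl a)) (Sum.inl b)
  have hs2 : G'.toBlocks₂₂ᵀ = G'.toBlocks₂₂ := by
    ext a b; exact congrFun (congrFun hG' (Sum.inr a)) (Sum.inr b)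
  obtain ⟨D1, hD1, hD1'⟩ := aux_block _ _ hs1 s τ hs hτ.le hts hlow1 hd1 A.1 hA.1
  obtain ⟨D2, hD2, hD2'⟩ := aux_block _ _ hs2 s τ hs hτ.le hts hlow2 hd2 A.2 hA.2
  refine ⟨(A.1 + D1, A.2 + D2), ⟨hD1, hD2⟩, ?_⟩
  have ht : 0 < τ / s := div_pos hτ hs
  have hτt : τ = (τ / s) * s := by field_simp
  set t := τ / s with htdef
  -- first bound
  have b1 : ∀ r, QF G' (Sum.elim (A.1 r) (A.2 r)) ≤ QF G (Sum.elim (A.1 r) (A.2 r)) + 2 * t := by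
    intro r
    have h1 := (abs_le.1 (hd (Sum.elim (A.1 r) (A.2 r)))).2
    have h2 : Sum.elim (A.1 r) (A.2 r) ⬝ᵥ Sum.elim (A.1 r) (A.2 r)
        = A.1 r ⬝ᵥ A.1 r + A.2 r ⬝ᵥ A.2 r := by simp [dotProduct]
    have h3 := hlow1 (A.1 r)
    have h4 := hlow2 (A.2 r)
    rw [diag_QF _ _ hA.1] at h3
    rw [diag_QF _ _ hA.2] at h4
    rw [h2, hτt] at h1
    nlinarith
  have b2 : ∀ r, QF G (Sum.elim (A.1 r) (A.2 r)) ≤ 4 := by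
    intro r
    have := QF_add_le G hG hp 1 one_pos (Sum.elim (A.1 r) 0) (Sum.elim 0 (A.2 r))
    rw [← elim_split, QF_inl, QF_inr, diag_QF _ _ hA.1, diag_QF _ _ hA.2] at this
    linarith
  have b3 : ∀ r, QF G' (Sum.elim ((A.1 + D1) r) ((A.2 + D2) r)) ≤
      QF G (Sum.elim (A.1 r) (A.2 r)) + (4 * t + (1 + t) * (2 * t)) +
        (1 + 1 / t) * (2 * QF G'.toBlocks₁₁ (D1 r) + 2 * QF G'.toBlocks₂₂ (D2 r)) := by
    intro r
    have e : Sum.elim ((A.1 + D1) r) ((A.2 + D2) r)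
        = Sum.elim (A.1 r) (A.2 r) + Sum.elim (D1 r) (D2 r) := by
      ext i; cases i <;> simp
    rw [e]
    have h1 := QF_add_le G' hG' hp' t ht (Sum.elim (A.1 r) (A.2 r)) (Sum.elim (D1 r) (D2 r))
    have h2 := QF_add_le G' hG' hp' 1 one_pos (Sum.elim (D1 r) 0) (Sum.elim 0 (D2 r))
    rw [← elim_split, QF_inl, QF_inr] at h2
    have h3 : (1 + 1/t) * QF G' (Sum.elim (D1 r) (D2 r)) ≤
        (1 + 1 / t) * (2 * QF G'.toBlocks₁₁ (D1 r) + 2 * QF G'.toBlocks₂₂ (D2 r)) := by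
      refine mul_le_mul_of_nonneg_left (by linarith) (by positivity)
    have h4 : (1 + t) * QF G' (Sum.elim (A.1 r) (A.2 r)) ≤
        (1 + t) * (QF G (Sum.elim (A.1 r) (A.2 r)) + 2 * t) :=
      mul_le_mul_of_nonneg_left (b1 r) (by positivity)
    have h5 := mul_le_mul_of_nonneg_left (b2 r) ht.le
    linarith
  have b4 := Finset.sum_le_sum fun r (_ : r ∈ Finset.univ) => b3 r
  refine b4.trans ?_
  have h10 : ∑ r, (1 + 1/t) * (2 * QF G'.toBlocks₁₁ (D1 r) + 2 * QF G'.toBlocks₂₂ (D2 r))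
      = (1 + 1/t) * (2 * ∑ r, QF G'.toBlocks₁₁ (D1 r) + 2 * ∑ r, QF G'.toBlocks₂₂ (D2 r)) := by
    rw [← Finset.mul_sum, Finset.sum_add_distrib, ← Finset.mul_sum, ← Finset.mul_sum]
  rw [Finset.sum_add_distrib, Finset.sum_add_distrib, h10]
  have h6 : (1 + 1/t) * (2 * ∑ r, QF G'.toBlocks₁₁ (D1 r) + 2 * ∑ r, QF G'.toBlocks₂₂ (D2 r))
      ≤ (1 + 1/t) * (4 * k * t^2) :=
    mul_le_mul_of_nonneg_left (by linarith) (by positivity)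
  have h7 : (1 + 1/t) * (4 * k * t^2) = 4 * k * t * (1 + t) := by field_simp; ring
  have h8 : ∑ _r : Fin k, (4 * t + (1 + t) * (2 * t)) = k * (4 * t + (1 + t) * (2 * t)) := by
    rw [Finset.sum_const]; simp only [Finset.card_univ, Fintype.card_fin, nsmul_eq_mul]
  rw [h8]
  unfold objG
  have h9 : (k:ℝ) * t * t ≤ k * t * (1/2) := by
    refine mul_le_mul_of_nonneg_left hts (by positivity)
  nlinarith

lemma aux_sInf {α : Type} (S S' : Set α) (f f' : α → ℝ) (η : ℝ) (hη : 0 ≤ η)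
    (hf : ∀ a, 0 ≤ f a) (hf' : ∀ a, 0 ≤ f' a)
    (h1 : ∀ a ∈ S, ∃ b ∈ S', f' b ≤ f a + η) (h2 : ∀ a ∈ S', ∃ b ∈ S, f b ≤ f' a + η) :
    |sInf (f '' S) - sInf (f' '' S')| ≤ η := by
  rcases S.eq_empty_or_nonempty with rfl | hS
  · have : S' = ∅ := by
      rw [Set.eq_empty_iff_forall_notMem]
      intro a ha
      obtain ⟨b, hb, _⟩ := h2 a ha
      exact hb
    subst this
    simpa using hη
  · have hS' : S'.Nonempty := by
      obtain ⟨a, ha⟩ := hS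
      obtain ⟨b, hb, _⟩ := h1 a ha
      exact ⟨b, hb⟩
    have bd : ∀ (g : α → ℝ) (T : Set α), (∀ a, 0 ≤ g a) → BddBelow (g '' T) := by
      intro g T hg
      exact ⟨0, by rintro _ ⟨a, _, rfl⟩; exact hg a⟩
    rw [abs_le]
    constructor
    · have : sInf (f' '' S') - η ≤ sInf (f '' S) := by
        refine le_csInf (hS.image f) ?_
        rintro _ ⟨a, ha, rfl⟩
        obtain ⟨b, hb, hle⟩ := h1 a ha
        have := csInf_le (bd f' S' hf') (Set.mem_image_of_mem f' hb)
        linarith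
      linarith
    · have : sInf (f '' S) - η ≤ sInf (f' '' S') := by
        refine le_csInf (hS'.image f') ?_
        rintro _ ⟨a, ha, rfl⟩
        obtain ⟨b, hb, hle⟩ := h2 a ha
        have := csInf_le (bd f S hf) (Set.mem_image_of_mem f hb)
        linarith
      linarith

lemma aux_prob {Ω : Type} [MeasurableSpace Ω] (P : Measure Ω) [IsProbabilityMeasure P]
    {κ : Type} [Fintype κ] (Z : Ω → κ → ℝ) (hZ : ∀ c, Measurable fun ω => Z ω c) (R : ℝ)
    (hR : ∀ᵐ ω ∂P, ∑ c, Z ω c ^ 2 ≤ R) (n : ℕ) (hn : 0 < n) (a : ℝ) (ha : 0 < a) :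
    (Measure.pi fun _ : Fin n => P).real
      {xs | a ≤ ∑ c, ((n : ℝ)⁻¹ * ∑ j, Z (xs j) c - ∫ ω, Z ω c ∂P) ^ 2} ≤ R / (n * a) := by
  have hn' : (0:ℝ) < n := by exact_mod_cast hn
  have hL : ∀ c, MemLp (fun ω => Z ω c) 2 P := by
    intro c
    refine MemLp.of_bound (hZ c).aestronglyMeasurable (Real.sqrt R) ?_
    filter_upwards [hR] with ω hω
    refine Real.abs_le_sqrt (le_trans ?_ hω)
    exact Finset.single_le_sum (f := fun c => Z ω c ^ 2) (fun i _ => sq_nonneg _)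
      (Finset.mem_univ c)
  have hLj : ∀ c (j : Fin n), MemLp (fun xs : Fin n → Ω => Z (xs j) c) 2
      (Measure.pi fun _ : Fin n => P) := by
    intro c j
    exact (hL c).comp_measurePreserving (measurePreserving_eval (fun _ : Fin n => P) j)
  have hLg : ∀ c, MemLp (fun xs : Fin n → Ω => (n : ℝ)⁻¹ * ∑ j, Z (xs j) c) 2
      (Measure.pi fun _ : Fin n => P) := by
    intro c
    exact (memLp_finsetSum _ fun j _ => hLj c j).const_mul _
  have hmean : ∀ c, ∫ xs, (n : ℝ)⁻¹ * ∑ j, Z (xs j) c ∂(Measure.pi fun _ : Fin n => P)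
      = ∫ ω, Z ω c ∂P := by
    intro c
    rw [integral_const_mul, integral_finsetSum]
    · have : ∀ j : Fin n, ∫ xs, Z (xs j) c ∂(Measure.pi fun _ : Fin n => P) = ∫ ω, Z ω c ∂P :=
        fun j => integral_comp_eval (μ := fun _ : Fin n => P) (i := j) (f := fun ω => Z ω c)
          (hZ c).aestronglyMeasurable
      simp only [this]
      simp
      field_simp
    · intro j _
      exact (hLj c j).integrable (by norm_num)
  have hvar : ∀ c, ∫ xs, ((n : ℝ)⁻¹ * ∑ j, Z (xs j) c - ∫ ω, Z ω c ∂P) ^ 2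
      ∂(Measure.pi fun _ : Fin n => P) ≤ (n:ℝ)⁻¹ * ∫ ω, Z ω c ^ 2 ∂P := by
    intro c
    have h1 := ProbabilityTheory.variance_eq_integral (hLg c).aemeasurable
    rw [hmean c] at h1
    rw [← h1, ProbabilityTheory.variance_const_mul]
    have h2 := ProbabilityTheory.variance_sum_pi (μ := fun _ : Fin n => P)
      (X := fun _ ω => Z ω c) (fun _ => hL c)
    have h3 : (∑ i : Fin n, fun ω : Fin n → Ω => Z (ω i) c) = fun ω => ∑ j, Z (ω j) c := by
      ext; simp
    rw [h3] at h2
    rw [h2]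
    have h4 := ProbabilityTheory.variance_le_expectation_sq (μ := P)
      (hZ c).aestronglyMeasurable
    simp only [Pi.pow_apply] at h4
    simp only [Finset.sum_const, Finset.card_univ, Fintype.card_fin, nsmul_eq_mul]
    have : ((n:ℝ)⁻¹)^2 * (n * ProbabilityTheory.variance (fun ω => Z ω c) P)
        = (n:ℝ)⁻¹ * ProbabilityTheory.variance (fun ω => Z ω c) P := by field_simp
    rw [this]
    exact mul_le_mul_of_nonneg_left h4 (by positivity)
  have hint : ∀ c, Integrable (fun xs : Fin n → Ω =>
      ((n : ℝ)⁻¹ * ∑ j, Z (xs j) c - ∫ ω, Z ω c ∂P) ^ 2) (Measure.pi fun _ : Fin n => P) := by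
    intro c
    exact ((hLg c).sub (memLp_const _)).integrable_sq
  have hM := mul_meas_ge_le_integral_of_nonneg
    (μ := (Measure.pi fun _ : Fin n => P))
    (f := fun xs => ∑ c, ((n : ℝ)⁻¹ * ∑ j, Z (xs j) c - ∫ ω, Z ω c ∂P) ^ 2)
    (Filter.Eventually.of_forall fun xs => Finset.sum_nonneg fun c _ => sq_nonneg _)
    (integrable_finsetSum _ fun c _ => hint c) a
  rw [integral_finsetSum _ fun c _ => hint c] at hM
  have h5 := hM.trans (Finset.sum_le_sum fun c _ => hvar c)
  rw [← Finset.mul_sum, ← integral_finsetSum _ fun c _ => (hL c).integrable_sq] at h5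
  have h6 : ∫ ω, ∑ c, Z ω c ^ 2 ∂P ≤ R := by
    have := integral_mono_ae (integrable_finsetSum _ fun c _ => (hL c).integrable_sq)
      (integrable_const R) hR
    simpa using this
  have h7 := h5.trans (mul_le_mul_of_nonneg_left h6 (by positivity))
  rw [le_div_iff₀ (by positivity)]
  have h8 := mul_le_mul_of_nonneg_left h7 hn'.le
  rw [mul_inv_cancel_left₀ hn'.ne'] at h8
  linarith

/-- empirical second-moment matrix -/
noncomputable def gramM {ι : Type} {n : ℕ} (y : Fin n → ι → ℝ) : Matrix ι ι ℝ :=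
  Matrix.of fun a b => (n:ℝ)⁻¹ * ∑ j, y j a * y j b

lemma QF_gramM {ι : Type} [Fintype ι] {n : ℕ} (y : Fin n → ι → ℝ) (w : ι → ℝ) :
    QF (gramM y) w = (n:ℝ)⁻¹ * ∑ j, (∑ a, w a * y j a) ^ 2 := by
  rw [QF_eq_sum]
  simp only [gramM, of_apply, sq, Finset.sum_mul_sum]
  simp only [Finset.mul_sum, Finset.sum_mul]
  rw [Finset.sum_comm' (t' := Finset.univ) (s' := fun _ => Finset.univ) (by simp)]
  conv_rhs => rw [Finset.sum_comm]
  rw [Finset.sum_comm]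
  refine Finset.sum_congr rfl fun a _ => ?_
  conv_rhs => rw [Finset.sum_comm]
  refine Finset.sum_congr rfl fun b _ => ?_
  refine Finset.sum_congr rfl fun j _ => ?_
  ring

lemma aux_det {ι : Type} [Fintype ι] {n : ℕ} (hn : 0 < n) (y y' : Fin n → ι → ℝ)
    (hy' : ∀ j a, y' j a = y j a - (n:ℝ)⁻¹ * ∑ i, y i a)
    (G : Matrix ι ι ℝ) (τ : ℝ) (hτ : 0 < τ)
    (h1 : ∑ c : ι × ι, ((n:ℝ)⁻¹ * ∑ j, y j c.1 * y j c.2 - G c.1 c.2) ^ 2 ≤ (τ/2) ^ 2)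
    (h2 : ∑ a, ((n:ℝ)⁻¹ * ∑ j, y j a) ^ 2 ≤ τ / 2) (w : ι → ℝ) :
    |QF (gramM y') w - QF G w| ≤ τ * (w ⬝ᵥ w) := by
  have hn' : (0:ℝ) < n := by exact_mod_cast hn
  set m : ι → ℝ := fun a => (n:ℝ)⁻¹ * ∑ j, y j a with hm
  have e1 : ∀ a b, gramM y' a b = (n:ℝ)⁻¹ * ∑ j, y j a * y j b - m a * m b := by
    intro a b
    have ha : ∑ j, y j a = n * m a := by simp only [hm]; field_simp
    have hb : ∑ j, y j b = n * m b := by simp only [hm]; field_simp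
    simp only [gramM, of_apply, hy']
    have : ∀ j, (y j a - (n:ℝ)⁻¹ * ∑ i, y i a) * (y j b - (n:ℝ)⁻¹ * ∑ i, y i b)
        = y j a * y j b - m a * y j b - y j a * m b + m a * m b := by
      intro j; simp only [hm]; ring
    rw [Finset.sum_congr rfl fun j _ => this j]
    simp only [Finset.sum_add_distrib, Finset.sum_sub_distrib, ← Finset.mul_sum,
      ← Finset.sum_mul, ha, hb, Finset.sum_const, Finset.card_univ, Fintype.card_fin,
      nsmul_eq_mul]
    field_simp
    ring
  set T := ∑ c : ι × ι, ((n:ℝ)⁻¹ * ∑ j, y j c.1 * y j c.2 - G c.1 c.2) * (w c.1 * w c.2) with hT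
  have e2 : QF (gramM y') w - QF G w = T - (∑ a, w a * m a) ^ 2 := by
    rw [QF_eq_sum, QF_eq_sum, hT, Fintype.sum_prod_type, sq, Finset.sum_mul_sum,
      ← Finset.sum_sub_distrib, ← Finset.sum_sub_distrib]
    refine Finset.sum_congr rfl fun a _ => ?_
    rw [← Finset.sum_sub_distrib, ← Finset.sum_sub_distrib]
    refine Finset.sum_congr rfl fun b _ => ?_
    rw [e1]; ring
  have hw : 0 ≤ w ⬝ᵥ w := Finset.sum_nonneg fun i _ => mul_self_nonneg _
  have hT2 : T ^ 2 ≤ (τ / 2 * (w ⬝ᵥ w)) ^ 2 := by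
    have := Finset.sum_mul_sq_le_sq_mul_sq (Finset.univ : Finset (ι × ι))
      (fun c => ((n:ℝ)⁻¹ * ∑ j, y j c.1 * y j c.2 - G c.1 c.2)) (fun c => w c.1 * w c.2)
    have e : ∑ c : ι × ι, (w c.1 * w c.2) ^ 2 = (w ⬝ᵥ w) ^ 2 := by
      rw [Fintype.sum_prod_type, sq, dotProduct, Finset.sum_mul_sum]
      refine Finset.sum_congr rfl fun a _ => Finset.sum_congr rfl fun b _ => ?_
      ring
    rw [e] at this
    rw [mul_pow]
    exact this.trans (mul_le_mul_of_nonneg_right h1 (sq_nonneg _))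
  have hTa := abs_le_of_sq_le_sq hT2 (by positivity)
  have hS : (∑ a, w a * m a) ^ 2 ≤ τ / 2 * (w ⬝ᵥ w) := by
    have := Finset.sum_mul_sq_le_sq_mul_sq (Finset.univ : Finset ι) w m
    have e : ∑ a, w a ^ 2 = w ⬝ᵥ w := by simp [dotProduct, sq]
    rw [e] at this
    nlinarith
  rw [e2, abs_le]
  have := sq_nonneg (∑ a, w a * m a)
  have := abs_le.1 (show |T| ≤ _ from hTa)
  constructor <;> linarith

lemma aux_rank {d k : ℕ} (A : Matrix (Fin k) (Fin d) ℝ) (G : Matrix (Fin d) (Fin d) ℝ)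
    (h : A * G * Aᵀ = 1) : k ≤ d := by
  have h1 : (A * G * Aᵀ).rank = k := by rw [h]; simp
  have h2 := Matrix.rank_mul_le_left A (G * Aᵀ)
  rw [← Matrix.mul_assoc, h1] at h2
  exact h2.trans (by simpa using A.rank_le_card_width)

set_option maxHeartbeats 4000000 in
/-- MCA sample complexity: Fix `p ∈ (0,1]`. There exists `C = C(p) > 0` such
that the following holds. Let `X = [X₁; X₂]` satisfy `‖X - 𝔼X‖_{2,∞} ≤ β` a.s. and
`minᵢ λ_min(Σ_{Xᵢ}) ≥ σ² > 0` (encoded by `(Σᵢ - σ² I).PosSemidef`). Then for every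
`ε ∈ (0,1]`, if `n ≥ C((d₁+d₂)(k/ε²) log(k/ε²) + (β/(εσ))⁴ log(d₁+d₂))`, then with
probability at least `1 - p` over `n` i.i.d. samples,
`|min_{S_{X̂}} f_{X̂} - min_{S_X} f_X| ≤ ε β²/σ²` (minima as `sInf` of image sets). -/
theorem mca_sample_complexity (p : ℝ) (hp : 0 < p) (hp1 : p ≤ 1) :
    ∃ C : ℝ, 0 < C ∧
      ∀ (Ω : Type) [MeasurableSpace Ω] (P : Measure Ω) [IsProbabilityMeasure P]
        (d₁ d₂ k n : ℕ)
        (X : Ω → (Fin d₁ → ℝ) × (Fin d₂ → ℝ)), Measurable X → Integrable X P →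
      ∀ (β σ ε : ℝ), 0 < σ → 0 < ε → ε ≤ 1 →
      ∀ (μ₁ : Fin d₁ → ℝ), μ₁ = ∫ ω, (X ω).1 ∂P →
      ∀ (μ₂ : Fin d₂ → ℝ), μ₂ = ∫ ω, (X ω).2 ∂P →
      (∀ᵐ ω ∂P,
        max (Real.sqrt (∑ a, ((X ω).1 a - μ₁ a) ^ 2))
            (Real.sqrt (∑ a, ((X ω).2 a - μ₂ a) ^ 2)) ≤ β) →
      ∀ (Sig₁ : Matrix (Fin d₁) (Fin d₁) ℝ),
        Sig₁ = Matrix.of (fun a b => ∫ ω, ((X ω).1 a - μ₁ a) * ((X ω).1 b - μ₁ b) ∂P) →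
      ∀ (Sig₂ : Matrix (Fin d₂) (Fin d₂) ℝ),
        Sig₂ = Matrix.of (fun a b => ∫ ω, ((X ω).2 a - μ₂ a) * ((X ω).2 b - μ₂ b) ∂P) →
      (Sig₁ - σ ^ 2 • (1 : Matrix (Fin d₁) (Fin d₁) ℝ)).PosSemidef →
      (Sig₂ - σ ^ 2 • (1 : Matrix (Fin d₂) (Fin d₂) ℝ)).PosSemidef →
      ∀ (fX : Matrix (Fin k) (Fin d₁) ℝ × Matrix (Fin k) (Fin d₂) ℝ → ℝ),
        (∀ A : Matrix (Fin k) (Fin d₁) ℝ × Matrix (Fin k) (Fin d₂) ℝ,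
          fX A = ∫ ω, ∑ i, ((A.1 *ᵥ ((X ω).1 - μ₁) - A.2 *ᵥ ((X ω).2 - μ₂)) i) ^ 2 ∂P) →
      ∀ (SX : Set (Matrix (Fin k) (Fin d₁) ℝ × Matrix (Fin k) (Fin d₂) ℝ)),
        SX = {A | A.1 * Sig₁ * A.1ᵀ = 1 ∧ A.2 * Sig₂ * A.2ᵀ = 1} →
      C * (((d₁ : ℝ) + (d₂ : ℝ)) * ((k : ℝ) / ε ^ 2) * Real.log ((k : ℝ) / ε ^ 2)
            + (β / (ε * σ)) ^ 4 * Real.log ((d₁ : ℝ) + (d₂ : ℝ))) ≤ (n : ℝ) →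
      ENNReal.ofReal (1 - p)
        ≤ (Measure.pi fun _ : Fin n => P)
          {xs | |sInf (empObj n d₁ d₂ k (fun j => (X (xs j)).1) (fun j => (X (xs j)).2) ''
                    empFeasible n d₁ d₂ k (fun j => (X (xs j)).1) (fun j => (X (xs j)).2))
                - sInf (fX '' SX)| ≤ ε * β ^ 2 / σ ^ 2} := by
  classical
  refine ⟨102400 / p, by positivity, ?_⟩
  intro Ω _ P _ d₁ d₂ k n X hXm hXi β σ ε hσ hε hε1 μ₁ hμ₁ μ₂ hμ₂ hβ Sig₁ hSig₁ Sig₂ hSig₂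
    hps₁ hps₂ fX hfX SX hSX hn
  by_cases hdeg : 1 ≤ k ∧ k ≤ d₁ ∧ k ≤ d₂
  swap
  · -- degenerate case
    have hz : ∀ (S : Set (Matrix (Fin k) (Fin d₁) ℝ × Matrix (Fin k) (Fin d₂) ℝ))
        (f : Matrix (Fin k) (Fin d₁) ℝ × Matrix (Fin k) (Fin d₂) ℝ → ℝ),
        (∀ A ∈ S, k ≤ d₁ ∧ k ≤ d₂) → (k = 0 → ∀ A, f A = 0) → sInf (f '' S) = 0 := by
      intro S f h1 h2
      rcases S.eq_empty_or_nonempty with rfl | ⟨A, hA⟩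
      · simp
      · have hk : k = 0 := by
          have := h1 A hA
          by_contra h
          exact hdeg ⟨by omega, this⟩
        have : f '' S = {0} := by
          ext x
          constructor
          · rintro ⟨a, _, rfl⟩; exact h2 hk a
          · intro hx; exact ⟨A, hA, by rw [h2 hk A]; exact hx.symm⟩
        rw [this]; simp
    have hev : {xs : Fin n → Ω | |sInf (empObj n d₁ d₂ k (fun j => (X (xs j)).1) (fun j => (X (xs j)).2) ''
                    empFeasible n d₁ d₂ k (fun j => (X (xs j)).1) (fun j => (X (xs j)).2))
                - sInf (fX '' SX)| ≤ ε * β ^ 2 / σ ^ 2} = Set.univ := by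
      rw [Set.eq_univ_iff_forall]
      intro xs
      rw [Set.mem_ofPred_eq, hz (empFeasible n d₁ d₂ k (fun j => (X (xs j)).1) (fun j => (X (xs j)).2))
          (empObj n d₁ d₂ k (fun j => (X (xs j)).1) (fun j => (X (xs j)).2))
          (fun A hA => ⟨aux_rank _ _ hA.1, aux_rank _ _ hA.2⟩)
          (by rintro rfl A; simp [empObj]),
        hz SX fX (by rw [hSX]; exact fun A hA => ⟨aux_rank _ _ hA.1, aux_rank _ _ hA.2⟩)
          (by rintro rfl A; simp [hfX])]
      simp only [sub_zero, abs_zero]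
      positivity
    rw [hev, measure_univ]
    exact ENNReal.ofReal_le_one.2 (by linarith)
  obtain ⟨hk1, hkd₁, hkd₂⟩ := hdeg
  set Y : Ω → Fin d₁ ⊕ Fin d₂ → ℝ := fun ω =>
    Sum.elim (fun a => (X ω).1 a - μ₁ a) (fun a => -((X ω).2 a - μ₂ a)) with hY
  set G : Matrix (Fin d₁ ⊕ Fin d₂) (Fin d₁ ⊕ Fin d₂) ℝ :=
    Matrix.of fun a b => ∫ ω, Y ω a * Y ω b ∂P with hG
  have hYm : ∀ c, Measurable fun ω => Y ω c := by
    rintro (a | a)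
    · simp only [hY, Sum.elim_inl]; fun_prop
    · simp only [hY, Sum.elim_inr]; fun_prop
  have hb1 : ∀ᵐ ω ∂P, ∑ a, ((X ω).1 a - μ₁ a) ^ 2 ≤ β ^ 2 := by
    filter_upwards [hβ] with ω hω
    exact (Real.sqrt_le_iff.1 ((le_max_left _ _).trans hω)).2
  have hb2 : ∀ᵐ ω ∂P, ∑ a, ((X ω).2 a - μ₂ a) ^ 2 ≤ β ^ 2 := by
    filter_upwards [hβ] with ω hω
    exact (Real.sqrt_le_iff.1 ((le_max_right _ _).trans hω)).2
  have hYb : ∀ᵐ ω ∂P, ∑ c, Y ω c ^ 2 ≤ 2 * β ^ 2 := by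
    filter_upwards [hb1, hb2] with ω h1 h2
    simp only [hY, Fintype.sum_sum_type, Sum.elim_inl, Sum.elim_inr, neg_sq]
    linarith
  have hYYb : ∀ᵐ ω ∂P, ∑ c : (Fin d₁ ⊕ Fin d₂) × (Fin d₁ ⊕ Fin d₂), (Y ω c.1 * Y ω c.2) ^ 2
      ≤ 4 * β ^ 4 := by
    filter_upwards [hYb] with ω h1
    have e : ∑ c : (Fin d₁ ⊕ Fin d₂) × (Fin d₁ ⊕ Fin d₂), (Y ω c.1 * Y ω c.2) ^ 2
        = (∑ c, Y ω c ^ 2) ^ 2 := by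
      rw [Fintype.sum_prod_type, sq, Finset.sum_mul_sum]
      simp only [mul_pow]
    rw [e]
    have h0 : 0 ≤ ∑ c, Y ω c ^ 2 := Finset.sum_nonneg fun c _ => sq_nonneg _
    nlinarith
  have hYYi : ∀ a b, Integrable (fun ω => Y ω a * Y ω b) P := by
    intro a b
    refine Integrable.of_bound ((hYm a).mul (hYm b)).aestronglyMeasurable (Real.sqrt (4 * β^4)) ?_
    filter_upwards [hYYb] with ω hω
    refine Real.abs_le_sqrt (le_trans ?_ hω)
    exact Finset.single_le_sum (f := fun c : (Fin d₁ ⊕ Fin d₂) × (Fin d₁ ⊕ Fin d₂) =>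
      (Y ω c.1 * Y ω c.2) ^ 2) (fun i _ => sq_nonneg _) (Finset.mem_univ (a, b))
  have hQG : ∀ w, QF G w = ∫ ω, (∑ a, w a * Y ω a) ^ 2 ∂P := by
    intro w
    rw [QF_eq_sum]
    have e : ∀ ω, (∑ a, w a * Y ω a) ^ 2 = ∑ a, ∑ b, (w a * w b) * (Y ω a * Y ω b) := by
      intro ω
      rw [sq, Finset.sum_mul_sum]
      refine Finset.sum_congr rfl fun a _ => Finset.sum_congr rfl fun b _ => ?_
      ring
    simp only [e]
    rw [integral_finsetSum _ fun a _ => integrable_finsetSum _ fun b _ =>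
      (hYYi a b).const_mul _]
    refine Finset.sum_congr rfl fun a _ => ?_
    rw [integral_finsetSum _ fun b _ => (hYYi a b).const_mul _]
    refine Finset.sum_congr rfl fun b _ => ?_
    rw [integral_const_mul, hG, of_apply]; ring
  have hint2 : ∀ w : Fin d₁ ⊕ Fin d₂ → ℝ, Integrable (fun ω => (∑ a, w a * Y ω a) ^ 2) P := by
    intro w
    have e : ∀ ω, (∑ a, w a * Y ω a) ^ 2 = ∑ a, ∑ b, (w a * w b) * (Y ω a * Y ω b) := by
      intro ω
      rw [sq, Finset.sum_mul_sum]
      refine Finset.sum_congr rfl fun a _ => Finset.sum_congr rfl fun b _ => ?_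
      ring
    simp only [e]
    exact integrable_finsetSum _ fun a _ => integrable_finsetSum _ fun b _ =>
      (hYYi a b).const_mul _
  have hG11 : G.toBlocks₁₁ = Sig₁ := by rw [hSig₁]; ext a b; simp [hG, hY, toBlocks₁₁]
  have hG22 : G.toBlocks₂₂ = Sig₂ := by
    rw [hSig₂]; ext a b
    simp only [hG, hY, toBlocks₂₂, of_apply, Sum.elim_inr, neg_mul_neg]
  have hGs : Gᵀ = G := by ext a b; simp [hG, mul_comm]
  have hGp : ∀ w, 0 ≤ QF G w := fun w => by
    rw [hQG]; exact integral_nonneg fun ω => sq_nonneg _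
  have hobj : fX = objG G := by
    funext A
    rw [hfX, objG]
    simp only [hQG]
    rw [← integral_finsetSum _ fun r _ => hint2 _]
    congr 1
    funext ω
    refine Finset.sum_congr rfl fun r _ => ?_
    congr 1
    simp [hY, mulVec, dotProduct, sub_eq_add_neg]
    rw [← Finset.sum_neg_distrib]
    exact Finset.sum_congr rfl fun a _ => by ring
  have hfeas : SX = feasG k G := by rw [hSX, feasG, hG11, hG22]
  have hlowgen : ∀ (d : ℕ) (S : Matrix (Fin d) (Fin d) ℝ),
      (S - σ ^ 2 • (1 : Matrix (Fin d) (Fin d) ℝ)).PosSemidef →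
      ∀ w, σ ^ 2 * (w ⬝ᵥ w) ≤ QF S w := by
    intro d S hS w
    have := hS.dotProduct_mulVec_nonneg w
    rw [sub_mulVec, smul_mulVec, one_mulVec, dotProduct_sub, dotProduct_smul] at this
    simp only [star_trivial, smul_eq_mul] at this
    rw [QF]; linarith
  have hlow1 : ∀ w, σ ^ 2 * (w ⬝ᵥ w) ≤ QF G.toBlocks₁₁ w := by
    rw [hG11]; exact hlowgen _ _ hps₁
  have hlow2 : ∀ w, σ ^ 2 * (w ⬝ᵥ w) ≤ QF G.toBlocks₂₂ w := by
    rw [hG22]; exact hlowgen _ _ hps₂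
  -- dimension bound
  have hdim : (d₁ : ℝ) * σ ^ 2 ≤ β ^ 2 := by
    have h1 : ∀ a : Fin d₁, σ ^ 2 ≤ ∫ ω, ((X ω).1 a - μ₁ a) ^ 2 ∂P := by
      intro a
      have := hlow1 (Pi.single a 1)
      rw [hG11, hSig₁, QF] at this
      simpa [sq] using this
    have hi : ∀ a : Fin d₁, Integrable (fun ω => ((X ω).1 a - μ₁ a) ^ 2) P := by
      intro a
      have := hYYi (Sum.inl a) (Sum.inl a)
      simpa [hY, sq] using this
    have h2 := Finset.sum_le_sum fun a (_ : a ∈ Finset.univ) => h1 a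
    rw [← integral_finsetSum _ fun a _ => hi a] at h2
    have h3 := integral_mono_ae (integrable_finsetSum Finset.univ fun a _ => hi a)
      (integrable_const (β ^ 2)) hb1
    simp at h2 h3
    linarith
  have hkR : (k:ℝ) * σ ^ 2 ≤ β ^ 2 := by
    refine le_trans ?_ hdim
    have : (k:ℝ) ≤ d₁ := by exact_mod_cast hkd₁
    gcongr
  have hk1' : (1:ℝ) ≤ k := by exact_mod_cast hk1
  have hσ2 : 0 < σ ^ 2 := by positivity
  have hσβ : σ ^ 2 ≤ β ^ 2 := by nlinarith
  -- sample size
  have hnn : 51200 * β ^ 4 ≤ p * (n * (ε ^ 4 * σ ^ 4)) := by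
    have h1 : 0 ≤ ((d₁ : ℝ) + (d₂ : ℝ)) * ((k : ℝ) / ε ^ 2) * Real.log ((k : ℝ) / ε ^ 2) := by
      refine mul_nonneg (by positivity) (Real.log_nonneg ?_)
      rw [le_div_iff₀ (by positivity)]
      nlinarith
    have h2 : (1/2 : ℝ) ≤ Real.log ((d₁ : ℝ) + (d₂ : ℝ)) := by
      have h3 : (2:ℝ) ≤ (d₁ : ℝ) + (d₂ : ℝ) := by
        have : 2 ≤ d₁ + d₂ := by omega
        exact_mod_cast this
      have := Real.log_le_log (by norm_num) h3
      have := Real.log_two_gt_d9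
      linarith
    have h3 : (102400 / p) * ((β / (ε * σ)) ^ 4 * (1 / 2)) ≤ n := by
      refine le_trans ?_ hn
      refine mul_le_mul_of_nonneg_left ?_ (by positivity)
      have : (β / (ε * σ)) ^ 4 * (1 / 2) ≤ (β / (ε * σ)) ^ 4 * Real.log ((d₁ : ℝ) + (d₂ : ℝ)) :=
        mul_le_mul_of_nonneg_left h2 (by positivity)
      linarith
    have e : (102400 / p) * ((β / (ε * σ)) ^ 4 * (1 / 2))
        = 51200 * β ^ 4 / (p * (ε ^ 4 * σ ^ 4)) := by field_simp; ring
    rw [e, div_le_iff₀ (by positivity)] at h3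
    linarith
  have hβ4 : 0 < β ^ 4 := by
    have : 0 < β ^ 2 := by linarith
    nlinarith
  have hn0 : 0 < n := by
    rcases Nat.eq_zero_or_pos n with h | h
    · rw [h] at hnn; simp at hnn; linarith
    · exact h
  have hn0' : (0:ℝ) < n := by exact_mod_cast hn0
  set τ := ε * σ ^ 2 / 40 with hτ
  have hτ0 : 0 < τ := by positivity
  have hP1 := aux_prob P (fun ω (c : (Fin d₁ ⊕ Fin d₂) × (Fin d₁ ⊕ Fin d₂)) => Y ω c.1 * Y ω c.2)
    (fun c => (hYm c.1).mul (hYm c.2)) _ hYYb n hn0 ((τ / 2) ^ 2) (by positivity)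
  have hP2 := aux_prob P Y hYm _ hYb n hn0 (τ / 2) (by positivity)
  have hε2 : ε ^ 2 ≤ 1 := by nlinarith
  have hε3 : ε ^ 3 ≤ 1 := pow_le_one₀ hε.le hε1
  have hq1 : 4 * β ^ 4 / (n * (τ / 2) ^ 2) ≤ p / 2 := by
    rw [div_le_iff₀ (by positivity)]
    have e : p / 2 * (n * (τ / 2) ^ 2) = p * (n * (ε ^ 2 * σ ^ 4)) / 12800 := by rw [hτ]; ring
    rw [e]
    have : p * (n * (ε ^ 4 * σ ^ 4)) ≤ p * (n * (ε ^ 2 * σ ^ 4)) := by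
      have : ε ^ 4 ≤ ε ^ 2 := by nlinarith [sq_nonneg ε]
      gcongr
    linarith
  have hq2 : 2 * β ^ 2 / (n * (τ / 2)) ≤ p / 2 := by
    rw [div_le_iff₀ (by positivity)]
    have e : p / 2 * (n * (τ / 2)) = p * (n * (ε * σ ^ 2)) / 160 := by rw [hτ]; ring
    rw [e]
    have h1 : p * (n * (ε ^ 4 * σ ^ 4)) ≤ p * (n * (ε * (σ ^ 2 * β ^ 2))) := by
      have : ε ^ 4 ≤ ε := by nlinarith
      have h4 : σ ^ 4 ≤ σ ^ 2 * β ^ 2 := by nlinarith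
      gcongr
    have h2 : (51200 * β ^ 2) * β ^ 2 ≤ (p * (n * (ε * σ ^ 2))) * β ^ 2 := by nlinarith
    have h3 := le_of_mul_le_mul_right h2 (by linarith)
    linarith [sq_nonneg β]
  have hmean : ∀ c, ∫ ω, Y ω c ∂P = 0 := by
    have hi1 : Integrable (fun ω => (X ω).1) P := hXi.fst
    have hi2 : Integrable (fun ω => (X ω).2) P := hXi.snd
    rintro (a | a)
    · simp only [hY, Sum.elim_inl]
      rw [integral_sub (hi1.eval a) (integrable_const _), hμ₁,
        eval_integral (fun i => hi1.eval i)]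
      simp
    · simp only [hY, Sum.elim_inr]
      rw [integral_neg, integral_sub (hi2.eval a) (integrable_const _), hμ₂,
        eval_integral (fun i => hi2.eval i)]
      simp
  simp only [hmean, sub_zero] at hP2
  set E1 := {xs : Fin n → Ω | (τ / 2) ^ 2 ≤ ∑ c : (Fin d₁ ⊕ Fin d₂) × (Fin d₁ ⊕ Fin d₂),
    ((n : ℝ)⁻¹ * ∑ j, Y (xs j) c.1 * Y (xs j) c.2 - ∫ ω, Y ω c.1 * Y ω c.2 ∂P) ^ 2} with hE1
  set E2 := {xs : Fin n → Ω | τ / 2 ≤ ∑ c, ((n : ℝ)⁻¹ * ∑ j, Y (xs j) c) ^ 2} with hE2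
  set T := {xs : Fin n → Ω | |sInf (empObj n d₁ d₂ k (fun j => (X (xs j)).1) (fun j => (X (xs j)).2) ''
                    empFeasible n d₁ d₂ k (fun j => (X (xs j)).1) (fun j => (X (xs j)).2))
                - sInf (fX '' SX)| ≤ ε * β ^ 2 / σ ^ 2} with hT
  have hcover : (Set.univ : Set (Fin n → Ω)) ⊆ T ∪ (E1 ∪ E2) := by
    intro xs _
    by_cases hx1 : xs ∈ E1
    · exact Or.inr (Or.inl hx1)
    by_cases hx2 : xs ∈ E2
    · exact Or.inr (Or.inr hx2)
    left
    rw [hE1, Set.mem_ofPred_eq, not_le] at hx1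
    rw [hE2, Set.mem_ofPred_eq, not_le] at hx2
    set y' : Fin n → Fin d₁ ⊕ Fin d₂ → ℝ := fun j =>
      Sum.elim (fun a => (X (xs j)).1 a - empMean n d₁ (fun j => (X (xs j)).1) a)
        (fun a => -((X (xs j)).2 a - empMean n d₂ (fun j => (X (xs j)).2) a)) with hy'
    have hd := aux_det hn0 (fun j => Y (xs j)) y' (by
        rintro j (a | a)
        · simp [hy', hY, empMean, Finset.sum_sub_distrib]
          field_simp; ring
        · simp [hy', hY, empMean, Finset.sum_sub_distrib]
          field_simp; ring) G τ hτ0 hx1.le hx2.le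
    have hH11 : (gramM y').toBlocks₁₁ = empCov n d₁ (fun j => (X (xs j)).1) := by
      ext a b; simp [gramM, hy', toBlocks₁₁, empCov]
    have hH22 : (gramM y').toBlocks₂₂ = empCov n d₂ (fun j => (X (xs j)).2) := by
      ext a b; simp only [gramM, hy', toBlocks₂₂, empCov, of_apply, Sum.elim_inr, neg_mul_neg]
    have hHs : (gramM y')ᵀ = gramM y' := by ext a b; simp [gramM, mul_comm]
    have hHp : ∀ w, 0 ≤ QF (gramM y') w := fun w => by
      rw [QF_gramM]; exact mul_nonneg (by positivity) (Finset.sum_nonneg fun j _ => sq_nonneg _)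
    have hHobj : empObj n d₁ d₂ k (fun j => (X (xs j)).1) (fun j => (X (xs j)).2)
        = objG (gramM y') := by
      funext A
      rw [objG, empObj]
      simp only [QF_gramM]
      rw [← Finset.mul_sum, Finset.sum_comm]
      congr 1
      refine Finset.sum_congr rfl fun r _ => Finset.sum_congr rfl fun j _ => ?_
      congr 1
      simp [hy', mulVec, dotProduct, sub_eq_add_neg]
      rw [← Finset.sum_neg_distrib]
      exact Finset.sum_congr rfl fun a _ => by ring
    have hHfeas : empFeasible n d₁ d₂ k (fun j => (X (xs j)).1) (fun j => (X (xs j)).2)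
        = feasG k (gramM y') := by rw [feasG, empFeasible, hH11, hH22]
    rw [hT, Set.mem_ofPred_eq, hHobj, hHfeas, hobj, hfeas]
    have hts : τ / (σ ^ 2 / 2) = ε / 20 := by rw [hτ]; field_simp; norm_num
    have hη : 13 * (k:ℝ) * (τ / (σ ^ 2 / 2)) ≤ ε * β ^ 2 / σ ^ 2 := by
      rw [hts, le_div_iff₀ hσ2]
      have := mul_le_mul_of_nonneg_left hkR hε.le
      have : 0 ≤ ε * (k * σ ^ 2) := by positivity
      nlinarith
    have hww : ∀ (d : ℕ) (w : Fin d → ℝ), 0 ≤ w ⬝ᵥ w := fun d w =>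
      Finset.sum_nonneg fun i _ => mul_self_nonneg _
    have hτσ : τ ≤ σ ^ 2 / 2 := by rw [hτ]; nlinarith
    refine aux_sInf _ _ _ _ _ (by positivity) (fun A => Finset.sum_nonneg fun r _ => hHp _)
      (fun A => Finset.sum_nonneg fun r _ => hGp _) ?_ ?_
    · intro A hA
      obtain ⟨A', h1, h2⟩ := aux_perturb (gramM y') G hHs hHp hGs hGp (σ ^ 2 / 2) τ (by positivity)
        hτ0 (by rw [hts]; linarith) (fun w => by
          have h1 := (abs_le.1 (hd (Sum.elim w 0))).1
          rw [QF_inl, QF_inl] at h1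
          have h2 : Sum.elim w (0 : Fin d₂ → ℝ) ⬝ᵥ Sum.elim w (0 : Fin d₂ → ℝ) = w ⬝ᵥ w := by
            simp [dotProduct]
          rw [h2] at h1
          have h3 := hlow1 w
          have := mul_le_mul_of_nonneg_right hτσ (hww _ w)
          linarith) (fun w => by
          have h1 := (abs_le.1 (hd (Sum.elim 0 w))).1
          rw [QF_inr, QF_inr] at h1
          have h2 : Sum.elim (0 : Fin d₁ → ℝ) w ⬝ᵥ Sum.elim (0 : Fin d₁ → ℝ) w = w ⬝ᵥ w := by
            simp [dotProduct]
          rw [h2] at h1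
          have h3 := hlow2 w
          have := mul_le_mul_of_nonneg_right hτσ (hww _ w)
          linarith) (fun w => by rw [abs_sub_comm]; exact hd w) A hA
      exact ⟨A', h1, by linarith⟩
    · intro A hA
      obtain ⟨A', h1, h2⟩ := aux_perturb G (gramM y') hGs hGp hHs hHp (σ ^ 2 / 2) τ (by positivity)
        hτ0 (by rw [hts]; linarith) (fun w => by
          have h3 := hlow1 w
          have := mul_nonneg hσ2.le (hww _ w)
          linarith) (fun w => by
          have h3 := hlow2 w
          have := mul_nonneg hσ2.le (hww _ w)
          linarith) hd A hA
      exact ⟨A', h1, by linarith⟩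
  have hm := measureReal_mono (μ := Measure.pi fun _ : Fin n => P) hcover
  have hm1 := measureReal_union_le (μ := Measure.pi fun _ : Fin n => P) T (E1 ∪ E2)
  have hm2 := measureReal_union_le (μ := Measure.pi fun _ : Fin n => P) E1 E2
  rw [probReal_univ] at hm
  rw [ENNReal.ofReal_le_iff_le_toReal (measure_ne_top _ _)]
  change 1 - p ≤ (Measure.pi fun _ : Fin n => P).real T
  linarith
end

section
/- Let $X = [X_1; X_2]$ be a random vector in $\mathbb{R}^{d_1} \times \mathbb{R}^{d_2}$ with mean $\mu$ such that $\|X - \mu\|_{2,\infty} \le \beta$ almost surely and $\min_{i \in \{1,2\}} \lambda_{\min}(\Sigma_{X_i}) \ge \sigma^2 > 0$. Fix $k \in \mathbb{N}$, $p \in (0,1]$, and $\epsilon \in (0, 2^5]$, and let $\hat{X}$ denote the empirical random vector built from $n$ i.i.d. realizations of $X$. If $n \ge \max\big\{\frac{2^{15}}{\epsilon^2}\big(k(d_1+d_2)\log(\frac{2^{22}k}{\epsilon^2}) + \log(\frac{2}{p})\big),\ \frac{2^{25}}{\epsilon^4}(\frac{\beta}{\sigma})^4\big(\log(2^3(d_1+d_2))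 + \log(\frac{2}{p})\big)\big\}$, then in an event of probability at least $1 - p$, $\big|\min_{A \in S_{\hat{X}}} f_{\hat{X}}(A) - \min_{A \in S_X} f_X(A)\big| \le \epsilon \cdot \frac{\beta^2}{\sigma^2}$. -/
open Matrix MeasureTheory

section conc
variable {E : Type*} [NormedAddCommGroup E] [InnerProductSpace ℝ E]

noncomputable def psiC (s : E) : ℝ := Real.sqrt (1 + ‖s‖ ^ 2)

lemma psiC_pos (s : E) : 1 ≤ psiC s := by
  unfold psiC; rw [Real.one_le_sqrt]; nlinarith [sq_nonneg ‖s‖]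

lemma norm_le_psiC (s : E) : ‖s‖ ≤ psiC s := by
  unfold psiC; apply Real.le_sqrt_of_sq_le; linarith

lemma psiC_add (s x : E) :
    psiC (s + x) ≤ psiC s + inner ℝ ((psiC s)⁻¹ • s) x + ‖x‖ ^ 2 / 2 := by
  have h1 := psiC_pos s
  have hsq : psiC s ^ 2 = 1 + ‖s‖ ^ 2 := Real.sq_sqrt (by positivity)
  have hle : ‖s + x‖ ^ 2 = ‖s‖ ^ 2 + 2 * inner ℝ s x + ‖x‖ ^ 2 := norm_add_sq_real s x
  have hy : 0 ≤ psiC (s + x) := Real.sqrt_nonneg _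
  have hsq2 : psiC (s + x) ^ 2 = 1 + ‖s + x‖ ^ 2 := Real.sq_sqrt (by positivity)
  rw [real_inner_smul_left]
  set p := psiC s
  set q := psiC (s + x)
  have h2 : q ≤ p + p⁻¹ * inner ℝ s x + p⁻¹ * (‖x‖ ^ 2 / 2) := by
    have : 2 * p * q ≤ 2 * p * p + 2 * inner ℝ s x + ‖x‖ ^ 2 := by nlinarith [sq_nonneg (p - q)]
    have hp : 0 < p := by linarith
    have h3 : p + p⁻¹ * inner ℝ s x + p⁻¹ * (‖x‖ ^ 2 / 2)
      = (2 * p * p + 2 * inner ℝ s x + ‖x‖ ^ 2) / (2 * p) := by field_simp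
    rw [h3, le_div_iff₀ (by positivity)]; linarith
  have h4 : p⁻¹ * (‖x‖ ^ 2 / 2) ≤ 1 * (‖x‖ ^ 2 / 2) := by
    gcongr; exact inv_le_one_of_one_le₀ h1
  linarith

variable [FiniteDimensional ℝ E] [MeasurableSpace E] [BorelSpace E]
variable {Ω : Type*} [MeasurableSpace Ω] (P : Measure Ω) [IsProbabilityMeasure P]

lemma conc_step (Z : Ω → E) (hZ : Measurable Z) (B : ℝ) (hB : 0 ≤ B)
    (hb : ∀ᵐ ω ∂P, ‖Z ω‖ ≤ B) (h0 : ∫ ω, Z ω ∂P = 0) (s : E) :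
    ∫⁻ ω, ENNReal.ofReal (Real.exp (psiC (s + Z ω))) ∂P
      ≤ ENNReal.ofReal (Real.exp (psiC s + B ^ 2)) := by
  have h1 := psiC_pos s
  set v := (psiC s)⁻¹ • s with hv
  have hvn : ‖v‖ ≤ 1 := by
    rw [hv, norm_smul, Real.norm_eq_abs, abs_of_nonneg (by positivity)]
    rw [inv_mul_le_iff₀ (by positivity)]; simpa using norm_le_psiC s
  have hint : Integrable Z P := Integrable.of_bound hZ.aestronglyMeasurable B hb
  have hm : Measurable fun ω => (inner ℝ v (Z ω) : ℝ) := by fun_prop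
  have hsub := ProbabilityTheory.hasSubgaussianMGF_of_mem_Icc_of_integral_eq_zero (μ := P)
    (X := fun ω => (inner ℝ v (Z ω) : ℝ)) (a := -B) (b := B) hm.aemeasurable (by
      filter_upwards [hb] with ω hω
      rw [Set.mem_Icc, ← abs_le]
      calc _ ≤ ‖v‖ * ‖Z ω‖ := abs_real_inner_le_norm _ _
        _ ≤ 1 * B := by gcongr
        _ = B := one_mul _) (by rw [integral_inner hint, h0, inner_zero_right])
  have hmgf := hsub.mgf_le 1
  have hi := hsub.integrable_exp_mul 1
  unfold ProbabilityTheory.mgf at hmgf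
  simp only [one_mul] at hmgf hi
  have hc : (((‖B - -B‖₊ / 2) ^ 2 : NNReal) : ℝ) * 1 ^ 2 / 2 = B ^ 2 / 2 := by
    push_cast
    rw [Real.norm_eq_abs, abs_of_nonneg (by linarith)]; ring
  rw [hc] at hmgf
  calc ∫⁻ ω, ENNReal.ofReal (Real.exp (psiC (s + Z ω))) ∂P
      ≤ ∫⁻ ω, ENNReal.ofReal (Real.exp (psiC s + B ^ 2 / 2)) *
          ENNReal.ofReal (Real.exp (inner ℝ v (Z ω))) ∂P := by
        apply lintegral_mono_ae
        filter_upwards [hb] with ω hω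
        rw [← ENNReal.ofReal_mul (by positivity), ← Real.exp_add]
        apply ENNReal.ofReal_le_ofReal
        apply Real.exp_le_exp.2
        have := psiC_add s (Z ω)
        have : ‖Z ω‖ ^ 2 ≤ B ^ 2 := by gcongr
        linarith
    _ = ENNReal.ofReal (Real.exp (psiC s + B ^ 2 / 2)) *
          ENNReal.ofReal (∫ ω, Real.exp (inner ℝ v (Z ω)) ∂P) := by
        rw [lintegral_const_mul _ (by fun_prop), ofReal_integral_eq_lintegral_ofReal hi]
        exact Filter.Eventually.of_forall fun _ => (Real.exp_pos _).le
    _ ≤ ENNReal.ofReal (Real.exp (psiC s + B ^ 2 / 2)) *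
          ENNReal.ofReal (Real.exp (B ^ 2 / 2)) := by gcongr
    _ = _ := by
        rw [← ENNReal.ofReal_mul (by positivity), ← Real.exp_add]; congr 2; ring

lemma measurable_psiC : Measurable (psiC : E → ℝ) := by
  unfold psiC; fun_prop

lemma conc_pi (Z : Ω → E) (hZ : Measurable Z) (B : ℝ) (hB : 0 ≤ B)
    (hb : ∀ᵐ ω ∂P, ‖Z ω‖ ≤ B) (h0 : ∫ ω, Z ω ∂P = 0) (n : ℕ) : ∀ (s : E),
    ∫⁻ xs, ENNReal.ofReal (Real.exp (psiC (s + ∑ j, Z (xs j)))) ∂(Measure.pi fun _ : Fin n => P)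
      ≤ ENNReal.ofReal (Real.exp (psiC s + n * B ^ 2)) := by
  induction n with
  | zero => intro s; simp
  | succ n ih =>
    intro s
    have hmp := (measurePreserving_piFinSuccAbove (fun _ : Fin (n+1) => P) 0).symm
    have hmeas := (measurable_psiC (E := E))
    rw [← hmp.lintegral_comp (by fun_prop)]
    rw [lintegral_prod_symm' _ (by fun_prop)]
    have key : ∀ y : Fin n → Ω, ∫⁻ x, ENNReal.ofReal (Real.exp (psiC (s + ∑ j,
        Z ((MeasurableEquiv.piFinSuccAbove (fun _ : Fin (n+1) => Ω) 0).symm (x, y) j)))) ∂P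
        ≤ ENNReal.ofReal (Real.exp (B ^ 2)) *
          ENNReal.ofReal (Real.exp (psiC (s + ∑ j, Z (y j)))) := by
      intro y
      have := conc_step P Z hZ B hB hb h0 (s + ∑ j, Z (y j))
      rw [← ENNReal.ofReal_mul (by positivity), ← Real.exp_add, add_comm (B ^ 2)]
      convert this using 6 with x
      rw [Fin.sum_univ_succ]
      simp [MeasurableEquiv.piFinSuccAbove]
      abel
    calc _ ≤ ∫⁻ y, ENNReal.ofReal (Real.exp (B ^ 2)) *
          ENNReal.ofReal (Real.exp (psiC (s + ∑ j, Z (y j)))) ∂(Measure.pi fun _ : Fin n => P) :=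
          lintegral_mono key
      _ ≤ ENNReal.ofReal (Real.exp (B ^ 2)) *
          ENNReal.ofReal (Real.exp (psiC s + n * B ^ 2)) := by
          rw [lintegral_const_mul _ (by fun_prop)]
          gcongr; exact ih s
      _ = _ := by
          rw [← ENNReal.ofReal_mul (by positivity), ← Real.exp_add]; congr 2; push_cast; ring

lemma conc_tail (U : Ω → E) (hU : Measurable U) (C : ℝ) (hC : 0 < C)
    (hb : ∀ᵐ ω ∂P, ‖U ω‖ ≤ C) (n : ℕ) (hn : 0 < n) (τ : ℝ) (hτ : 0 ≤ τ) :
    (Measure.pi fun _ : Fin n => P) {xs | τ ≤ ‖(n : ℝ)⁻¹ • ∑ j, (U (xs j) - ∫ ω, U ω ∂P)‖}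
      ≤ ENNReal.ofReal (Real.exp (1 - n * τ ^ 2 / (16 * C ^ 2))) := by
  have hn' : (0 : ℝ) < n := by exact_mod_cast hn
  have hint : Integrable U P := Integrable.of_bound hU.aestronglyMeasurable C hb
  set m := ∫ ω, U ω ∂P with hm
  have hmC : ‖m‖ ≤ C := by
    have := norm_integral_le_of_norm_le_const hb
    simpa using this
  set l : ℝ := τ / (8 * C ^ 2) with hl
  have hl0 : 0 ≤ l := by positivity
  set Z : Ω → E := fun ω => l • (U ω - m) with hZdef
  have hZ : Measurable Z := by fun_prop
  have h0 : ∫ ω, Z ω ∂P = 0 := by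
    rw [hZdef, integral_smul, integral_sub hint (integrable_const _)]
    simp [hm]
  have hZb : ∀ᵐ ω ∂P, ‖Z ω‖ ≤ l * (2 * C) := by
    filter_upwards [hb] with ω hω
    rw [hZdef, norm_smul, Real.norm_eq_abs, abs_of_nonneg hl0]
    gcongr
    linarith [norm_sub_le (U ω) m]
  have hpi := conc_pi P Z hZ _ (by positivity) hZb h0 n 0
  have hψ0 : psiC (0 : E) = 1 := by simp [psiC]
  rw [hψ0] at hpi
  have hmeas := (measurable_psiC (E := E))
  have hmarkov := mul_meas_ge_le_lintegral₀ (μ := Measure.pi fun _ : Fin n => P)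
    (f := fun xs => ENNReal.ofReal (Real.exp (psiC (0 + ∑ j, Z (xs j)))))
    (Measurable.aemeasurable (by fun_prop))
    (ENNReal.ofReal (Real.exp (l * (n * τ))))
  have hsubset : {xs : Fin n → Ω | τ ≤ ‖(n : ℝ)⁻¹ • ∑ j, (U (xs j) - m)‖} ⊆
      {xs | ENNReal.ofReal (Real.exp (l * (n * τ))) ≤
        ENNReal.ofReal (Real.exp (psiC (0 + ∑ j, Z (xs j))))} := by
    intro xs hxs
    simp only [Set.mem_ofPred_eq] at hxs ⊢
    apply ENNReal.ofReal_le_ofReal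
    apply Real.exp_le_exp.2
    refine le_trans ?_ (norm_le_psiC _)
    rw [zero_add, hZdef, ← Finset.smul_sum, norm_smul, Real.norm_eq_abs, abs_of_nonneg hl0]
    rw [norm_smul, Real.norm_eq_abs, abs_of_nonneg (by positivity), le_inv_mul_iff₀ hn'] at hxs
    gcongr
  have hfin := hmarkov.trans hpi
  have : (Measure.pi fun _ : Fin n => P) {xs | τ ≤ ‖(n : ℝ)⁻¹ • ∑ j, (U (xs j) - m)‖}
      ≤ ENNReal.ofReal (Real.exp (1 + n * (l * (2 * C)) ^ 2)) /
        ENNReal.ofReal (Real.exp (l * (n * τ))) := by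
    rw [ENNReal.le_div_iff_mul_le (by left; simp [Real.exp_pos]) (by left; simp)]
    rw [mul_comm]
    refine le_trans ?_ hfin
    gcongr
  refine this.trans ?_
  rw [← ENNReal.ofReal_div_of_pos (Real.exp_pos _), ← Real.exp_sub]
  apply ENNReal.ofReal_le_ofReal
  apply Real.exp_le_exp.2
  apply le_of_eq
  rw [hl]; field_simp; ring
end conc
section det
open scoped Matrix.Norms.L2Operator

lemma inv_sqrt_near {k : ℕ} (M : Matrix (Fin k) (Fin k) ℝ) (hM : M.IsHermitian) (δ : ℝ)
    (hδ : δ ≤ 1 / 2) (h : ‖M - 1‖ ≤ δ) :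
    ∃ B : Matrix (Fin k) (Fin k) ℝ, B * M * Bᵀ = 1 ∧ ‖B - 1‖ ≤ δ := by
  have hδ0 : 0 ≤ δ := (norm_nonneg _).trans h
  set U := hM.eigenvectorUnitary
  set l := hM.eigenvalues
  have hspec : M = (U : Matrix _ _ ℝ) * diagonal l * star (U : Matrix _ _ ℝ) := by
    conv_lhs => rw [hM.spectral_theorem]
    rw [Unitary.conjStarAlgAut_apply]; rfl
  have hUU : (U : Matrix (Fin k) (Fin k) ℝ) * star (U : Matrix (Fin k) (Fin k) ℝ) = 1 :=
    Unitary.mul_star_self_of_mem U.2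
  have hUU' : star (U : Matrix (Fin k) (Fin k) ℝ) * (U : Matrix (Fin k) (Fin k) ℝ) = 1 :=
    Unitary.star_mul_self_of_mem U.2
  have hconj : ∀ v : Fin k → ℝ, (U : Matrix _ _ ℝ) * diagonal v * star (U : Matrix _ _ ℝ) - 1
      = (U : Matrix _ _ ℝ) * diagonal (fun i => v i - 1) * star (U : Matrix _ _ ℝ) := by
    intro v
    have : diagonal (fun i => v i - 1) = diagonal v - (1 : Matrix (Fin k) (Fin k) ℝ) := by
      rw [← diagonal_one, diagonal_sub]
    rw [this, mul_sub, sub_mul, mul_one, hUU]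
  have hnorm : ∀ v : Fin k → ℝ,
      ‖(U : Matrix _ _ ℝ) * diagonal v * star (U : Matrix _ _ ℝ)‖ = ‖v‖ := by
    intro v
    rw [← Unitary.coe_star, CStarRing.norm_mul_coe_unitary, CStarRing.norm_coe_unitary_mul,
      l2_opNorm_diagonal]
  rw [hspec, hconj, hnorm] at h
  have hl : ∀ i, |l i - 1| ≤ δ := fun i => by
    have := (pi_norm_le_iff_of_nonneg hδ0).1 h i
    simpa using this
  have hlpos : ∀ i, 1 / 2 ≤ l i := fun i => by
    have := (abs_le.1 (hl i)).1; linarith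
  refine ⟨(U : Matrix _ _ ℝ) * diagonal (fun i => (Real.sqrt (l i))⁻¹) * star (U : Matrix _ _ ℝ),
    ?_, ?_⟩
  · have hT : ((U : Matrix _ _ ℝ) * diagonal (fun i => (Real.sqrt (l i))⁻¹) *
        star (U : Matrix _ _ ℝ))ᵀ = (U : Matrix _ _ ℝ) * diagonal (fun i => (Real.sqrt (l i))⁻¹) *
        star (U : Matrix _ _ ℝ) := by
      rw [← conjTranspose_eq_transpose_of_trivial]
      simp only [conjTranspose_mul, star_eq_conjTranspose, conjTranspose_conjTranspose,
        diagonal_conjTranspose, mul_assoc]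
      simp
    rw [hT]
    conv_lhs => rw [hspec]
    calc _ = (U : Matrix _ _ ℝ) * diagonal (fun i => (Real.sqrt (l i))⁻¹) *
        (star (U : Matrix _ _ ℝ) * (U : Matrix _ _ ℝ)) * diagonal l *
        (star (U : Matrix _ _ ℝ) * (U : Matrix _ _ ℝ)) * diagonal (fun i => (Real.sqrt (l i))⁻¹) *
        star (U : Matrix _ _ ℝ) := by simp only [mul_assoc]
      _ = (U : Matrix _ _ ℝ) * (diagonal (fun i => (Real.sqrt (l i))⁻¹) * diagonal l *
        diagonal (fun i => (Real.sqrt (l i))⁻¹)) * star (U : Matrix _ _ ℝ) := by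
          rw [hUU']; simp only [mul_assoc, mul_one, one_mul]
      _ = 1 := by
          rw [diagonal_mul_diagonal, diagonal_mul_diagonal]
          have : (fun i => (Real.sqrt (l i))⁻¹ * l i * (Real.sqrt (l i))⁻¹) = fun _ => (1:ℝ) := by
            funext i
            have h1 := hlpos i
            have h2 : 0 < Real.sqrt (l i) := Real.sqrt_pos.2 (by linarith)
            have h3 := Real.mul_self_sqrt (show 0 ≤ l i by linarith)
            field_simp; nlinarith
          rw [this, diagonal_one, mul_one, hUU]
  · rw [hconj, hnorm, pi_norm_le_iff_of_nonneg hδ0]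
    intro i
    rw [Real.norm_eq_abs]
    refine le_trans ?_ (hl i)
    have h1 := hlpos i
    have h2 : 0 < Real.sqrt (l i) := Real.sqrt_pos.2 (by linarith)
    have h3 := Real.sq_sqrt (show 0 ≤ l i by linarith)
    set q := Real.sqrt (l i)
    have h4 : 1 / 2 ≤ q := by nlinarith
    have h5 : q⁻¹ - 1 = (1 - l i) / (q * (1 + q)) := by
      rw [← h3]; field_simp; ring
    rw [h5, abs_div, abs_sub_comm, abs_of_pos (show 0 < q * (1 + q) by positivity)]
    apply div_le_self (abs_nonneg _)
    nlinarith

lemma dot_eq_norm {ι : Type*} [Fintype ι] (u : ι → ℝ) : u ⬝ᵥ u = ‖WithLp.toLp 2 u‖ ^ 2 := by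
  rw [EuclideanSpace.norm_sq_eq]; simp [dotProduct, pow_two]

lemma l2_le_of_mulVec {m n : Type*} [Fintype m] [Fintype n] [DecidableEq n]
    (A : Matrix m n ℝ) (c : ℝ) (hc : 0 ≤ c)
    (h : ∀ u, (A *ᵥ u) ⬝ᵥ (A *ᵥ u) ≤ c ^ 2 * (u ⬝ᵥ u)) : ‖A‖ ≤ c := by
  rw [l2_opNorm_def]
  apply ContinuousLinearMap.opNorm_le_bound _ hc
  intro x
  have := h x.ofLp
  rw [dot_eq_norm, dot_eq_norm, ← mul_pow] at this
  exact (pow_le_pow_iff_left₀ (norm_nonneg _) (by positivity) two_ne_zero).1 this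

lemma l2_le_of_frob {m n : Type*} [Fintype m] [Fintype n] [DecidableEq n]
    (A : Matrix m n ℝ) (c : ℝ) (hc : 0 ≤ c)
    (h : ∑ i, ∑ j, A i j ^ 2 ≤ c ^ 2) : ‖A‖ ≤ c := by
  apply l2_le_of_mulVec _ _ hc
  intro u
  have hu : 0 ≤ u ⬝ᵥ u := by rw [dot_eq_norm]; positivity
  calc (A *ᵥ u) ⬝ᵥ (A *ᵥ u) = ∑ i, (∑ j, A i j * u j) ^ 2 := by
        simp [dotProduct, mulVec, pow_two]
    _ ≤ ∑ i, (∑ j, A i j ^ 2) * (∑ j, u j ^ 2) := by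
        gcongr with i; exact Finset.sum_mul_sq_le_sq_mul_sq _ _ _
    _ = (∑ i, ∑ j, A i j ^ 2) * (u ⬝ᵥ u) := by
        rw [← Finset.sum_mul]; simp [dotProduct, pow_two]
    _ ≤ _ := by gcongr

lemma l2_transpose {m n : Type*} [Fintype m] [Fintype n] [DecidableEq m] [DecidableEq n]
    (A : Matrix m n ℝ) : ‖Aᵀ‖ = ‖A‖ := by
  rw [← conjTranspose_eq_transpose_of_trivial, l2_opNorm_conjTranspose]

lemma abs_trace_le {k : ℕ} (A : Matrix (Fin k) (Fin k) ℝ) : |A.trace| ≤ k * ‖A‖ := by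
  have : ∀ i, |A i i| ≤ ‖A‖ := by
    intro i
    have h := l2_opNorm_mulVec A (EuclideanSpace.single i (1:ℝ))
    have h2 := PiLp.norm_single 2 (fun _ : Fin k => ℝ) i (1:ℝ)
    rw [h2] at h
    have h3 := (PiLp.norm_apply_le ((EuclideanSpace.equiv (Fin k) ℝ).symm
      (A *ᵥ (EuclideanSpace.single i (1:ℝ)).ofLp)) i).trans h
    simpa using h3
  calc |A.trace| ≤ ∑ i, |A i i| := Finset.abs_sum_le_sum_abs _ _
    _ ≤ ∑ _i : Fin k, ‖A‖ := by gcongr with i; exact this i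
    _ = _ := by simp

lemma dot_mulVec_adj {m n : Type*} [Fintype m] [Fintype n] (A : Matrix m n ℝ) (u : m → ℝ)
    (w : n → ℝ) : (Aᵀ *ᵥ u) ⬝ᵥ w = u ⬝ᵥ (A *ᵥ w) := by
  rw [mulVec_transpose, dotProduct_mulVec]

lemma feas_norm {k d : ℕ} (S : Matrix (Fin d) (Fin d) ℝ) (s : ℝ) (hs : 0 < s)
    (hS : ∀ u, s * (u ⬝ᵥ u) ≤ u ⬝ᵥ (S *ᵥ u)) (A : Matrix (Fin k) (Fin d) ℝ)
    (hA : A * S * Aᵀ = 1) : ‖A‖ ≤ Real.sqrt s⁻¹ := by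
  rw [← l2_transpose]
  apply l2_le_of_mulVec _ _ (Real.sqrt_nonneg _)
  intro u
  rw [Real.sq_sqrt (by positivity)]
  have h1 := hS (Aᵀ *ᵥ u)
  rw [dot_mulVec_adj (A := A) (w := S *ᵥ (Aᵀ *ᵥ u)), mulVec_mulVec, mulVec_mulVec, hA,
    one_mulVec] at h1
  rw [← div_eq_inv_mul, le_div_iff₀ hs]; linarith

lemma cross_norm {k d₁ d₂ : ℕ} (S₁ : Matrix (Fin d₁) (Fin d₁) ℝ) (S₂ : Matrix (Fin d₂) (Fin d₂) ℝ)
    (S₁₂ : Matrix (Fin d₁) (Fin d₂) ℝ)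
    (hCS : ∀ u v, 2 * (u ⬝ᵥ (S₁₂ *ᵥ v)) ≤ u ⬝ᵥ (S₁ *ᵥ u) + v ⬝ᵥ (S₂ *ᵥ v))
    (A₁ : Matrix (Fin k) (Fin d₁) ℝ) (A₂ : Matrix (Fin k) (Fin d₂) ℝ)
    (h₁ : A₁ * S₁ * A₁ᵀ = 1) (h₂ : A₂ * S₂ * A₂ᵀ = 1) : ‖A₁ * S₁₂ * A₂ᵀ‖ ≤ 1 := by
  apply l2_le_of_mulVec _ _ zero_le_one
  intro v
  set u := (A₁ * S₁₂ * A₂ᵀ) *ᵥ v with hu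
  have h := hCS (A₁ᵀ *ᵥ u) (A₂ᵀ *ᵥ v)
  rw [dot_mulVec_adj (A := A₁) (w := S₁₂ *ᵥ (A₂ᵀ *ᵥ v)), mulVec_mulVec, mulVec_mulVec,
    ← hu, dot_mulVec_adj (A := A₁) (w := S₁ *ᵥ (A₁ᵀ *ᵥ u)), mulVec_mulVec, mulVec_mulVec, h₁, one_mulVec, dot_mulVec_adj (A := A₂) (w := S₂ *ᵥ (A₂ᵀ *ᵥ v)), mulVec_mulVec,
    mulVec_mulVec, h₂, one_mulVec] at h
  linarith

lemma sandwich {k d₁ d₂ : ℕ} (s δ : ℝ) (hs : 0 < s) (D : Matrix (Fin d₁) (Fin d₂) ℝ)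
    (A₁ : Matrix (Fin k) (Fin d₁) ℝ) (A₂ : Matrix (Fin k) (Fin d₂) ℝ)
    (h₁ : ‖A₁‖ ≤ Real.sqrt s⁻¹) (h₂ : ‖A₂‖ ≤ Real.sqrt s⁻¹) (hD : ‖D‖ ≤ δ * s) :
    ‖A₁ * D * A₂ᵀ‖ ≤ δ := by
  calc ‖A₁ * D * A₂ᵀ‖ ≤ ‖A₁‖ * ‖D‖ * ‖A₂‖ := by
        refine (l2_opNorm_mul _ _).trans ?_
        rw [l2_transpose]; gcongr; exact l2_opNorm_mul _ _
    _ ≤ Real.sqrt s⁻¹ * (δ * s) * Real.sqrt s⁻¹ := by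
        have := (norm_nonneg _).trans hD
        gcongr
    _ = (Real.sqrt s⁻¹ * Real.sqrt s⁻¹) * (δ * s) := by ring
    _ = δ := by rw [Real.mul_self_sqrt (by positivity)]; field_simp

lemma transfer {k d₁ d₂ : ℕ} (S₁ T₁ : Matrix (Fin d₁) (Fin d₁) ℝ)
    (S₂ T₂ : Matrix (Fin d₂) (Fin d₂) ℝ)
    (S₁₂ T₁₂ : Matrix (Fin d₁) (Fin d₂) ℝ)
    (hCS : ∀ u v, 2 * (u ⬝ᵥ (S₁₂ *ᵥ v)) ≤ u ⬝ᵥ (S₁ *ᵥ u) + v ⬝ᵥ (S₂ *ᵥ v))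
    (s δ : ℝ) (hs : 0 < s) (hδ : δ ≤ 1 / 8)
    (hS₁ : ∀ u, s * (u ⬝ᵥ u) ≤ u ⬝ᵥ (S₁ *ᵥ u))
    (hS₂ : ∀ u, s * (u ⬝ᵥ u) ≤ u ⬝ᵥ (S₂ *ᵥ u))
    (hT₁ : T₁ᵀ = T₁) (hT₂ : T₂ᵀ = T₂)
    (h₁ : ‖T₁ - S₁‖ ≤ δ * s) (h₂ : ‖T₂ - S₂‖ ≤ δ * s) (h₁₂ : ‖T₁₂ - S₁₂‖ ≤ δ * s)
    (A₁ : Matrix (Fin k) (Fin d₁) ℝ) (A₂ : Matrix (Fin k) (Fin d₂) ℝ)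
    (hA₁ : A₁ * S₁ * A₁ᵀ = 1) (hA₂ : A₂ * S₂ * A₂ᵀ = 1) :
    ∃ (B₁ : Matrix (Fin k) (Fin d₁) ℝ) (B₂ : Matrix (Fin k) (Fin d₂) ℝ),
      B₁ * T₁ * B₁ᵀ = 1 ∧ B₂ * T₂ * B₂ᵀ = 1 ∧
      |(B₁ * T₁₂ * B₂ᵀ).trace - (A₁ * S₁₂ * A₂ᵀ).trace| ≤ k * (4 * δ) := by
  have hδ0 : 0 ≤ δ := by
    have := (norm_nonneg _).trans h₁
    by_contra h; push Not at h; nlinarith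
  have n₁ := feas_norm S₁ s hs hS₁ A₁ hA₁
  have n₂ := feas_norm S₂ s hs hS₂ A₂ hA₂
  have m₁ := sandwich s δ hs _ A₁ A₁ n₁ n₁ h₁
  have m₂ := sandwich s δ hs _ A₂ A₂ n₂ n₂ h₂
  have m₁₂ := sandwich s δ hs _ A₁ A₂ n₁ n₂ h₁₂
  rw [Matrix.mul_sub, Matrix.sub_mul] at m₁ m₂ m₁₂
  rw [hA₁] at m₁
  rw [hA₂] at m₂
  have hN0 := cross_norm S₁ S₂ S₁₂ hCS A₁ A₂ hA₁ hA₂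
  obtain ⟨C₁, hC₁, hC₁'⟩ := inv_sqrt_near (A₁ * T₁ * A₁ᵀ) (by
    rw [IsHermitian, conjTranspose_eq_transpose_of_trivial]
    simp [transpose_mul, hT₁, Matrix.mul_assoc]) δ (by linarith) m₁
  obtain ⟨C₂, hC₂, hC₂'⟩ := inv_sqrt_near (A₂ * T₂ * A₂ᵀ) (by
    rw [IsHermitian, conjTranspose_eq_transpose_of_trivial]
    simp [transpose_mul, hT₂, Matrix.mul_assoc]) δ (by linarith) m₂
  refine ⟨C₁ * A₁, C₂ * A₂, ?_, ?_, ?_⟩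
  · rw [← hC₁]; simp only [transpose_mul, Matrix.mul_assoc]
  · rw [← hC₂]; simp only [transpose_mul, Matrix.mul_assoc]
  rw [← trace_sub]
  refine (abs_trace_le _).trans ?_
  gcongr
  set N := A₁ * T₁₂ * A₂ᵀ with hN
  set N0 := A₁ * S₁₂ * A₂ᵀ with hN0'
  have e : C₁ * A₁ * T₁₂ * (C₂ * A₂)ᵀ - N0
      = (C₁ - 1) * N * (C₂ - 1)ᵀ + (C₁ - 1) * N + N * (C₂ - 1)ᵀ + (N - N0) := by
    have : C₁ * A₁ * T₁₂ * (C₂ * A₂)ᵀ = C₁ * N * C₂ᵀ := by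
      rw [hN]; simp only [transpose_mul, Matrix.mul_assoc]
    rw [this, transpose_sub, transpose_one]; noncomm_ring
  rw [e]
  have hNn : ‖N‖ ≤ 1 + δ := by
    calc ‖N‖ = ‖N0 + (N - N0)‖ := by congr 1; abel
      _ ≤ _ := (norm_add_le _ _).trans (by linarith)
  have hC₂T : ‖(C₂ - 1)ᵀ‖ ≤ δ := by rw [l2_transpose]; exact hC₂'
  have t1 : ‖(C₁ - 1) * N‖ ≤ δ * (1 + δ) := (l2_opNorm_mul _ _).trans (by gcongr)
  have t2 : ‖N * (C₂ - 1)ᵀ‖ ≤ (1 + δ) * δ := (l2_opNorm_mul _ _).trans (by gcongr)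
  have t3 : ‖(C₁ - 1) * N * (C₂ - 1)ᵀ‖ ≤ δ * (1 + δ) * δ := (l2_opNorm_mul _ _).trans (by gcongr)
  have q := norm_add_le ((C₁ - 1) * N * (C₂ - 1)ᵀ + (C₁ - 1) * N + N * (C₂ - 1)ᵀ) (N - N0)
  have q2 := norm_add_le ((C₁ - 1) * N * (C₂ - 1)ᵀ + (C₁ - 1) * N) (N * (C₂ - 1)ᵀ)
  have q3 := norm_add_le ((C₁ - 1) * N * (C₂ - 1)ᵀ) ((C₁ - 1) * N)
  have e1 : δ * δ ≤ δ * (1 / 8) := by gcongr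
  have e2 : δ * (1 + δ) * δ ≤ (δ * δ) * 2 := by nlinarith [mul_nonneg hδ0 hδ0]
  linarith
end det
section det2
open scoped Matrix.Norms.L2Operator

lemma trace_expand {k α γ : Type*} [Fintype k] [Fintype α] [Fintype γ]
    (A : Matrix k α ℝ) (S : Matrix α γ ℝ) (B : Matrix k γ ℝ) :
    (A * S * Bᵀ).trace = ∑ i, ∑ b, ∑ a, A i a * S a b * B i b := by
  simp [Matrix.trace, Matrix.mul_apply, Finset.sum_mul]

noncomputable def covM {Ω' : Type*} [MeasurableSpace Ω'] (ν : Measure Ω') {α γ : Type*}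
    (x : Ω' → α → ℝ) (y : Ω' → γ → ℝ) : Matrix α γ ℝ :=
  Matrix.of fun a b => ∫ ω, x ω a * y ω b ∂ν

lemma integral_trace {Ω' : Type*} [MeasurableSpace Ω'] (ν : Measure Ω') {k α γ : Type*}
    [Fintype k] [Fintype α] [Fintype γ]
    (x : Ω' → α → ℝ) (y : Ω' → γ → ℝ) (h : ∀ a b, Integrable (fun ω => x ω a * y ω b) ν)
    (A : Matrix k α ℝ) (B : Matrix k γ ℝ) :
    Integrable (fun ω => ∑ i, (A *ᵥ x ω) i * (B *ᵥ y ω) i) ν ∧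
    ∫ ω, ∑ i, (A *ᵥ x ω) i * (B *ᵥ y ω) i ∂ν = (A * covM ν x y * Bᵀ).trace := by
  have e : (fun ω => ∑ i, (A *ᵥ x ω) i * (B *ᵥ y ω) i)
      = fun ω => ∑ i, ∑ b, ∑ a, (A i a * B i b) * (x ω a * y ω b) := by
    funext ω
    refine Finset.sum_congr rfl fun i _ => ?_
    simp only [mulVec, dotProduct]
    rw [Finset.sum_mul_sum, Finset.sum_comm]
    refine Finset.sum_congr rfl fun b _ => Finset.sum_congr rfl fun a _ => by ring
  have hi : ∀ i b a, Integrable (fun ω => (A i a * B i b) * (x ω a * y ω b)) ν :=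
    fun i b a => (h a b).const_mul _
  rw [e]
  constructor
  · exact integrable_finsetSum _ fun i _ => integrable_finsetSum _ fun b _ =>
      integrable_finsetSum _ fun a _ => hi i b a
  · rw [trace_expand, integral_finsetSum _ fun i _ => integrable_finsetSum _ fun b _ =>
      integrable_finsetSum _ fun a _ => hi i b a]
    refine Finset.sum_congr rfl fun i _ => ?_
    rw [integral_finsetSum _ fun b _ => integrable_finsetSum _ fun a _ => hi i b a]
    refine Finset.sum_congr rfl fun b _ => ?_
    rw [integral_finsetSum _ fun a _ => hi i b a]
    refine Finset.sum_congr rfl fun a _ => ?_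
    rw [integral_const_mul]; simp only [covM, Matrix.of_apply]; ring

lemma obj_formula {Ω' : Type*} [MeasurableSpace Ω'] (ν : Measure Ω') {k α γ : Type*}
    [Fintype k] [Fintype α] [Fintype γ]
    (x : Ω' → α → ℝ) (y : Ω' → γ → ℝ) (hxx : ∀ a b, Integrable (fun ω => x ω a * x ω b) ν)
    (hxy : ∀ a b, Integrable (fun ω => x ω a * y ω b) ν)
    (hyy : ∀ a b, Integrable (fun ω => y ω a * y ω b) ν)
    (A : Matrix k α ℝ) (B : Matrix k γ ℝ) :
    ∫ ω, ∑ i, ((A *ᵥ x ω - B *ᵥ y ω) i) ^ 2 ∂ν =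
      (A * covM ν x x * Aᵀ).trace + (B * covM ν y y * Bᵀ).trace
        - 2 * (A * covM ν x y * Bᵀ).trace := by
  obtain ⟨i1, e1⟩ := integral_trace ν x x hxx A A
  obtain ⟨i2, e2⟩ := integral_trace ν y y hyy B B
  obtain ⟨i3, e3⟩ := integral_trace ν x y hxy A B
  rw [← e1, ← e2, ← e3, ← integral_const_mul, ← integral_add i1 i2,
    ← integral_sub (by exact i1.add i2) (i3.const_mul 2)]
  congr 1
  funext ω
  simp only [Pi.add_apply, Pi.sub_apply]
  rw [Finset.mul_sum, ← Finset.sum_add_distrib, ← Finset.sum_sub_distrib]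
  refine Finset.sum_congr rfl fun i _ => by ring

lemma cov_CS {Ω' : Type*} [MeasurableSpace Ω'] (ν : Measure Ω') {α γ : Type*}
    [Fintype α] [Fintype γ]
    (x : Ω' → α → ℝ) (y : Ω' → γ → ℝ) (hxx : ∀ a b, Integrable (fun ω => x ω a * x ω b) ν)
    (hxy : ∀ a b, Integrable (fun ω => x ω a * y ω b) ν)
    (hyy : ∀ a b, Integrable (fun ω => y ω a * y ω b) ν) (u : α → ℝ) (v : γ → ℝ) :
    2 * (u ⬝ᵥ (covM ν x y *ᵥ v)) ≤ u ⬝ᵥ (covM ν x x *ᵥ u) + v ⬝ᵥ (covM ν y y *ᵥ v) := by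
  have h := obj_formula ν x y hxx hxy hyy (Matrix.of fun (_ : Fin 1) => u)
    (Matrix.of fun (_ : Fin 1) => v)
  have h0 : 0 ≤ ∫ ω, ∑ i, (((Matrix.of fun (_ : Fin 1) => u) *ᵥ x ω -
      (Matrix.of fun (_ : Fin 1) => v) *ᵥ y ω) i) ^ 2 ∂ν :=
    integral_nonneg fun ω => Finset.sum_nonneg fun i _ => sq_nonneg _
  rw [h] at h0
  have key : ∀ {α γ : Type _} [Fintype α] [Fintype γ] (S : Matrix α γ ℝ) (u : α → ℝ) (v : γ → ℝ),
      ((Matrix.of fun (_ : Fin 1) => u) * S * (Matrix.of fun (_ : Fin 1) => v)ᵀ).trace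
        = u ⬝ᵥ (S *ᵥ v) := by
    intro α γ _ _ S u v
    rw [trace_expand]
    simp only [Matrix.of_apply, Finset.univ_unique, Finset.sum_singleton, mulVec, dotProduct]
    rw [Finset.sum_comm]
    refine Finset.sum_congr rfl fun i _ => ?_
    rw [Finset.mul_sum]
    refine Finset.sum_congr rfl fun j _ => by ring
  have k1 := key (covM ν x x) u u
  have k2 : ((Matrix.of fun (_ : Fin 1) => v) * covM ν y y *
    (Matrix.of fun (_ : Fin 1) => v)ᵀ).trace = v ⬝ᵥ (covM ν y y *ᵥ v) := by
    rw [trace_expand]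
    simp only [Matrix.of_apply, Finset.univ_unique, Finset.sum_singleton, mulVec, dotProduct]
    rw [Finset.sum_comm]
    refine Finset.sum_congr rfl fun i _ => ?_
    rw [Finset.mul_sum]
    refine Finset.sum_congr rfl fun j _ => by ring
  have k3 : ((Matrix.of fun (_ : Fin 1) => u) * covM ν x y *
    (Matrix.of fun (_ : Fin 1) => v)ᵀ).trace = u ⬝ᵥ (covM ν x y *ᵥ v) := by
    rw [trace_expand]
    simp only [Matrix.of_apply, Finset.univ_unique, Finset.sum_singleton, mulVec, dotProduct]
    rw [Finset.sum_comm]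
    refine Finset.sum_congr rfl fun i _ => ?_
    rw [Finset.mul_sum]
    refine Finset.sum_congr rfl fun j _ => by ring
  rw [k1, k2, k3] at h0
  linarith

/-- feasible set for a pair of matrices -/
def feas {d₁ d₂ : ℕ} (k : ℕ) (S₁ : Matrix (Fin d₁) (Fin d₁) ℝ) (S₂ : Matrix (Fin d₂) (Fin d₂) ℝ) :
    Set (Matrix (Fin k) (Fin d₁) ℝ × Matrix (Fin k) (Fin d₂) ℝ) :=
  {A | A.1 * S₁ * A.1ᵀ = 1 ∧ A.2 * S₂ * A.2ᵀ = 1}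

lemma feas_obj {d₁ d₂ k : ℕ} {S₁ : Matrix (Fin d₁) (Fin d₁) ℝ} {S₂ : Matrix (Fin d₂) (Fin d₂) ℝ}
    {S₁₂ : Matrix (Fin d₁) (Fin d₂) ℝ}
    {f : Matrix (Fin k) (Fin d₁) ℝ × Matrix (Fin k) (Fin d₂) ℝ → ℝ}
    (hf : ∀ A, f A = (A.1 * S₁ * A.1ᵀ).trace + (A.2 * S₂ * A.2ᵀ).trace
        - 2 * (A.1 * S₁₂ * A.2ᵀ).trace) {A} (hA : A ∈ feas k S₁ S₂) :
    f A = 2 * k - 2 * (A.1 * S₁₂ * A.2ᵀ).trace := by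
  rw [hf, hA.1, hA.2, trace_one, Fintype.card_fin]; ring

lemma sInf_mca_range {d₁ d₂ k : ℕ} {S₁ : Matrix (Fin d₁) (Fin d₁) ℝ} {S₂ : Matrix (Fin d₂) (Fin d₂) ℝ}
    {S₁₂ : Matrix (Fin d₁) (Fin d₂) ℝ}
    {f : Matrix (Fin k) (Fin d₁) ℝ × Matrix (Fin k) (Fin d₂) ℝ → ℝ} (h0 : ∀ A, 0 ≤ f A)
    (hf : ∀ A, f A = (A.1 * S₁ * A.1ᵀ).trace + (A.2 * S₂ * A.2ᵀ).trace
        - 2 * (A.1 * S₁₂ * A.2ᵀ).trace) :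
    0 ≤ sInf (f '' feas k S₁ S₂) ∧ sInf (f '' feas k S₁ S₂) ≤ 2 * k := by
  have hnn : ∀ y ∈ f '' feas k S₁ S₂, 0 ≤ y := by rintro _ ⟨A, _, rfl⟩; exact h0 A
  refine ⟨Real.sInf_nonneg hnn, ?_⟩
  rcases (feas k S₁ S₂).eq_empty_or_nonempty with h | ⟨A, hA⟩
  · rw [h]; simp
  · have hB : (-A.1, A.2) ∈ feas k S₁ S₂ := by
      refine ⟨?_, hA.2⟩
      simpa using hA.1
    have e1 := feas_obj hf hA
    have e2 := feas_obj hf hB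
    have hbd : BddBelow (f '' feas k S₁ S₂) := ⟨0, hnn⟩
    have c1 := csInf_le hbd ⟨A, hA, rfl⟩
    have c2 := csInf_le hbd ⟨_, hB, rfl⟩
    simp only [Matrix.neg_mul, trace_neg] at e2
    linarith

lemma quad_norm {d : ℕ} (D : Matrix (Fin d) (Fin d) ℝ) (c : ℝ) (h : ‖D‖ ≤ c) (u : Fin d → ℝ) :
    |u ⬝ᵥ (D *ᵥ u)| ≤ c * (u ⬝ᵥ u) := by
  have h1 := l2_opNorm_mulVec D (WithLp.toLp 2 u)
  have h2 := abs_real_inner_le_norm (WithLp.toLp 2 (D *ᵥ u)) (WithLp.toLp 2 u)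
  have h3 : inner ℝ (WithLp.toLp 2 (D *ᵥ u)) (WithLp.toLp 2 u) = u ⬝ᵥ (D *ᵥ u) := by
    rw [EuclideanSpace.inner_eq_star_dotProduct]; simp
  rw [h3] at h2
  rw [dot_eq_norm]
  have h4 : ‖WithLp.toLp 2 (D *ᵥ u)‖ ≤ ‖D‖ * ‖WithLp.toLp 2 u‖ := h1
  calc _ ≤ ‖D‖ * ‖WithLp.toLp 2 u‖ * ‖WithLp.toLp 2 u‖ := h2.trans (by gcongr)
    _ = ‖D‖ * ‖WithLp.toLp 2 u‖ ^ 2 := by ring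
    _ ≤ _ := by gcongr

lemma sInf_compare {ι : Type*} (f g : ι → ℝ) (S T : Set ι) (c : ℝ) (hg : ∀ A, 0 ≤ g A)
    (hS : S.Nonempty)
    (h : ∀ A ∈ S, ∃ B ∈ T, g B ≤ f A + c) : sInf (g '' T) ≤ sInf (f '' S) + c := by
  have : sInf (g '' T) - c ≤ sInf (f '' S) := by
    apply le_csInf (hS.image f)
    rintro _ ⟨A, hA, rfl⟩
    obtain ⟨B, hB, hle⟩ := h A hA
    have := csInf_le ⟨0, by rintro _ ⟨A, _, rfl⟩; exact hg A⟩ (Set.mem_image_of_mem g hB)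
    linarith
  linarith

lemma det_main {k d₁ d₂ : ℕ} (S₁ T₁ : Matrix (Fin d₁) (Fin d₁) ℝ)
    (S₂ T₂ : Matrix (Fin d₂) (Fin d₂) ℝ)
    (S₁₂ T₁₂ : Matrix (Fin d₁) (Fin d₂) ℝ)
    (hCS : ∀ u v, 2 * (u ⬝ᵥ (S₁₂ *ᵥ v)) ≤ u ⬝ᵥ (S₁ *ᵥ u) + v ⬝ᵥ (S₂ *ᵥ v))
    (hCT : ∀ u v, 2 * (u ⬝ᵥ (T₁₂ *ᵥ v)) ≤ u ⬝ᵥ (T₁ *ᵥ u) + v ⬝ᵥ (T₂ *ᵥ v))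
    (s δ : ℝ) (hs : 0 < s) (hδ : δ ≤ 1 / 16)
    (hS₁ : ∀ u, s * (u ⬝ᵥ u) ≤ u ⬝ᵥ (S₁ *ᵥ u))
    (hS₂ : ∀ u, s * (u ⬝ᵥ u) ≤ u ⬝ᵥ (S₂ *ᵥ u))
    (hT₁ : T₁ᵀ = T₁) (hT₂ : T₂ᵀ = T₂) (hS₁' : S₁ᵀ = S₁) (hS₂' : S₂ᵀ = S₂)
    (h₁ : ‖T₁ - S₁‖ ≤ δ * s) (h₂ : ‖T₂ - S₂‖ ≤ δ * s) (h₁₂ : ‖T₁₂ - S₁₂‖ ≤ δ * s)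
    (f g : Matrix (Fin k) (Fin d₁) ℝ × Matrix (Fin k) (Fin d₂) ℝ → ℝ) (hf0 : ∀ A, 0 ≤ f A)
    (hg0 : ∀ A, 0 ≤ g A)
    (hf : ∀ A, f A = (A.1 * S₁ * A.1ᵀ).trace + (A.2 * S₂ * A.2ᵀ).trace
        - 2 * (A.1 * S₁₂ * A.2ᵀ).trace)
    (hg : ∀ A, g A = (A.1 * T₁ * A.1ᵀ).trace + (A.2 * T₂ * A.2ᵀ).trace
        - 2 * (A.1 * T₁₂ * A.2ᵀ).trace) :
    |sInf (g '' feas k T₁ T₂) - sInf (f '' feas k S₁ S₂)| ≤ 16 * k * δ := by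
  have hδ0 : 0 ≤ δ := by
    have := (norm_nonneg _).trans h₁
    by_contra h; push Not at h; nlinarith
  have low : ∀ {d : ℕ} (S T : Matrix (Fin d) (Fin d) ℝ), (∀ u, s * (u ⬝ᵥ u) ≤ u ⬝ᵥ (S *ᵥ u)) →
      ‖T - S‖ ≤ δ * s → ∀ u, s / 2 * (u ⬝ᵥ u) ≤ u ⬝ᵥ (T *ᵥ u) := by
    intro d S T hS hTS u
    have h1 := (abs_le.1 (quad_norm _ _ hTS u)).1
    rw [sub_mulVec, dotProduct_sub] at h1
    have h2 := hS u
    have hu : 0 ≤ u ⬝ᵥ u := by rw [dot_eq_norm]; positivity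
    have : δ * s * (u ⬝ᵥ u) ≤ 1 / 16 * s * (u ⬝ᵥ u) := by gcongr
    nlinarith [mul_nonneg hs.le hu]
  have kδ : 0 ≤ (k : ℝ) * δ := by positivity
  have dir1 : ∀ A ∈ feas k S₁ S₂, ∃ B ∈ feas k T₁ T₂, g B ≤ f A + 16 * k * δ := by
    intro A hA
    obtain ⟨B₁, B₂, b1, b2, b3⟩ := transfer S₁ T₁ S₂ T₂ S₁₂ T₁₂ hCS s δ hs (by linarith) hS₁ hS₂
      hT₁ hT₂ h₁ h₂ h₁₂ A.1 A.2 hA.1 hA.2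
    have hB : (B₁, B₂) ∈ feas k T₁ T₂ := ⟨b1, b2⟩
    refine ⟨_, hB, ?_⟩
    rw [feas_obj hg hB, feas_obj hf hA]
    have := (abs_le.1 b3).1
    simp only
    linarith
  have dir2 : ∀ A ∈ feas k T₁ T₂, ∃ B ∈ feas k S₁ S₂, f B ≤ g A + 16 * k * δ := by
    intro A hA
    have e : 2 * δ * (s / 2) = δ * s := by ring
    obtain ⟨B₁, B₂, b1, b2, b3⟩ := transfer T₁ S₁ T₂ S₂ T₁₂ S₁₂ hCT (s / 2) (2 * δ) (by linarith)
      (by linarith) (low _ _ hS₁ h₁) (low _ _ hS₂ h₂)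
      hS₁' hS₂' (by rw [e, norm_sub_rev]; exact h₁) (by rw [e, norm_sub_rev]; exact h₂)
      (by rw [e, norm_sub_rev]; exact h₁₂) A.1 A.2 hA.1 hA.2
    have hB : (B₁, B₂) ∈ feas k S₁ S₂ := ⟨b1, b2⟩
    refine ⟨_, hB, ?_⟩
    rw [feas_obj hf hB, feas_obj hg hA]
    have := (abs_le.1 b3).1
    simp only
    linarith
  rcases (feas k S₁ S₂).eq_empty_or_nonempty with h | h
  · rcases (feas k T₁ T₂).eq_empty_or_nonempty with h' | ⟨A, hA⟩
    · rw [h, h']; simp; linarith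
    · obtain ⟨B, hB, _⟩ := dir2 A hA
      rw [h] at hB; exact absurd hB (Set.notMem_empty _)
  · have h' : (feas k T₁ T₂).Nonempty := by
      obtain ⟨A, hA⟩ := h
      obtain ⟨B, hB, _⟩ := dir1 A hA
      exact ⟨B, hB⟩
    have c1 := sInf_compare f g _ _ _ hg0 h dir1
    have c2 := sInf_compare g f _ _ _ hf0 h' dir2
    rw [abs_le]; constructor <;> linarith

lemma feas_empty {d₁ d₂ k : ℕ} (S₁ : Matrix (Fin d₁) (Fin d₁) ℝ) (S₂ : Matrix (Fin d₂) (Fin d₂) ℝ)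
    (h : ¬ (k ≤ d₁ ∧ k ≤ d₂)) : feas k S₁ S₂ = ∅ := by
  rw [Set.eq_empty_iff_forall_notMem]
  intro A hA
  apply h
  have key : ∀ {d : ℕ} (A : Matrix (Fin k) (Fin d) ℝ) (S : Matrix (Fin d) (Fin d) ℝ),
      A * S * Aᵀ = 1 → k ≤ d := by
    intro d A S h
    have h1 : (A * (S * Aᵀ)).rank = k := by rw [← Matrix.mul_assoc, h, rank_one, Fintype.card_fin]
    have h2 := rank_mul_le_left A (S * Aᵀ)
    have h3 := rank_le_width A
    omega
  exact ⟨key _ _ hA.1, key _ _ hA.2⟩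

lemma sum_emb_le {α ι : Type*} [Fintype α] [Fintype ι] (e : α ↪ ι) (g : ι → ℝ) (hg : ∀ i, 0 ≤ g i) :
    ∑ a, g (e a) ≤ ∑ i, g i := by
  rw [← Finset.sum_map Finset.univ e g]
  exact Finset.sum_le_univ_sum_of_nonneg hg

lemma block_norm {α γ ι : Type*} [Fintype α] [Fintype γ] [Fintype ι] [DecidableEq γ]
    (e : α ↪ ι) (e' : γ ↪ ι) (D : ι → ι → ℝ) (m : ι → ℝ) (τ : ℝ) (hτ : 0 ≤ τ)
    (hD : ∑ i, ∑ j, D i j ^ 2 ≤ τ ^ 2) (hm : ∑ i, m i ^ 2 ≤ τ) (M : Matrix α γ ℝ)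
    (hM : ∀ a b, M a b = D (e a) (e' b) - m (e a) * m (e' b)) : ‖M‖ ≤ 2 * τ := by
  have e1 : M = (Matrix.of fun a b => D (e a) (e' b)) -
      (Matrix.of fun a b => m (e a) * m (e' b)) := by
    ext a b; simp [hM]
  rw [e1]
  refine (norm_sub_le _ _).trans ?_
  have n1 : ‖(Matrix.of fun a b => D (e a) (e' b) : Matrix α γ ℝ)‖ ≤ τ := by
    apply l2_le_of_frob _ _ hτ
    refine le_trans ?_ hD
    simp only [Matrix.of_apply]
    calc _ ≤ ∑ a, ∑ j, D (e a) j ^ 2 := by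
          gcongr with a; exact sum_emb_le e' (fun j => D (e a) j ^ 2) fun _ => sq_nonneg _
      _ ≤ _ := sum_emb_le e (fun i => ∑ j, D i j ^ 2) fun _ =>
          Finset.sum_nonneg fun _ _ => sq_nonneg _
  have n2 : ‖(Matrix.of fun a b => m (e a) * m (e' b) : Matrix α γ ℝ)‖ ≤ τ := by
    apply l2_le_of_frob _ _ hτ
    simp only [Matrix.of_apply, mul_pow]
    rw [← Finset.sum_mul_sum, pow_two τ]
    have a1 := sum_emb_le e (fun i => m i ^ 2) fun _ => sq_nonneg _
    have a2 := sum_emb_le e' (fun i => m i ^ 2) fun _ => sq_nonneg _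
    have a3 : 0 ≤ ∑ b, m (e' b) ^ 2 := Finset.sum_nonneg fun _ _ => sq_nonneg _
    exact mul_le_mul (a1.trans hm) (a2.trans hm) a3 hτ
  linarith
end det2

section fin
open scoped Matrix.Norms.L2Operator

noncomputable def cntM (n : ℕ) : Measure (Fin n) := ENNReal.ofReal ((n : ℝ)⁻¹) • Measure.count

lemma int_cntM (n : ℕ) (g : Fin n → ℝ) : ∫ j, g j ∂(cntM n) = (n : ℝ)⁻¹ * ∑ j, g j := by
  unfold cntM
  rw [integral_smul_measure, integral_count, ENNReal.toReal_ofReal (by positivity), smul_eq_mul]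

lemma intg_cntM (n : ℕ) (g : Fin n → ℝ) : Integrable g (cntM n) := by
  have : IsFiniteMeasure (cntM n) := by
    unfold cntM
    exact Measure.smul_finite _ ENNReal.ofReal_ne_top
  exact Integrable.of_finite

lemma empCov_eq (n d : ℕ) (v : Fin n → Fin d → ℝ) :
    empCov n d v = covM (cntM n) (fun j => v j - empMean n d v) (fun j => v j - empMean n d v) := by
  ext a b
  simp only [empCov, covM, Matrix.of_apply, int_cntM, Pi.sub_apply]

lemma empObj_eq (n d₁ d₂ k : ℕ) (v₁ : Fin n → Fin d₁ → ℝ) (v₂ : Fin n → Fin d₂ → ℝ)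
    (A : Matrix (Fin k) (Fin d₁) ℝ × Matrix (Fin k) (Fin d₂) ℝ) :
    empObj n d₁ d₂ k v₁ v₂ A = (A.1 * empCov n d₁ v₁ * A.1ᵀ).trace
      + (A.2 * empCov n d₂ v₂ * A.2ᵀ).trace
      - 2 * (A.1 * covM (cntM n) (fun j => v₁ j - empMean n d₁ v₁)
          (fun j => v₂ j - empMean n d₂ v₂) * A.2ᵀ).trace := by
  rw [empCov_eq, empCov_eq, ← obj_formula _ _ _ (fun _ _ => intg_cntM _ _)
    (fun _ _ => intg_cntM _ _) (fun _ _ => intg_cntM _ _), int_cntM]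
  rfl

lemma empObj_nonneg (n d₁ d₂ k : ℕ) (v₁ : Fin n → Fin d₁ → ℝ) (v₂ : Fin n → Fin d₂ → ℝ)
    (A : Matrix (Fin k) (Fin d₁) ℝ × Matrix (Fin k) (Fin d₂) ℝ) :
    0 ≤ empObj n d₁ d₂ k v₁ v₂ A := by
  unfold empObj
  exact mul_nonneg (by positivity) (Finset.sum_nonneg fun _ _ => Finset.sum_nonneg fun _ _ =>
    sq_nonneg _)

/-- covariance of recentred samples -/
lemma emp_cov_entry (n : ℕ) (hn : 0 < n) {d d' : ℕ} (v : Fin n → Fin d → ℝ) (w : Fin n → Fin d' → ℝ)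
    (μ : Fin d → ℝ) (μ' : Fin d' → ℝ) (a : Fin d) (b : Fin d') :
    covM (cntM n) (fun j => v j - empMean n d v) (fun j => w j - empMean n d' w) a b
      = (n : ℝ)⁻¹ * ∑ j, (v j a - μ a) * (w j b - μ' b)
        - ((n : ℝ)⁻¹ * ∑ j, (v j a - μ a)) * ((n : ℝ)⁻¹ * ∑ j, (w j b - μ' b)) := by
  have hn' : (n : ℝ) ≠ 0 := by exact_mod_cast hn.ne'
  have e1 : ∀ {d : ℕ} (v : Fin n → Fin d → ℝ) (μ : Fin d → ℝ) (a : Fin d),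
      empMean n d v a = μ a + (n : ℝ)⁻¹ * ∑ j, (v j a - μ a) := by
    intro d v μ a
    simp only [empMean, Pi.smul_apply, Finset.sum_apply, smul_eq_mul, Finset.sum_sub_distrib,
      Finset.sum_const, Finset.card_univ, Fintype.card_fin, nsmul_eq_mul]
    field_simp; ring
  simp only [covM, Matrix.of_apply, int_cntM, Pi.sub_apply]
  rw [e1 v μ, e1 w μ']
  set p := (n : ℝ)⁻¹ * ∑ j, (v j a - μ a) with hp
  set q := (n : ℝ)⁻¹ * ∑ j, (w j b - μ' b) with hq
  have hp' : ∑ j, (v j a - μ a) = n * p := by rw [hp]; field_simp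
  have hq' : ∑ j, (w j b - μ' b) = n * q := by rw [hq]; field_simp
  have : ∀ j, (v j a - (μ a + p)) * (w j b - (μ' b + q)) =
      (v j a - μ a) * (w j b - μ' b) - (v j a - μ a) * q - p * (w j b - μ' b) + p * q := by
    intro j; ring
  simp only [this, Finset.sum_add_distrib, Finset.sum_sub_distrib, ← Finset.sum_mul,
    ← Finset.mul_sum] at hp' hq' ⊢
  simp only [← Finset.sum_sub_distrib] at hp' hq' ⊢
  rw [hp', hq']
  simp only [Finset.sum_const, Finset.card_univ, Fintype.card_fin, nsmul_eq_mul]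
  field_simp; ring

/-- the vector that is concentrated -/
noncomputable def Uvec {ι : Type*} (β : ℝ) (x : ι → ℝ) : EuclideanSpace ℝ ((ι × ι) ⊕ ι) :=
  WithLp.toLp 2 (Sum.elim (fun q => x q.1 * x q.2) (fun a => β * x a))

lemma Uvec_norm {ι : Type*} [Fintype ι] (β : ℝ) (x : ι → ℝ) (hx : ∑ a, x a ^ 2 ≤ 2 * β ^ 2) :
    ‖Uvec β x‖ ≤ 5 / 2 * β ^ 2 := by
  apply le_of_sq_le_sq _ (by positivity)
  rw [EuclideanSpace.norm_sq_eq, Fintype.sum_sum_type, Fintype.sum_prod_type]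
  simp only [Uvec, Sum.elim_inl, Sum.elim_inr, Real.norm_eq_abs, sq_abs, mul_pow]
  rw [← Finset.sum_mul_sum, ← Finset.mul_sum]
  set N := ∑ a, x a ^ 2
  have hN : 0 ≤ N := Finset.sum_nonneg fun _ _ => sq_nonneg _
  nlinarith [sq_nonneg β, mul_le_mul hx hx hN (by positivity), mul_le_mul_of_nonneg_left hx (sq_nonneg β)]

lemma psd_quad {d : ℕ} (S : Matrix (Fin d) (Fin d) ℝ) (c : ℝ)
    (h : (S - c • (1 : Matrix (Fin d) (Fin d) ℝ)).PosSemidef) (u : Fin d → ℝ) :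
    c * (u ⬝ᵥ u) ≤ u ⬝ᵥ (S *ᵥ u) := by
  have := h.dotProduct_mulVec_nonneg u
  simp [sub_mulVec, dotProduct_sub, smul_mulVec] at this
  linarith

lemma dim_le {Ω : Type*} [MeasurableSpace Ω] (P : Measure Ω) [IsProbabilityMeasure P] {d : ℕ}
    (x : Ω → Fin d → ℝ) (β c : ℝ) (hx : ∀ᵐ ω ∂P, ∑ a, x ω a ^ 2 ≤ β ^ 2)
    (hi : ∀ a b, Integrable (fun ω => x ω a * x ω b) P)
    (h : (covM P x x - c • (1 : Matrix (Fin d) (Fin d) ℝ)).PosSemidef) : d * c ≤ β ^ 2 := by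
  have h1 : ∀ a, c ≤ ∫ ω, x ω a * x ω a ∂P := by
    intro a
    have := h.diag_nonneg (i := a)
    simp [covM] at this
    exact this
  calc (d : ℝ) * c = ∑ _a : Fin d, c := by simp
    _ ≤ ∑ a, ∫ ω, x ω a * x ω a ∂P := Finset.sum_le_sum fun a _ => h1 a
    _ = ∫ ω, ∑ a, x ω a * x ω a ∂P := by rw [integral_finsetSum _ fun a _ => hi a a]
    _ ≤ ∫ _ω, β ^ 2 ∂P := by
        apply integral_mono_ae (integrable_finsetSum _ fun a _ => hi a a) (integrable_const _)
        filter_upwards [hx] with ω hω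
        simpa [pow_two] using hω
    _ = β ^ 2 := by simp

end fin

section fin2
open scoped Matrix.Norms.L2Operator

lemma block_dev (n : ℕ) (hn : 0 < n) {ι : Type*} [Fintype ι] (x : Fin n → ι → ℝ)
    (m : EuclideanSpace ℝ ((ι × ι) ⊕ ι)) (hm0 : ∀ a, m (Sum.inr a) = 0) (β τ : ℝ) (hβ : 0 < β)
    (hτ : 0 ≤ τ) (hτβ : τ ≤ β ^ 2)
    (hG : ‖(n : ℝ)⁻¹ • ∑ j, (Uvec β (x j) - m)‖ ≤ τ) {d d' : ℕ}
    (v : Fin n → Fin d → ℝ) (w : Fin n → Fin d' → ℝ)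
    (μ : Fin d → ℝ) (μ' : Fin d' → ℝ) (e : Fin d ↪ ι) (e' : Fin d' ↪ ι)
    (hv : ∀ j a, x j (e a) = v j a - μ a) (hw : ∀ j a, x j (e' a) = w j a - μ' a)
    (S : Matrix (Fin d) (Fin d') ℝ) (hS : ∀ a b, S a b = m (Sum.inl (e a, e' b))) :
    ‖covM (cntM n) (fun j => v j - empMean n d v) (fun j => w j - empMean n d' w) - S‖
      ≤ 2 * τ := by
  have hn' : (n : ℝ) ≠ 0 := by exact_mod_cast hn.ne'
  have g1 : ∀ q : ι × ι, ((n : ℝ)⁻¹ • ∑ j, (Uvec β (x j) - m)) (Sum.inl q)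
      = (n : ℝ)⁻¹ * ∑ j, x j q.1 * x j q.2 - m (Sum.inl q) := by
    intro q
    simp [Uvec, mul_sub]
    field_simp
  have g2 : ∀ a : ι, ((n : ℝ)⁻¹ • ∑ j, (Uvec β (x j) - m)) (Sum.inr a)
      = β * ((n : ℝ)⁻¹ * ∑ j, x j a) := by
    intro q
    simp [Uvec, hm0, ← Finset.mul_sum]
    ring
  have hsq := pow_le_pow_left₀ (norm_nonneg _) hG 2
  rw [EuclideanSpace.norm_sq_eq, Fintype.sum_sum_type, Fintype.sum_prod_type] at hsq
  simp only [g1, g2, Real.norm_eq_abs, sq_abs, mul_pow β] at hsq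
  rw [← Finset.mul_sum] at hsq
  have p1 : 0 ≤ ∑ i, ∑ j, ((n : ℝ)⁻¹ * ∑ l, x l i * x l j - m (Sum.inl (i, j))) ^ 2 :=
    Finset.sum_nonneg fun _ _ => Finset.sum_nonneg fun _ _ => sq_nonneg _
  have p2 : 0 ≤ ∑ i, ((n : ℝ)⁻¹ * ∑ l, x l i) ^ 2 := Finset.sum_nonneg fun _ _ => sq_nonneg _
  have hβ2 : 0 < β ^ 2 := by positivity
  refine block_norm e e' (fun i j => (n : ℝ)⁻¹ * ∑ l, x l i * x l j - m (Sum.inl (i, j)))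
    (fun i => (n : ℝ)⁻¹ * ∑ l, x l i) τ hτ ?_ ?_ _ ?_
  · nlinarith
  · have : β ^ 2 * ∑ i, ((n : ℝ)⁻¹ * ∑ l, x l i) ^ 2 ≤ β ^ 2 * τ := by nlinarith
    exact le_of_mul_le_mul_left this hβ2
  · intro a b
    rw [Matrix.sub_apply, emp_cov_entry n hn v w μ μ', hS]
    simp only [hv, hw]; ring

lemma covM_symm {Ω' : Type*} [MeasurableSpace Ω'] (ν : Measure Ω') {α : Type*}
    (x : Ω' → α → ℝ) : (covM ν x x)ᵀ = covM ν x x := by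
  ext a b; simp [covM, mul_comm]

lemma main_aux {Ω : Type*} [MeasurableSpace Ω] (P : Measure Ω)
    [IsProbabilityMeasure P] (d₁ d₂ k n : ℕ) (x₁ : Ω → Fin d₁ → ℝ) (x₂ : Ω → Fin d₂ → ℝ)
    (hx₁ : Measurable x₁) (hx₂ : Measurable x₂) (β σ p ε : ℝ) (hσ : 0 < σ) (hp : 0 < p)
    (hε : 0 < ε) (hβ0 : 0 ≤ β)
    (μ₁ : Fin d₁ → ℝ) (μ₂ : Fin d₂ → ℝ)
    (hm₁ : ∀ a, ∫ ω, x₁ ω a ∂P = 0) (hm₂ : ∀ a, ∫ ω, x₂ ω a ∂P = 0)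
    (hb₁ : ∀ᵐ ω ∂P, ∑ a, x₁ ω a ^ 2 ≤ β ^ 2) (hb₂ : ∀ᵐ ω ∂P, ∑ a, x₂ ω a ^ 2 ≤ β ^ 2)
    (hlam₁ : (covM P x₁ x₁ - σ ^ 2 • (1 : Matrix (Fin d₁) (Fin d₁) ℝ)).PosSemidef)
    (hlam₂ : (covM P x₂ x₂ - σ ^ 2 • (1 : Matrix (Fin d₂) (Fin d₂) ℝ)).PosSemidef)
    (fX : Matrix (Fin k) (Fin d₁) ℝ × Matrix (Fin k) (Fin d₂) ℝ → ℝ)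
    (hfX : ∀ A : Matrix (Fin k) (Fin d₁) ℝ × Matrix (Fin k) (Fin d₂) ℝ,
      fX A = ∫ ω, ∑ i, ((A.1 *ᵥ (x₁ ω) - A.2 *ᵥ (x₂ ω)) i) ^ 2 ∂P)
    (hp1 : p ≤ 1)
    (hn : 2 ^ 25 / ε ^ 4 * (β / σ) ^ 4 *
          (Real.log (2 ^ 3 * ((d₁ : ℝ) + (d₂ : ℝ))) + Real.log (2 / p)) ≤ (n : ℝ)) :
    ENNReal.ofReal (1 - p)
      ≤ (Measure.pi fun _ : Fin n => P)
        {xs | |sInf (empObj n d₁ d₂ k (fun j => x₁ (xs j) + μ₁) (fun j => x₂ (xs j) + μ₂) ''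
                  empFeasible n d₁ d₂ k (fun j => x₁ (xs j) + μ₁) (fun j => x₂ (xs j) + μ₂))
              - sInf (fX '' feas k (covM P x₁ x₁) (covM P x₂ x₂))| ≤ ε * β ^ 2 / σ ^ 2} := by
  have hprob1 : ENNReal.ofReal (1 - p) ≤ 1 := by
    rw [ENNReal.ofReal_le_one]; linarith
  have triv : ∀ (Q : (Fin n → Ω) → Prop), (∀ xs, Q xs) →
      ENNReal.ofReal (1 - p) ≤ (Measure.pi fun _ : Fin n => P) {xs | Q xs} := by
    intro Q hQ
    have : {xs | Q xs} = Set.univ := Set.eq_univ_of_forall hQ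
    rw [this, measure_univ]; exact hprob1
  -- integrability
  have c₁ : ∀ᵐ ω ∂P, ∀ a, |x₁ ω a| ≤ β := by
    filter_upwards [hb₁] with ω hω a
    apply abs_le_of_sq_le_sq _ hβ0
    exact (Finset.single_le_sum (f := fun a => x₁ ω a ^ 2) (fun _ _ => sq_nonneg _)
      (Finset.mem_univ a)).trans hω
  have c₂ : ∀ᵐ ω ∂P, ∀ a, |x₂ ω a| ≤ β := by
    filter_upwards [hb₂] with ω hω a
    apply abs_le_of_sq_le_sq _ hβ0
    exact (Finset.single_le_sum (f := fun a => x₂ ω a ^ 2) (fun _ _ => sq_nonneg _)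
      (Finset.mem_univ a)).trans hω
  have i₁₁ : ∀ a b, Integrable (fun ω => x₁ ω a * x₁ ω b) P := fun a b => by
    apply Integrable.of_bound (Measurable.aestronglyMeasurable (by fun_prop)) (β * β)
    filter_upwards [c₁] with ω h
    rw [Real.norm_eq_abs, abs_mul]; exact mul_le_mul (h a) (h b) (abs_nonneg _) hβ0
  have i₁₂ : ∀ a b, Integrable (fun ω => x₁ ω a * x₂ ω b) P := fun a b => by
    apply Integrable.of_bound (Measurable.aestronglyMeasurable (by fun_prop)) (β * β)
    filter_upwards [c₁, c₂] with ω h h'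
    rw [Real.norm_eq_abs, abs_mul]; exact mul_le_mul (h a) (h' b) (abs_nonneg _) hβ0
  have i₂₂ : ∀ a b, Integrable (fun ω => x₂ ω a * x₂ ω b) P := fun a b => by
    apply Integrable.of_bound (Measurable.aestronglyMeasurable (by fun_prop)) (β * β)
    filter_upwards [c₂] with ω h
    rw [Real.norm_eq_abs, abs_mul]; exact mul_le_mul (h a) (h b) (abs_nonneg _) hβ0
  have hf0 : ∀ A, 0 ≤ fX A := fun A => by
    rw [hfX]; exact integral_nonneg fun ω => Finset.sum_nonneg fun i _ => sq_nonneg _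
  have hff : ∀ A, fX A = (A.1 * covM P x₁ x₁ * A.1ᵀ).trace + (A.2 * covM P x₂ x₂ * A.2ᵀ).trace
        - 2 * (A.1 * covM P x₁ x₂ * A.2ᵀ).trace := fun A => by
    rw [hfX, obj_formula P x₁ x₂ i₁₁ i₁₂ i₂₂]
  have hfeas : ∀ v₁ v₂, empFeasible n d₁ d₂ k v₁ v₂ = feas k (empCov n d₁ v₁) (empCov n d₂ v₂) :=
    fun _ _ => rfl
  simp only [hfeas]
  have hrhs : 0 ≤ ε * β ^ 2 / σ ^ 2 := by positivity
  by_cases hk : k ≤ d₁ ∧ k ≤ d₂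
  swap
  · apply triv
    intro xs
    rw [feas_empty _ _ hk, feas_empty _ _ hk]; simpa using hrhs
  by_cases htriv : 2 * (k : ℝ) ≤ ε * β ^ 2 / σ ^ 2
  · apply triv
    intro xs
    have r1 := sInf_mca_range hf0 hff
    have r2 := sInf_mca_range (empObj_nonneg n d₁ d₂ k (fun j => x₁ (xs j) + μ₁)
      (fun j => x₂ (xs j) + μ₂)) (empObj_eq n d₁ d₂ k (fun j => x₁ (xs j) + μ₁)
      (fun j => x₂ (xs j) + μ₂))
    rw [abs_le]; constructor <;> linarith
  push Not at htriv
  have hdim := dim_le P x₁ β (σ ^ 2) hb₁ i₁₁ hlam₁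
  have hk1 : (k : ℝ) ≤ d₁ := by exact_mod_cast hk.1
  have hσ2 : 0 < σ ^ 2 := by positivity
  have hkβ : (k : ℝ) * σ ^ 2 ≤ β ^ 2 := le_trans (by gcongr) hdim
  have hkpos : 0 < k := by
    rcases Nat.eq_zero_or_pos k with h | h
    · rw [h] at htriv; push_cast at htriv; linarith
    · exact h
  have hk1' : (1 : ℝ) ≤ k := by exact_mod_cast hkpos
  have hε2 : ε < 2 := by
    rw [div_lt_iff₀ hσ2] at htriv
    by_contra h; push Not at h
    have : 2 * β ^ 2 ≤ ε * β ^ 2 := by gcongr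
    nlinarith
  have hσβ : σ ^ 2 ≤ β ^ 2 := by nlinarith
  have hβ : 0 < β := by
    rcases hβ0.lt_or_eq with h | h
    · exact h
    · rw [← h] at hσβ; nlinarith
  -- sample size
  set L := Real.log (2 ^ 3 * ((d₁ : ℝ) + (d₂ : ℝ))) + Real.log (2 / p) with hL
  have hL1 : 1 + Real.log (1 / p) ≤ L := by
    have e : Real.log (2 / p) = Real.log 2 + Real.log (1 / p) := by
      rw [← Real.log_mul (by norm_num) (by positivity)]; congr 1; ring
    have h2 : Real.log 4 ≤ Real.log (2 ^ 3 * ((d₁ : ℝ) + (d₂ : ℝ))) := by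
      apply Real.log_le_log (by norm_num)
      have : (0:ℝ) ≤ d₂ := by positivity
      linarith
    have h4 : Real.log 4 = 2 * Real.log 2 := by
      rw [show (4:ℝ) = 2 ^ 2 by norm_num, Real.log_pow]; norm_num
    have := Real.log_two_gt_d9
    rw [hL, e]; linarith
  have hlogp : 0 ≤ Real.log (1 / p) := Real.log_nonneg (by rw [le_div_iff₀ hp]; linarith)
  have hLpos : 0 < L := by linarith
  have hnpos : (0:ℝ) < n := lt_of_lt_of_le (by positivity) hn
  have hn0 : 0 < n := by exact_mod_cast hnpos
  set τ := ε ^ 2 * σ ^ 2 / 2 ^ 8 with hτ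
  have hτ0 : 0 ≤ τ := by positivity
  have hε4 : ε ^ 2 ≤ 4 := by nlinarith
  have hτβ : τ ≤ β ^ 2 := by
    rw [hτ, div_le_iff₀ (by norm_num)]; nlinarith
  -- concentration
  let x : Ω → (Fin d₁ ⊕ Fin d₂) → ℝ := fun ω => Sum.elim (x₁ ω) (x₂ ω)
  have hxm : ∀ a, Measurable fun ω => x ω a := by
    rintro (a | a)
    · exact (measurable_pi_apply a).comp hx₁
    · exact (measurable_pi_apply a).comp hx₂
  let U : Ω → EuclideanSpace ℝ (((Fin d₁ ⊕ Fin d₂) × (Fin d₁ ⊕ Fin d₂)) ⊕ (Fin d₁ ⊕ Fin d₂)) :=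
    fun ω => Uvec β (x ω)
  have hU : Measurable U := by
    apply (WithLp.measurable_toLp 2 _).comp
    rw [measurable_pi_iff]
    rintro (q | a)
    · exact (hxm q.1).mul (hxm q.2)
    · exact (hxm a).const_mul β
  have hUb : ∀ᵐ ω ∂P, ‖U ω‖ ≤ 5 / 2 * β ^ 2 := by
    filter_upwards [hb₁, hb₂] with ω h1 h2
    apply Uvec_norm
    rw [Fintype.sum_sum_type]
    simp only [x, Sum.elim_inl, Sum.elim_inr]
    linarith
  have hUi : Integrable U P := Integrable.of_bound hU.aestronglyMeasurable _ hUb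
  set m := ∫ ω, U ω ∂P with hm
  have hcoord : ∀ i, m i = ∫ ω, U ω i ∂P := by
    intro i
    have := (EuclideanSpace.proj i : EuclideanSpace ℝ (((Fin d₁ ⊕ Fin d₂) × (Fin d₁ ⊕ Fin d₂)) ⊕
      (Fin d₁ ⊕ Fin d₂)) →L[ℝ] ℝ).integral_comp_comm hUi
    simpa using this.symm
  have hm0 : ∀ a, m (Sum.inr a) = 0 := by
    intro a
    rw [hcoord]
    simp only [U, Uvec, Sum.elim_inr]
    rw [integral_const_mul]
    rcases a with a | a
    · simp only [x, Sum.elim_inl]; rw [hm₁]; simp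
    · simp only [x, Sum.elim_inr]; rw [hm₂]; simp
  have htail := conc_tail P U hU (5 / 2 * β ^ 2) (by positivity) hUb n hn0 τ hτ0
  have hexp : Real.exp (1 - n * τ ^ 2 / (16 * (5 / 2 * β ^ 2) ^ 2)) ≤ p := by
    rw [← Real.le_log_iff_exp_le hp]
    have e : Real.log p = - Real.log (1 / p) := by rw [one_div, Real.log_inv]; ring
    have h1 : 2 ^ 9 * β ^ 4 * L ≤ n * τ ^ 2 := by
      calc 2 ^ 9 * β ^ 4 * L = (2 ^ 25 / ε ^ 4 * (β / σ) ^ 4 * L) * τ ^ 2 := by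
            rw [hτ]; field_simp
        _ ≤ _ := by gcongr
    have h2 : L ≤ n * τ ^ 2 / (16 * (5 / 2 * β ^ 2) ^ 2) := by
      rw [le_div_iff₀ (by positivity)]
      have : 0 ≤ β ^ 4 * L := by positivity
      nlinarith
    rw [e]; linarith
  have htail' := htail.trans (ENNReal.ofReal_le_ofReal hexp)
  set G := {xs : Fin n → Ω | τ ≤ ‖(n : ℝ)⁻¹ • ∑ j, (U (xs j) - ∫ ω, U ω ∂P)‖} with hG
  have hGm : MeasurableSet G := by
    apply measurableSet_le measurable_const
    fun_prop
  have hGc : ENNReal.ofReal (1 - p) ≤ (Measure.pi fun _ : Fin n => P) Gᶜ := by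
    rw [prob_compl_eq_one_sub hGm, ENNReal.ofReal_sub _ hp.le, ENNReal.ofReal_one]
    gcongr
  refine hGc.trans (measure_mono ?_)
  intro xs hxs
  have hdev : ‖(n : ℝ)⁻¹ • ∑ j, (Uvec β (x (xs j)) - m)‖ ≤ τ := by
    have : ¬ (τ ≤ ‖(n : ℝ)⁻¹ • ∑ j, (U (xs j) - ∫ ω, U ω ∂P)‖) := hxs
    exact (not_le.1 this).le
  have hmi : ∀ q : (Fin d₁ ⊕ Fin d₂) × (Fin d₁ ⊕ Fin d₂),
      m (Sum.inl q) = ∫ ω, x ω q.1 * x ω q.2 ∂P := fun q => by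
    rw [hcoord]; rfl
  set v₁ : Fin n → Fin d₁ → ℝ := fun j => x₁ (xs j) + μ₁ with hv₁
  set v₂ : Fin n → Fin d₂ → ℝ := fun j => x₂ (xs j) + μ₂ with hv₂
  have hvv₁ : ∀ j a, x (xs j) (Function.Embedding.inl a) = v₁ j a - μ₁ a := by
    intro j a; simp [x, hv₁]
  have hvv₂ : ∀ j a, x (xs j) (Function.Embedding.inr a) = v₂ j a - μ₂ a := by
    intro j a; simp [x, hv₂]
  have b₁ := block_dev n hn0 (fun j => x (xs j)) m hm0 β τ hβ hτ0 hτβ hdev v₁ v₁ μ₁ μ₁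
    Function.Embedding.inl Function.Embedding.inl hvv₁ hvv₁ (covM P x₁ x₁)
    (fun a b => by rw [hmi]; rfl)
  have b₂ := block_dev n hn0 (fun j => x (xs j)) m hm0 β τ hβ hτ0 hτβ hdev v₂ v₂ μ₂ μ₂
    Function.Embedding.inr Function.Embedding.inr hvv₂ hvv₂ (covM P x₂ x₂)
    (fun a b => by rw [hmi]; rfl)
  have b₁₂ := block_dev n hn0 (fun j => x (xs j)) m hm0 β τ hβ hτ0 hτβ hdev v₁ v₂ μ₁ μ₂
    Function.Embedding.inl Function.Embedding.inr hvv₁ hvv₂ (covM P x₁ x₂)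
    (fun a b => by rw [hmi]; rfl)
  have hδτ : 2 * τ = (ε ^ 2 / 2 ^ 7) * σ ^ 2 := by rw [hτ]; ring
  rw [hδτ] at b₁ b₂ b₁₂
  have hfin := det_main (k := k) (covM P x₁ x₁) (empCov n d₁ v₁) (covM P x₂ x₂) (empCov n d₂ v₂)
    (covM P x₁ x₂) (covM (cntM n) (fun j => v₁ j - empMean n d₁ v₁)
          (fun j => v₂ j - empMean n d₂ v₂)) (cov_CS P x₁ x₂ i₁₁ i₁₂ i₂₂)
    (by
      rw [empCov_eq, empCov_eq]
      exact cov_CS _ _ _ (fun _ _ => intg_cntM _ _)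
        (fun _ _ => intg_cntM _ _) (fun _ _ => intg_cntM _ _))
    (σ ^ 2) (ε ^ 2 / 2 ^ 7) hσ2 (by linarith) (psd_quad _ _ hlam₁) (psd_quad _ _ hlam₂)
    (by rw [empCov_eq]; exact covM_symm _ _) (by rw [empCov_eq]; exact covM_symm _ _)
    (covM_symm _ _) (covM_symm _ _) (by rw [empCov_eq]; exact b₁) (by rw [empCov_eq]; exact b₂) b₁₂
    fX (empObj n d₁ d₂ k v₁ v₂) hf0 (empObj_nonneg n d₁ d₂ k v₁ v₂) hff
    (empObj_eq n d₁ d₂ k v₁ v₂)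
  refine hfin.trans ?_
  rw [le_div_iff₀ hσ2]
  have q1 : ε ^ 2 ≤ 2 * ε := by nlinarith
  have q2 : ε ^ 2 * (k * σ ^ 2) ≤ (2 * ε) * β ^ 2 := by gcongr
  have q3 : 0 ≤ ε * β ^ 2 := by positivity
  calc 16 * (k:ℝ) * (ε ^ 2 / 2 ^ 7) * σ ^ 2 = (ε ^ 2 * (k * σ ^ 2)) / 8 := by ring
    _ ≤ _ := by linarith
end fin2

/-- explicit-constant MCA sample complexity: Let `X = [X₁; X₂]` have mean `μ`
with `‖X - μ‖_{2,∞} ≤ β` a.s. and `minᵢ λ_min(Σ_{Xᵢ}) ≥ σ² > 0` (encoded by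
`(Σᵢ - σ² I).PosSemidef`). Fix `k`, `p ∈ (0,1]`, `ε ∈ (0, 2⁵]`. If
`n ≥ max{(2¹⁵/ε²)(k(d₁+d₂) log(2²²k/ε²) + log(2/p)), (2²⁵/ε⁴)(β/σ)⁴(log(2³(d₁+d₂)) + log(2/p))}`,
then with probability at least `1 - p` over `n` i.i.d. samples,
`|min_{S_{X̂}} f_{X̂} - min_{S_X} f_X| ≤ ε β²/σ²` (minima as `sInf` of image sets). -/
theorem mca_sample_complexity_explicit {Ω : Type*} [MeasurableSpace Ω] (P : Measure Ω)
    [IsProbabilityMeasure P] (d₁ d₂ k n : ℕ)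
    (X : Ω → (Fin d₁ → ℝ) × (Fin d₂ → ℝ)) (hX : Measurable X) (hXint : Integrable X P)
    (β σ p ε : ℝ) (hσ : 0 < σ) (hp : 0 < p) (hp1 : p ≤ 1) (hε : 0 < ε) (hε5 : ε ≤ 2 ^ 5)
    (μ₁ : Fin d₁ → ℝ) (hμ₁ : μ₁ = ∫ ω, (X ω).1 ∂P)
    (μ₂ : Fin d₂ → ℝ) (hμ₂ : μ₂ = ∫ ω, (X ω).2 ∂P)
    (hbound : ∀ᵐ ω ∂P,
      max (Real.sqrt (∑ a, ((X ω).1 a - μ₁ a) ^ 2))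
          (Real.sqrt (∑ a, ((X ω).2 a - μ₂ a) ^ 2)) ≤ β)
    (Sig₁ : Matrix (Fin d₁) (Fin d₁) ℝ)
    (hSig₁ : Sig₁ = Matrix.of fun a b => ∫ ω, ((X ω).1 a - μ₁ a) * ((X ω).1 b - μ₁ b) ∂P)
    (Sig₂ : Matrix (Fin d₂) (Fin d₂) ℝ)
    (hSig₂ : Sig₂ = Matrix.of fun a b => ∫ ω, ((X ω).2 a - μ₂ a) * ((X ω).2 b - μ₂ b) ∂P)
    (hlam₁ : (Sig₁ - σ ^ 2 • (1 : Matrix (Fin d₁) (Fin d₁) ℝ)).PosSemidef)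
    (hlam₂ : (Sig₂ - σ ^ 2 • (1 : Matrix (Fin d₂) (Fin d₂) ℝ)).PosSemidef)
    (fX : Matrix (Fin k) (Fin d₁) ℝ × Matrix (Fin k) (Fin d₂) ℝ → ℝ)
    (hfX : ∀ A : Matrix (Fin k) (Fin d₁) ℝ × Matrix (Fin k) (Fin d₂) ℝ,
      fX A = ∫ ω, ∑ i, ((A.1 *ᵥ ((X ω).1 - μ₁) - A.2 *ᵥ ((X ω).2 - μ₂)) i) ^ 2 ∂P)
    (SX : Set (Matrix (Fin k) (Fin d₁) ℝ × Matrix (Fin k) (Fin d₂) ℝ))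
    (hSX : SX = {A | A.1 * Sig₁ * A.1ᵀ = 1 ∧ A.2 * Sig₂ * A.2ᵀ = 1})
    (hn : max
        (2 ^ 15 / ε ^ 2 *
          ((k : ℝ) * ((d₁ : ℝ) + (d₂ : ℝ)) * Real.log (2 ^ 22 * (k : ℝ) / ε ^ 2)
            + Real.log (2 / p)))
        (2 ^ 25 / ε ^ 4 * (β / σ) ^ 4 *
          (Real.log (2 ^ 3 * ((d₁ : ℝ) + (d₂ : ℝ))) + Real.log (2 / p)))
      ≤ (n : ℝ)) :
    ENNReal.ofReal (1 - p)
      ≤ (Measure.pi fun _ : Fin n => P)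
        {xs | |sInf (empObj n d₁ d₂ k (fun j => (X (xs j)).1) (fun j => (X (xs j)).2) ''
                  empFeasible n d₁ d₂ k (fun j => (X (xs j)).1) (fun j => (X (xs j)).2))
              - sInf (fX '' SX)| ≤ ε * β ^ 2 / σ ^ 2} := by
  have hbb : ∀ᵐ ω ∂P, 0 ≤ β ∧ ∑ a, ((X ω).1 a - μ₁ a) ^ 2 ≤ β ^ 2 ∧
      ∑ a, ((X ω).2 a - μ₂ a) ^ 2 ≤ β ^ 2 := by
    filter_upwards [hbound] with ω h
    have h1 := (le_max_left _ _).trans h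
    have h2 := (le_max_right _ _).trans h
    have h0 : 0 ≤ β := (Real.sqrt_nonneg _).trans h1
    exact ⟨h0, (Real.sqrt_le_left h0).1 h1, (Real.sqrt_le_left h0).1 h2⟩
  have hβ0 : 0 ≤ β := by
    obtain ⟨ω, h⟩ := hbb.exists
    exact h.1
  have hX1 : Integrable (fun ω => (X ω).1) P := hXint.fst
  have hX2 : Integrable (fun ω => (X ω).2) P := hXint.snd
  have hm₁ : ∀ a, ∫ ω, ((X ω).1 - μ₁) a ∂P = 0 := by
    intro a
    simp only [Pi.sub_apply]
    have hi : Integrable (fun ω => (X ω).1 a) P := hX1.eval a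
    rw [integral_sub hi (integrable_const _), hμ₁, eval_integral (fun i => hX1.eval i)]
    simp
  have hm₂ : ∀ a, ∫ ω, ((X ω).2 - μ₂) a ∂P = 0 := by
    intro a
    simp only [Pi.sub_apply]
    have hi : Integrable (fun ω => (X ω).2 a) P := hX2.eval a
    rw [integral_sub hi (integrable_const _), hμ₂, eval_integral (fun i => hX2.eval i)]
    simp
  have e₁ : Sig₁ = covM P (fun ω => (X ω).1 - μ₁) (fun ω => (X ω).1 - μ₁) := hSig₁
  have e₂ : Sig₂ = covM P (fun ω => (X ω).2 - μ₂) (fun ω => (X ω).2 - μ₂) := hSig₂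
  have hS : SX = feas k (covM P (fun ω => (X ω).1 - μ₁) (fun ω => (X ω).1 - μ₁))
      (covM P (fun ω => (X ω).2 - μ₂) (fun ω => (X ω).2 - μ₂)) := by
    rw [hSX, ← e₁, ← e₂]; rfl
  have key := main_aux P d₁ d₂ k n (fun ω => (X ω).1 - μ₁) (fun ω => (X ω).2 - μ₂)
    (by fun_prop) (by fun_prop) β σ p ε hσ hp hε hβ0 μ₁ μ₂ hm₁ hm₂
    (hbb.mono fun ω h => h.2.1) (hbb.mono fun ω h => h.2.2) (e₁ ▸ hlam₁) (e₂ ▸ hlam₂) fX hfX hp1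
    ((le_max_right _ _).trans hn)
  rw [hS]
  simpa only [sub_add_cancel] using key
end

section
/- If $n \ge d_1 + d_2 + 1$, then $\operatorname{ALM}(d_1, d_2, n)$ is exactly matchable: there exists a measurable function $\mathcal{D}$ mapping each tuple $\{x_{ij}\}_{i \in \{1,2\}, j \in [n]}$ with $x_{ij} \in \mathbb{R}^{d_i}$ to a tuple $(A_1, b_1, A_2, b_2)$ with $A_i \in \mathbb{R}^{k \times d_i}$ and $b_i \in \mathbb{R}^k$ for some common $k \ge 1$, such that for every $D \in \mathbb{N}$, every probability distribution $\mathbb{P}$ on $\mathbb{R}^D$ that is absolutely continuous with respect to Lebesgue measure, every $S_i \in \mathbb{R}^{d_i \times D}$ and $\mu_i \in \mathbb{R}^{d_i}$, if $\omega_1, \ldots, \omega_n$ are drawn independently with distribution $\mathbb{P}$ and $(A_1, b_1, A_2, b_2) := \mathcal{D}(\{S_i\omega_j + \mu_i\}_{i \in \{1,2\}, j \in [n]})$, then almost surely both (i) $A_1(S_1\omega + \mu_1) + b_1 = A_2(S_2\omega + \mu_2) + b_2$ for all $\omega \in \mathbb{R}^D$, and (ii) $\ker A_1 S_1 = \ker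 S_1 + \ker S_2$ (equivalently $\ker A_i S_i = \ker S_1 + \ker S_2$ for both $i$). -/
open Matrix MeasureTheory

/-- The (Borel) product measurable structure on matrices. -/
noncomputable instance matrixMeasurableSpace {m n : Type*} :
    MeasurableSpace (Matrix m n ℝ) :=
  MeasurableSpace.pi

/-- `ALM(d₁, d₂, n)` is *exactly matchable* if there is a `k ≥ 1` and a measurable map
`𝒟` sending matched samples `{x_{ij}}_{i ∈ {1,2}, j ∈ [n]}` to `(A₁, b₁, A₂, b₂)` with
`Aᵢ ∈ ℝ^{k×dᵢ}`, `bᵢ ∈ ℝ^k`, such that for every `D`, every probability measure `ℙ` on `ℝ^D`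
absolutely continuous w.r.t. Lebesgue measure, and every `Sᵢ ∈ ℝ^{dᵢ×D}`, `μᵢ ∈ ℝ^{dᵢ}`,
if `ω₁, …, ωₙ` are i.i.d. with distribution `ℙ` and
`(A₁, b₁, A₂, b₂) = 𝒟({Sᵢωⱼ + μᵢ})`, then almost surely both
(i) `A₁(S₁ω + μ₁) + b₁ = A₂(S₂ω + μ₂) + b₂` for all `ω ∈ ℝ^D`, and
(ii) `ker A₁S₁ = ker S₁ + ker S₂`. -/
def ExactlyMatchable (d₁ d₂ n : ℕ) : Prop :=
  ∃ k : ℕ, 0 < k ∧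
    ∃ Dfun : (Fin n → Fin d₁ → ℝ) × (Fin n → Fin d₂ → ℝ) →
        (Matrix (Fin k) (Fin d₁) ℝ × (Fin k → ℝ)) × (Matrix (Fin k) (Fin d₂) ℝ × (Fin k → ℝ)),
      Measurable Dfun ∧
      ∀ (D : ℕ) (P : Measure (Fin D → ℝ)) [IsProbabilityMeasure P],
        P ≪ MeasureTheory.volume →
        ∀ (S₁ : Matrix (Fin d₁) (Fin D) ℝ) (S₂ : Matrix (Fin d₂) (Fin D) ℝ)
          (μ₁ : Fin d₁ → ℝ) (μ₂ : Fin d₂ → ℝ),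
        ∀ᵐ ωs ∂(Measure.pi fun _ : Fin n => P),
          (∀ ω : Fin D → ℝ,
            (Dfun (fun j => S₁ *ᵥ ωs j + μ₁, fun j => S₂ *ᵥ ωs j + μ₂)).1.1 *ᵥ
                (S₁ *ᵥ ω + μ₁) +
              (Dfun (fun j => S₁ *ᵥ ωs j + μ₁, fun j => S₂ *ᵥ ωs j + μ₂)).1.2 =
            (Dfun (fun j => S₁ *ᵥ ωs j + μ₁, fun j => S₂ *ᵥ ωs j + μ₂)).2.1 *ᵥ
                (S₂ *ᵥ ω + μ₂) +
              (Dfun (fun j => S₁ *ᵥ ωs j + μ₁, fun j => S₂ *ᵥ ωs j + μ₂)).2.2) ∧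
          LinearMap.ker
              (((Dfun (fun j => S₁ *ᵥ ωs j + μ₁, fun j => S₂ *ᵥ ωs j + μ₂)).1.1
                * S₁).mulVecLin)
            = LinearMap.ker S₁.mulVecLin ⊔ LinearMap.ker S₂.mulVecLin


theorem alm_aux_li {D : ℕ} {ι : Type*} [Fintype ι] (P : Measure (Fin D → ℝ))
    [IsProbabilityMeasure P] (hP : P ≪ volume) (z : (Fin D → ℝ) →ᵃ[ℝ] (ι → ℝ)) (k : ℕ)
    (hk : k ≤ Module.finrank ℝ (Submodule.span ℝ (Set.range z))) :
    ∀ᵐ ωs ∂(Measure.pi fun _ : Fin k => P), LinearIndependent ℝ (fun j => z (ωs j)) := by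
  have hzc : Continuous z := z.continuous_of_finiteDimensional
  induction k with
  | zero => exact Filter.Eventually.of_forall fun _ => linearIndependent_empty_type
  | succ k ih =>
    have ih := ih (by omega)
    have hmp := measurePreserving_piFinSuccAbove (fun _ : Fin (k+1) => P) 0
    have hmeas : MeasurableSet {p : (Fin D → ℝ) × (Fin k → Fin D → ℝ) |
        LinearIndependent ℝ (Fin.cons (z p.1) (fun j => z (p.2 j)) : Fin (k+1) → ι → ℝ)} := by
      apply IsOpen.measurableSet
      have hc : Continuous fun p : (Fin D → ℝ) × (Fin k → Fin D → ℝ) =>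
        (Fin.cons (z p.1) (fun j => z (p.2 j)) : Fin (k+1) → ι → ℝ) := by
        refine continuous_pi fun i => ?_
        refine Fin.cases ?_ (fun j => ?_) i
        · simp only [Fin.cons_zero]
          fun_prop
        · simp only [Fin.cons_succ]
          fun_prop
      exact isOpen_setOfPred_linearIndependent.preimage hc
    have key : ∀ᵐ p ∂(P.prod (Measure.pi fun _ : Fin k => P)),
        LinearIndependent ℝ (Fin.cons (z p.1) (fun j => z (p.2 j)) : Fin (k+1) → ι → ℝ) := by
      rw [Measure.ae_prod_iff_ae_ae hmeas, Measure.ae_ae_comm hmeas]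
      filter_upwards [ih] with ωs hωs
      set V := Submodule.span ℝ (Set.range fun j => z (ωs j)) with hV
      have hVr : Module.finrank ℝ V = k := by
        rw [hV, finrank_span_eq_card hωs, Fintype.card_fin]
      have hnot : V.toAffineSubspace.comap z ≠ ⊤ := by
        intro h
        have : Submodule.span ℝ (Set.range z) ≤ V := by
          rw [Submodule.span_le]
          rintro _ ⟨ω, rfl⟩
          have : ω ∈ V.toAffineSubspace.comap z := by rw [h]; trivial
          simpa using this
        have := Submodule.finrank_mono this
        omega
      have h0 := hP (Measure.addHaar_affineSubspace volume _ hnot)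
      have h1 : ∀ᵐ ω ∂P, ω ∉ (V.toAffineSubspace.comap z : Set (Fin D → ℝ)) :=
        measure_eq_zero_iff_ae_notMem.1 h0
      filter_upwards [h1] with ω hω
      rw [linearIndependent_finCons]
      refine ⟨hωs, fun h => hω ?_⟩
      simpa using h
    have := hmp.quasiMeasurePreserving.ae key
    filter_upwards [this] with ωs h
    convert h using 1
    ext j
    refine Fin.cases ?_ (fun i => ?_) j <;> simp [MeasurableEquiv.piFinSuccAbove, Fin.insertNthEquiv]
    all_goals rfl

theorem alm_aux_proj {Ω : Type*} [MeasurableSpace Ω] (P : Measure Ω) [IsProbabilityMeasure P]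
    {r n : ℕ} (f : Fin r → Fin n) (hf : Function.Injective f) :
    MeasurePreserving (fun ωs : Fin n → Ω => fun j => ωs (f j)) (Measure.pi fun _ => P)
      (Measure.pi fun _ => P) := by
  refine ⟨by fun_prop, ?_⟩
  have h1 := (ProbabilityTheory.iIndepFun_pi (μ := fun _ : Fin n => P) (X := fun _ x => x)
    (fun _ => aemeasurable_id)).precomp hf
  have := (ProbabilityTheory.iIndepFun_iff_map_fun_eq_pi_map
    (fun i => (measurable_pi_apply (f i)).aemeasurable)).1 h1
  simpa [Function.comp_def, Measure.map_id', (measurePreserving_eval (fun _ : Fin n => P) _).map_eq] using this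

theorem alm_aux_span {D n : ℕ} {ι : Type*} [Fintype ι] (P : Measure (Fin D → ℝ))
    [IsProbabilityMeasure P] (hP : P ≪ volume) (z : (Fin D → ℝ) →ᵃ[ℝ] (ι → ℝ))
    (hn : Fintype.card ι ≤ n) :
    ∀ᵐ ωs ∂(Measure.pi fun _ : Fin n => P), ∀ ω,
      z ω ∈ Submodule.span ℝ (Set.range fun j => z (ωs j)) := by
  set r := Module.finrank ℝ (Submodule.span ℝ (Set.range z)) with hr
  have hrn : r ≤ n := by
    have := Submodule.finrank_le (Submodule.span ℝ (Set.range z))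
    simp at this
    omega
  have h := alm_aux_li P hP z r le_rfl
  have := (alm_aux_proj P (Fin.castLE hrn) (Fin.castLE_injective hrn)).quasiMeasurePreserving.ae h
  filter_upwards [this] with ωs hωs ω
  have hle : Submodule.span ℝ (Set.range fun j => z (ωs (Fin.castLE hrn j))) ≤
      Submodule.span ℝ (Set.range z) := by
    apply Submodule.span_mono
    rintro _ ⟨j, rfl⟩
    exact ⟨_, rfl⟩
  have heq := Submodule.eq_of_le_of_finrank_eq hle (by
    rw [finrank_span_eq_card hωs, Fintype.card_fin])
  have h1 : z ω ∈ Submodule.span ℝ (Set.range z) := Submodule.subset_span ⟨ω, rfl⟩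
  rw [← heq] at h1
  refine Submodule.span_mono ?_ h1
  rintro _ ⟨j, rfl⟩
  exact ⟨_, rfl⟩

theorem alm_aux_matrix {ι : Type*} [Fintype ι] [DecidableEq ι] (G : Matrix ι ι ℝ)
    (hG : G.PosSemidef) : ∃ M : Matrix ι ι ℝ, M.IsSymm ∧ G * M = 0 ∧
      (∀ v, G *ᵥ v = 0 → M *ᵥ v = v) ∧
      ∀ i j, Filter.Tendsto (fun m : ℕ => (1 + (m : ℝ) • G).det⁻¹ * (1 + (m : ℝ) • G).adjugate i j)
        Filter.atTop (nhds (M i j)) := by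
  have hH := hG.1
  set l := hH.eigenvalues with hl
  have hl0 : ∀ i, 0 ≤ l i := hG.eigenvalues_nonneg
  set U : Matrix ι ι ℝ := (hH.eigenvectorUnitary : Matrix ι ι ℝ) with hU
  have hUU : Uᵀ * U = 1 := by
    have := Unitary.coe_star_mul_self hH.eigenvectorUnitary
    simpa [star_eq_conjTranspose] using this
  have hUU' : U * Uᵀ = 1 := mul_eq_one_comm.1 hUU
  have hsp : G = U * diagonal l * Uᵀ := by
    have := hH.spectral_theorem
    rw [Unitary.conjStarAlgAut_apply] at this
    simpa [star_eq_conjTranspose, Function.comp_def] using this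
  have hconj : ∀ a b : ι → ℝ, (U * diagonal a * Uᵀ) * (U * diagonal b * Uᵀ)
      = U * diagonal (fun i => a i * b i) * Uᵀ := by
    intro a b
    calc _ = U * diagonal a * (Uᵀ * U) * diagonal b * Uᵀ := by simp only [Matrix.mul_assoc]
      _ = _ := by rw [hUU, Matrix.mul_one, Matrix.mul_assoc U, diagonal_mul_diagonal]
  have hadd : ∀ a b : ι → ℝ, (U * diagonal a * Uᵀ) + (U * diagonal b * Uᵀ)
      = U * diagonal (fun i => a i + b i) * Uᵀ := by
    intro a b
    rw [← Matrix.add_mul, ← Matrix.mul_add, diagonal_add]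
  have hone : (1 : Matrix ι ι ℝ) = U * diagonal (fun _ => 1) * Uᵀ := by
    simp [hUU']
  set M := U * diagonal (fun i => if l i = 0 then (1:ℝ) else 0) * Uᵀ with hM
  have hinv : ∀ m : ℕ, (1 + (m : ℝ) • G)⁻¹ = U * diagonal (fun i => (1 + m * l i)⁻¹) * Uᵀ := by
    intro m
    apply inv_eq_right_inv
    have : (1 + (m : ℝ) • G) = U * diagonal (fun i => 1 + m * l i) * Uᵀ := by
      have h2 : (m : ℝ) • G = U * diagonal (fun i => m * l i) * Uᵀ := by
        conv_lhs => rw [hsp]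
        rw [← Matrix.smul_mul, ← Matrix.mul_smul, ← diagonal_smul]
        rfl
      rw [h2]
      conv_lhs => rw [hone]
      rw [hadd]
    rw [this, hconj]
    conv_rhs => rw [hone]
    congr
    ext i
    have : 0 < 1 + m * l i := by have := hl0 i; positivity
    field_simp
  refine ⟨M, ?_, ?_, ?_, ?_⟩
  · simp [Matrix.IsSymm, hM, Matrix.mul_assoc]
  · rw [hsp, hM, hconj]
    have : (fun i => l i * if l i = 0 then (1:ℝ) else 0) = fun _ => 0 := by
      ext i; split_ifs with h <;> simp [h]
    rw [this]
    simp
  · intro v hv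
    have : M + (U * diagonal (fun i => (l i)⁻¹) * Uᵀ) * G = 1 := by
      conv_lhs => rw [hsp]
      rw [hconj, hM, hadd]
      conv_rhs => rw [hone]
      congr
      ext i
      split_ifs with h <;> simp [h]
    have h3 := congrArg (· *ᵥ v) this
    simpa [Matrix.add_mulVec, ← Matrix.mulVec_mulVec, hv] using h3
  · intro i j
    have : ∀ m : ℕ, (1 + (m : ℝ) • G).det⁻¹ * (1 + (m : ℝ) • G).adjugate i j =
        ∑ a, U i a * (1 + m * l a)⁻¹ * U j a := by
      intro m
      have := congrFun (congrFun (hinv m) i) j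
      rw [Matrix.inv_def, Matrix.mul_apply] at this
      simpa [Matrix.mul_diagonal] using this
    simp_rw [this]
    have hMij : M i j = ∑ a, U i a * (if l a = 0 then (1:ℝ) else 0) * U j a := by
      rw [hM, Matrix.mul_apply]
      simp [Matrix.mul_diagonal]
    rw [hMij]
    refine tendsto_finsetSum _ fun a _ => ?_
    refine (Filter.Tendsto.const_mul _ ?_).mul_const _
    split_ifs with h
    · simp [h]
    · have hpos : 0 < l a := lt_of_le_of_ne (hl0 a) (Ne.symm h)
      refine Filter.Tendsto.inv_tendsto_atTop ?_
      refine Filter.tendsto_atTop_add_const_left _ _ ?_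
      exact Filter.Tendsto.atTop_mul_const hpos tendsto_natCast_atTop_atTop

def almZ {d₁ d₂ n : ℕ} (x : (Fin n → Fin d₁ → ℝ) × (Fin n → Fin d₂ → ℝ)) :
    Matrix (Fin n) (Fin d₁ ⊕ (Fin d₂ ⊕ Unit)) ℝ :=
  fun j => Sum.elim (x.1 j) (Sum.elim (x.2 j) (fun _ => 1))

theorem almZ_continuous {d₁ d₂ n : ℕ} : Continuous (almZ (d₁ := d₁) (d₂ := d₂) (n := n)) := by
  refine continuous_pi fun j => continuous_pi fun a => ?_
  rcases a with a | a | a <;> simp only [almZ, Sum.elim_inl, Sum.elim_inr] <;> fun_prop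

noncomputable def almAff {d₁ d₂ D : ℕ} (S₁ : Matrix (Fin d₁) (Fin D) ℝ)
    (S₂ : Matrix (Fin d₂) (Fin D) ℝ) (μ₁ : Fin d₁ → ℝ) (μ₂ : Fin d₂ → ℝ) :
    (Fin D → ℝ) →ᵃ[ℝ] (Fin d₁ ⊕ (Fin d₂ ⊕ Unit) → ℝ) where
  toFun ω := Sum.elim (S₁ *ᵥ ω + μ₁) (Sum.elim (S₂ *ᵥ ω + μ₂) (fun _ => 1))
  linear :=
    { toFun := fun ω => Sum.elim (S₁ *ᵥ ω) (Sum.elim (S₂ *ᵥ ω) (fun _ => 0))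
      map_add' := by
        intro a b
        ext (i | i | i) <;> simp [Matrix.mulVec_add]
      map_smul' := by
        intro a b
        ext (i | i | i) <;> simp [Matrix.mulVec_smul] }
  map_vadd' := by
    intro a b
    ext (i | i | i) <;> simp [Matrix.mulVec_add, add_assoc]

theorem alm_aux_dual {d D : ℕ} (S : Matrix (Fin d) (Fin D) ℝ) (f : (Fin D → ℝ) →ₗ[ℝ] ℝ)
    (hf : LinearMap.ker S.mulVecLin ≤ LinearMap.ker f) :
    ∃ u : Fin d → ℝ, ∀ ω, f ω = u ⬝ᵥ (S *ᵥ ω) := by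
  have h : f ∈ LinearMap.range S.mulVecLin.dualMap := by
    rw [LinearMap.range_dualMap_eq_dualAnnihilator_ker, Submodule.mem_dualAnnihilator]
    exact fun w hw => hf hw
  obtain ⟨g, rfl⟩ := h
  refine ⟨fun i => g (Pi.single i 1), fun ω => ?_⟩
  rw [LinearMap.dualMap_apply, LinearMap.pi_apply_eq_sum_univ g, dotProduct]
  refine Finset.sum_congr rfl fun i _ => ?_
  have : (fun j => if i = j then (1:ℝ) else 0) = Pi.single i 1 := by
    ext j; simp [Pi.single_apply, eq_comm]
  rw [this, smul_eq_mul, mul_comm, mulVecLin_apply]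

/-- If `n ≥ d₁ + d₂ + 1`, then `ALM(d₁, d₂, n)` is exactly matchable. -/
theorem alm_exactly_matchable (d₁ d₂ n : ℕ) (hd₁ : 0 < d₁) (hd₂ : 0 < d₂)
    (hn : d₁ + d₂ + 1 ≤ n) : ExactlyMatchable d₁ d₂ n := by
  classical
  let ι := Fin d₁ ⊕ (Fin d₂ ⊕ Unit)
  have hcard : Fintype.card ι = d₁ + d₂ + 1 := by simp [ι]; omega
  let e : Fin (d₁ + d₂ + 1) ≃ ι := (Fintype.equivFinOfCardEq hcard).symm
  have hex := fun x : (Fin n → Fin d₁ → ℝ) × (Fin n → Fin d₂ → ℝ) =>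
    alm_aux_matrix ((almZ x)ᴴ * almZ x) (posSemidef_conjTranspose_mul_self _)
  choose M hsym hGM hGv hlim using hex
  have hMmeas : ∀ i j, Measurable fun x => M x i j := by
    intro i j
    refine measurable_of_tendsto_metrizable (f := fun (m : ℕ) x =>
      (1 + (m : ℝ) • ((almZ x)ᴴ * almZ x)).det⁻¹ *
        (1 + (m : ℝ) • ((almZ x)ᴴ * almZ x)).adjugate i j) ?_ ?_
    · intro m
      have hc : Continuous fun x : (Fin n → Fin d₁ → ℝ) × (Fin n → Fin d₂ → ℝ) =>
          (1 + (m : ℝ) • ((almZ x)ᴴ * almZ x)) := by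
        have h1 : Continuous fun x : (Fin n → Fin d₁ → ℝ) × (Fin n → Fin d₂ → ℝ) =>
            (almZ x)ᴴ * almZ x :=
          almZ_continuous.matrix_conjTranspose.matrix_mul almZ_continuous
        fun_prop
      exact hc.matrix_det.measurable.inv.mul (hc.matrix_adjugate.matrix_elem i j).measurable
    · rw [tendsto_pi_nhds]
      exact fun x => hlim x i j
  refine ⟨d₁ + d₂ + 1, by omega, fun x =>
    ((fun r a => M x (e r) (Sum.inl a), fun r => M x (e r) (Sum.inr (Sum.inr ()))),
      (fun r a => - M x (e r) (Sum.inr (Sum.inl a)), fun _ => 0)), ?_, ?_⟩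
  · refine Measurable.prodMk (Measurable.prodMk ?_ ?_) (Measurable.prodMk ?_ ?_)
    · exact measurable_pi_lambda _ fun r => measurable_pi_lambda _ fun a => hMmeas _ _
    · exact measurable_pi_lambda _ fun r => hMmeas _ _
    · exact measurable_pi_lambda _ fun r => measurable_pi_lambda _ fun a => (hMmeas _ _).neg
    · exact measurable_const
  intro D P _ hP S₁ S₂ μ₁ μ₂
  filter_upwards [alm_aux_span P hP (almAff S₁ S₂ μ₁ μ₂) (hcard.trans_le hn)] with ωs hspan
  set x : (Fin n → Fin d₁ → ℝ) × (Fin n → Fin d₂ → ℝ) :=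
    (fun j => S₁ *ᵥ ωs j + μ₁, fun j => S₂ *ᵥ ωs j + μ₂) with hx
  have hrow : ∀ j, almZ x j = almAff S₁ S₂ μ₁ μ₂ (ωs j) := fun j => rfl
  have hZM : almZ x * M x = 0 := by
    have := hGM x
    rwa [conjTranspose_mul_self_mul_eq_zero] at this
  have hMz : ∀ ω, M x *ᵥ almAff S₁ S₂ μ₁ μ₂ ω = 0 := by
    intro ω
    have : Submodule.span ℝ (Set.range fun j => almAff S₁ S₂ μ₁ μ₂ (ωs j)) ≤
        LinearMap.ker (M x).mulVecLin := by
      rw [Submodule.span_le]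
      rintro _ ⟨j, rfl⟩
      have h1 := congrFun hZM j
      change M x *ᵥ almAff S₁ S₂ μ₁ μ₂ (ωs j) = 0
      rw [← hrow, ← (hsym x).eq, mulVec_transpose]
      exact h1
    exact this (hspan ω)
  set A₁ : Matrix (Fin (d₁ + d₂ + 1)) (Fin d₁) ℝ := fun r a => M x (e r) (Sum.inl a) with hA₁
  set A₂ : Matrix (Fin (d₁ + d₂ + 1)) (Fin d₂) ℝ :=
    fun r a => - M x (e r) (Sum.inr (Sum.inl a)) with hA₂
  set b₁ : Fin (d₁ + d₂ + 1) → ℝ := fun r => M x (e r) (Sum.inr (Sum.inr ())) with hb₁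
  have hi : ∀ ω, A₁ *ᵥ (S₁ *ᵥ ω + μ₁) + b₁ = A₂ *ᵥ (S₂ *ᵥ ω + μ₂) + fun _ => 0 := by
    intro ω
    ext r
    have h1 := congrFun (hMz ω) (e r)
    have h2 : (M x *ᵥ almAff S₁ S₂ μ₁ μ₂ ω) (e r) =
        (A₁ *ᵥ (S₁ *ᵥ ω + μ₁)) r + (-(A₂ *ᵥ (S₂ *ᵥ ω + μ₂)) r + b₁ r) := by
      simp only [mulVec, dotProduct, Fintype.sum_sum_type, almAff, hA₁, hA₂, hb₁]
      simp
    rw [h2] at h1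
    simp only [Pi.add_apply, Pi.zero_apply] at h1 ⊢
    linarith
  refine ⟨hi, ?_⟩
  change LinearMap.ker (A₁ * S₁).mulVecLin = _
  apply le_antisymm
  · intro ω hω
    by_contra hnot
    obtain ⟨f, hfω, hf⟩ := Submodule.exists_le_ker_of_notMem hnot
    obtain ⟨u, hu⟩ := alm_aux_dual S₁ f (le_sup_left.trans hf)
    obtain ⟨v, hv⟩ := alm_aux_dual S₂ f (le_sup_right.trans hf)
    let w : ι → ℝ := Sum.elim u (Sum.elim (-v) (fun _ => v ⬝ᵥ μ₂ - u ⬝ᵥ μ₁))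
    have hZw : almZ x *ᵥ w = 0 := by
      ext j
      have : (almZ x *ᵥ w) j = (S₁ *ᵥ ωs j + μ₁) ⬝ᵥ u +
          ((S₂ *ᵥ ωs j + μ₂) ⬝ᵥ (-v) + (v ⬝ᵥ μ₂ - u ⬝ᵥ μ₁)) := by
        simp only [mulVec, dotProduct, Fintype.sum_sum_type, almZ, w, hx]
        simp
      rw [this]
      have h1 := hu (ωs j)
      have h2 := hv (ωs j)
      rw [dotProduct_comm _ u, dotProduct_comm _ (-v), dotProduct_add, neg_dotProduct,
        dotProduct_add v, ← h1, ← h2]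
      simp only [Pi.zero_apply]
      ring
    have hw : M x *ᵥ w = w := hGv x w (by rw [← mulVec_mulVec, hZw, mulVec_zero])
    have hω' : A₁ *ᵥ (S₁ *ᵥ ω) = 0 := by
      rw [mulVec_mulVec]; exact hω
    have hu' : u = (fun r => w (e r)) ᵥ* A₁ := by
      ext a
      have h1 := congrFun hw (Sum.inl a)
      rw [← (hsym x).eq, mulVec_transpose] at h1
      change _ = u a at h1
      rw [← h1]
      simp only [vecMul, dotProduct, hA₁]
      exact (e.sum_comp (fun i => w i * M x i (Sum.inl a))).symm
    apply hfω
    rw [hu, hu', ← dotProduct_mulVec, hω', dotProduct_zero]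
  · rw [sup_le_iff]
    constructor
    · intro ω hω
      have h : S₁ *ᵥ ω = 0 := hω
      change (A₁ * S₁) *ᵥ ω = 0
      rw [← mulVec_mulVec, h, mulVec_zero]
    · intro ω hω
      have h : S₂ *ᵥ ω = 0 := hω
      change (A₁ * S₁) *ᵥ ω = 0
      have h1 := hi ω
      have h0 := hi 0
      rw [h, mulVec_add] at h1
      rw [mulVec_zero, mulVec_zero, zero_add, ← h1] at h0
      rw [← mulVec_mulVec]
      ext i
      have h3 := congrFun h0 i
      simp only [Pi.add_apply, Pi.zero_apply] at h3 ⊢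
      linarith
end

section
/- If $n < d_1 + d_2 + 1$, then $\operatorname{ALM}(d_1, d_2, n)$ is not exactly matchable: there exists no measurable function $\mathcal{D}$ mapping each tuple $\{x_{ij}\}_{i \in \{1,2\}, j \in [n]}$ with $x_{ij} \in \mathbb{R}^{d_i}$ to a tuple $(A_1, b_1, A_2, b_2)$ with $A_i \in \mathbb{R}^{k \times d_i}$ and $b_i \in \mathbb{R}^k$ for some common $k \ge 1$, such that for every $D \in \mathbb{N}$, every probability distribution $\mathbb{P}$ on $\mathbb{R}^D$ that is absolutely continuous with respect to Lebesgue measure, every $S_i \in \mathbb{R}^{d_i \times D}$ and $\mu_i \in \mathbb{R}^{d_i}$, if $\omega_1, \ldots, \omega_n$ are drawn independently with distribution $\mathbb{P}$ and $(A_1, b_1, A_2, b_2) := \mathcal{D}(\{S_i\omega_j + \mu_i\}_{i \in \{1,2\}, j \in [n]})$, then almost surely both (i) $A_1(S_1\omega + \mu_1) + b_1 = A_2(S_2\omega + \mu_2) + b_2$ for all $\omega \in \mathbb{R}^D$, and (ii) $\ker A_1 S_1 = \ker S_1 + \ker S_2$. -/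
open Matrix MeasureTheory

theorem alm_pi_ac {α : Type} [MeasurableSpace α] (μ ν : Measure α) [SigmaFinite μ]
    [SigmaFinite ν] (h : μ ≪ ν) (n : ℕ) :
    (Measure.pi fun _ : Fin n => μ) ≪ (Measure.pi fun _ : Fin n => ν) := by
  induction n with
  | zero =>
    rw [Measure.pi_of_empty, Measure.pi_of_empty]
  | succ n ih =>
    have h1 := (measurePreserving_piFinSuccAbove (fun _ : Fin (n+1) => μ) 0).symm.map_eq
    have h2 := (measurePreserving_piFinSuccAbove (fun _ : Fin (n+1) => ν) 0).symm.map_eq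
    rw [← h1, ← h2]
    exact (h.prod ih).map (MeasurableEquiv.measurable _)

/-- all a.e. facts for every AC probability transfer to Lebesgue -/
theorem alm_ae_of_prob {D n : ℕ} {p : (Fin n → Fin D → ℝ) → Prop}
    (h : ∀ (P : Measure (Fin D → ℝ)) [IsProbabilityMeasure P], P ≪ volume →
      ∀ᵐ ωs ∂(Measure.pi fun _ : Fin n => P), p ωs) : ∀ᵐ ωs, p ωs := by
  have h1 := h (volume : Measure (Fin D → ℝ)).toFinite (toFinite_absolutelyContinuous _)
  exact (alm_pi_ac _ _ (absolutelyContinuous_toFinite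
    (volume : Measure (Fin D → ℝ))) n).ae_le h1

/-- design matrix -/
def almM {m n : ℕ} (ω : Fin n → Fin m → ℝ) : Matrix (Fin n) (Fin (m+1)) ℝ :=
  Matrix.of fun j => Fin.cons 1 (ω j)

theorem almM_mulVec {m n : ℕ} (ω : Fin n → Fin m → ℝ) (θ : Fin (m+1) → ℝ) (j : Fin n) :
    (almM ω *ᵥ θ) j = Fin.tail θ ⬝ᵥ ω j + θ 0 := by
  simp [almM, mulVec, dotProduct, Fin.sum_univ_succ, Fin.tail, mul_comm, add_comm]

theorem almM_continuous {m n : ℕ} : Continuous (almM : (Fin n → Fin m → ℝ) → _) := by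
  refine continuous_matrix fun i j => ?_
  refine Fin.cases ?_ (fun k => ?_) j
  · simpa [almM] using continuous_const
  · simp only [almM, of_apply, Fin.cons_succ]
    fun_prop

def almU (m n : ℕ) (h : n ≤ m + 1) : Set (Fin n → Fin m → ℝ) :=
  {ω | ((almM ω).submatrix id (Fin.castLE h)).det ≠ 0}

theorem almU_open (m n : ℕ) (h : n ≤ m + 1) : IsOpen (almU m n h) := by
  refine isOpen_ne_fun ?_ continuous_const
  exact (almM_continuous.matrix_submatrix _ _).matrix_det

theorem almU_nonempty (m n : ℕ) (h : n ≤ m + 1) : (almU m n h).Nonempty := by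
  refine ⟨fun i k => if i.val = k.val + 1 then 1 else 0, ?_⟩
  have key : ∀ (i : Fin n) (j : Fin (m+1)),
      almM (fun (i : Fin n) (k : Fin m) => if i.val = k.val + 1 then (1:ℝ) else 0) i j
        = if j.val = 0 ∨ i.val = j.val then 1 else 0 := by
    intro i j
    refine Fin.cases ?_ (fun k => ?_) j <;> simp [almM]
  simp only [almU, Set.mem_ofPred_eq]
  rw [Matrix.det_of_isLowerTriangular]
  · simp [key]
  · intro i j hij
    have : i < j := hij
    simp only [submatrix_apply, key, id, Fin.val_castLE]
    rw [if_neg]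
    have : i.val < j.val := this
    omega

theorem almU_surj {m n : ℕ} {h : n ≤ m + 1} {ω} (hω : ω ∈ almU m n h) :
    Function.Surjective (almM ω).mulVecLin := by
  intro y
  have e : (almM ω).submatrix id (Fin.castLE h)
      = almM ω * (1 : Matrix (Fin (m+1)) (Fin (m+1)) ℝ).submatrix id (Fin.castLE h) := by
    ext i j
    simp [Matrix.mul_apply, Matrix.one_apply]
  have hu : IsUnit ((almM ω).submatrix id (Fin.castLE h)).det := isUnit_iff_ne_zero.2 hω
  refine ⟨((1 : Matrix (Fin (m+1)) (Fin (m+1)) ℝ).submatrix id (Fin.castLE h)) *ᵥ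
    (((almM ω).submatrix id (Fin.castLE h))⁻¹ *ᵥ y), ?_⟩
  rw [mulVecLin_apply, mulVec_mulVec, ← e, mulVec_mulVec, mul_nonsing_inv _ hu, one_mulVec]

/-- the sample tuple from the first `m` coordinates and the last one -/
def almX (d₁ e n : ℕ) (p : (Fin n → Fin (d₁ + e) → ℝ) × (Fin n → ℝ)) :
    (Fin n → Fin d₁ → ℝ) × (Fin n → Fin (e+1) → ℝ) :=
  (fun j i => p.1 j (Fin.castAdd e i),
    fun j => Fin.cons (p.2 j) (fun i => p.1 j (Fin.natAdd d₁ i)))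

theorem almX_measurable (d₁ e n : ℕ) : Measurable (almX d₁ e n) := by
  refine Measurable.prodMk (by fun_prop) ?_
  refine measurable_pi_lambda _ fun j => measurable_pi_lambda _ fun i => ?_
  refine Fin.cases ?_ (fun k => ?_) i
  · simp only [Fin.cons_zero]; fun_prop
  · simp only [Fin.cons_succ]; fun_prop

def almPsi (m n : ℕ) : (Fin n → Fin (m+1) → ℝ) →ₗ[ℝ] (Fin n → Fin m → ℝ) × (Fin n → ℝ) where
  toFun Z := (fun j i => Z j i.succ, fun j => Z j 0)
  map_add' _ _ := rfl
  map_smul' _ _ := rfl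

theorem almPsi_surj (m n : ℕ) : Function.Surjective (almPsi m n) := by
  rintro ⟨ω, y⟩
  exact ⟨fun j => Fin.cons (y j) (ω j), by simp [almPsi]⟩

theorem alm_haar (m n : ℕ) :
    (volume : Measure (Fin n → Fin m → ℝ)).IsAddHaarMeasure :=
  Measure.pi.isAddHaarMeasure (fun _ : Fin n => (volume : Measure (Fin m → ℝ)))

theorem one_submatrix_mulVec' {a b : ℕ} (f : Fin a → Fin b) (v : Fin b → ℝ) :
    ((1 : Matrix (Fin b) (Fin b) ℝ).submatrix f id) *ᵥ v = fun i => v (f i) := by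
  ext i
  simp [mulVec, dotProduct, Matrix.one_apply]

/-- If `n < d₁ + d₂ + 1`, then `ALM(d₁, d₂, n)` is not exactly matchable. -/
theorem alm_not_exactly_matchable (d₁ d₂ n : ℕ) (hd₁ : 0 < d₁) (hd₂ : 0 < d₂)
    (hn : n < d₁ + d₂ + 1) : ¬ ExactlyMatchable d₁ d₂ n := by
  obtain ⟨e, rfl⟩ : ∃ e, d₂ = e + 1 := ⟨d₂ - 1, by omega⟩
  rintro ⟨k, -, F, hF, H⟩
  have hnm : n ≤ (d₁ + e) + 1 := by omega
  -- the good set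
  set G : Set ((Fin n → Fin (d₁ + e) → ℝ) × (Fin n → ℝ)) :=
    {p | (F (almX d₁ e n p)).1.1 = 0} with hG
  have hGm : MeasurableSet G := by
    have h1 : Measurable fun p => (F (almX d₁ e n p)).1.1 :=
      (hF.comp (almX_measurable d₁ e n)).fst.fst
    have h2 : G = ⋂ i, ⋂ j, {p | (F (almX d₁ e n p)).1.1 i j = 0} := by
      ext p
      simp [hG, ← Matrix.ext_iff]
    rw [h2]
    refine MeasurableSet.iInter fun i => MeasurableSet.iInter fun j => ?_
    have h3 : Measurable fun p => (F (almX d₁ e n p)).1.1 i j :=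
      (measurable_pi_apply j).comp ((measurable_pi_apply i).comp h1)
    exact h3 (measurableSet_singleton 0)
  -- Step A
  have hA : ∀ᵐ p ∂((volume : Measure (Fin n → Fin (d₁ + e) → ℝ)).prod
      (volume : Measure (Fin n → ℝ))), p ∈ G := by
    have hHaar1 := alm_haar (d₁ + e) n
    have hHaar2 := alm_haar (d₁ + e + 1) n
    have hHaar : ((volume : Measure (Fin n → Fin (d₁ + e) → ℝ)).prod
      (volume : Measure (Fin n → ℝ))).IsAddHaarMeasure :=
      Measure.prod.instIsAddHaarMeasure _ _
    rw [← ae_comp_linearMap_mem_iff (almPsi (d₁+e) n) volume _ (almPsi_surj _ _) hGm]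
    refine alm_ae_of_prob fun P _ hP => ?_
    have := H (d₁ + e + 1) P hP
      ((1 : Matrix _ _ ℝ).submatrix (fun i => (Fin.castAdd e i).succ) id)
      ((1 : Matrix _ _ ℝ).submatrix (Fin.cons 0 fun i => (Fin.natAdd d₁ i).succ) id) 0 0
    filter_upwards [this] with Z hZ
    have hX : almX d₁ e n (almPsi (d₁+e) n Z) =
      (fun j => ((1 : Matrix _ _ ℝ).submatrix (fun i => (Fin.castAdd e i).succ) id) *ᵥ Z j + 0,
        fun j => ((1 : Matrix _ _ ℝ).submatrix
          (Fin.cons 0 fun i => (Fin.natAdd d₁ i).succ) id) *ᵥ Z j + 0) := by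
      simp only [add_zero, one_submatrix_mulVec']
      refine Prod.ext rfl ?_
      funext j i
      refine Fin.cases ?_ (fun k => ?_) i <;> simp [almX, almPsi]
    rw [← hX] at hZ
    have h2 := hZ.2
    simp only [hG, Set.mem_ofPred_eq]
    generalize (F (almX d₁ e n (almPsi (d₁+e) n Z))).1.1 = A at h2
    ext r i
    have hv : (Pi.single (Fin.castAdd e i).succ 1 : Fin (d₁+e+1) → ℝ) ∈
        LinearMap.ker (A * ((1 : Matrix _ _ ℝ).submatrix
          (fun i => (Fin.castAdd e i).succ) id : Matrix (Fin d₁) (Fin (d₁+e+1)) ℝ)).mulVecLin := by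
      rw [h2]
      apply Submodule.mem_sup_right
      rw [LinearMap.mem_ker, mulVecLin_apply, one_submatrix_mulVec']
      funext q
      refine Fin.cases ?_ (fun k => ?_) q
      · simp
      · simp only [Fin.cons_succ, Pi.zero_apply]
        rw [Pi.single_eq_of_ne]
        intro h
        have := congrArg Fin.val h
        simp at this
        omega
    rw [LinearMap.mem_ker, mulVecLin_apply] at hv
    have := congrFun hv r
    simpa [Matrix.mul_apply, Matrix.one_apply] using this
  have hA' := Measure.ae_ae_of_ae_prod hA
  -- Step B
  set i0 : Fin (d₁ + e) := Fin.castAdd e ⟨0, hd₁⟩ with hi0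
  have hB : ∀ θ : Fin (d₁ + e + 1) → ℝ, θ i0.succ ≠ 0 →
      ∀ᵐ ω : Fin n → Fin (d₁ + e) → ℝ, (ω, almM ω *ᵥ θ) ∈ Gᶜ := by
    intro θ hθ
    refine alm_ae_of_prob fun P _ hP => ?_
    have := H (d₁ + e) P hP
      ((1 : Matrix _ _ ℝ).submatrix (Fin.castAdd e) id)
      (Matrix.of (Fin.cons (Fin.tail θ) fun i => Pi.single (Fin.natAdd d₁ i) 1)) 0
      (Fin.cons (θ 0) 0)
    filter_upwards [this] with ω hω
    have hX : almX d₁ e n (ω, almM ω *ᵥ θ) =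
      (fun j => ((1 : Matrix _ _ ℝ).submatrix (Fin.castAdd e) id) *ᵥ ω j + 0,
        fun j => (Matrix.of (Fin.cons (Fin.tail θ) fun i => Pi.single (Fin.natAdd d₁ i) 1) :
          Matrix (Fin (e+1)) (Fin (d₁+e)) ℝ) *ᵥ ω j + (Fin.cons (θ 0) 0 : Fin (e+1) → ℝ)) := by
      simp only [add_zero, one_submatrix_mulVec']
      refine Prod.ext rfl ?_
      funext j i
      refine Fin.cases ?_ (fun k => ?_) i
      · have h5 := almM_mulVec ω θ j
        simp only [almX, Fin.cons_zero, h5]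
        simp [mulVec]
      · simp [almX, mulVec]
    rw [← hX] at hω
    have h2 := hω.2
    simp only [hG, Set.mem_compl_iff, Set.mem_ofPred_eq]
    intro hz
    rw [hz] at h2
    have hv : (Pi.single i0 1 : Fin (d₁+e) → ℝ) ∈
        LinearMap.ker ((1 : Matrix _ _ ℝ).submatrix (Fin.castAdd e) id :
          Matrix (Fin d₁) (Fin (d₁+e)) ℝ).mulVecLin ⊔
        LinearMap.ker (Matrix.of (Fin.cons (Fin.tail θ) fun i => Pi.single (Fin.natAdd d₁ i) 1) :
          Matrix (Fin (e+1)) (Fin (d₁+e)) ℝ).mulVecLin := by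
      rw [← h2]
      simp
    obtain ⟨u, hu, w, hw, huw⟩ := Submodule.mem_sup.1 hv
    rw [LinearMap.mem_ker, mulVecLin_apply] at hu hw
    rw [one_submatrix_mulVec'] at hu
    have hw0 : Fin.tail θ ⬝ᵥ w = 0 := by simpa [mulVec] using congrFun hw 0
    have hw1 : ∀ i, w (Fin.natAdd d₁ i) = 0 := fun i => by
      simpa [mulVec] using congrFun hw i.succ
    have hu1 : ∀ i, u (Fin.castAdd e i) = 0 := fun i => by simpa using congrFun hu i
    have hw2 : w = Pi.single i0 1 := by
      funext q
      refine Fin.addCases (fun i => ?_) (fun i => ?_) q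
      · rw [← huw]; simp [hu1]
      · rw [hw1, Pi.single_eq_of_ne]
        intro h
        have := congrArg Fin.val h
        simp [hi0] at this
        omega
    rw [hw2] at hw0
    exact hθ (by simpa [Fin.tail] using hw0)
  have hθae : ∀ᵐ θ : Fin (d₁ + e + 1) → ℝ, θ i0.succ ≠ 0 := by
    have := (ae_comp_linearMap_mem_iff
      (LinearMap.proj i0.succ : (Fin (d₁ + e + 1) → ℝ) →ₗ[ℝ] ℝ) volume volume
      (LinearMap.proj_surjective _) (s := {0}ᶜ) (measurableSet_singleton _).compl).2
      (by simp [ae_iff])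
    simpa using this
  have hB' : ∀ᵐ θ : Fin (d₁ + e + 1) → ℝ, ∀ᵐ ω : Fin n → Fin (d₁ + e) → ℝ,
      (ω, almM ω *ᵥ θ) ∈ Gᶜ := by
    filter_upwards [hθae] with θ hθ using hB θ hθ
  rw [Measure.ae_ae_comm] at hB'
  swap
  · have : Measurable fun x : (Fin (d₁ + e + 1) → ℝ) × (Fin n → Fin (d₁ + e) → ℝ) =>
        (x.2, almM x.2 *ᵥ x.1) := by
      apply Continuous.measurable
      exact continuous_snd.prodMk
        (Continuous.matrix_mulVec (almM_continuous.comp continuous_snd) continuous_fst)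
    exact this hGm.compl
  have hpos : volume (almU (d₁+e) n hnm) ≠ 0 :=
    ((almU_open _ _ hnm).measure_pos volume (almU_nonempty _ _ hnm)).ne'
  obtain ⟨ω, hωU, h1, h2⟩ : ∃ ω ∈ almU (d₁+e) n hnm,
      (∀ᵐ y : Fin n → ℝ, (ω, y) ∈ G) ∧
      ∀ᵐ θ : Fin (d₁ + e + 1) → ℝ, (ω, almM ω *ᵥ θ) ∈ Gᶜ := by
    have hf : ∃ᵐ ω : Fin n → Fin (d₁ + e) → ℝ, ω ∈ almU (d₁+e) n hnm :=
      frequently_ae_iff.2 hpos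
    exact (hf.and_eventually (hA'.and hB')).exists
  have h3 := (ae_comp_linearMap_mem_iff (almM ω).mulVecLin volume volume (almU_surj hωU)
    (s := {y | (ω, y) ∈ G}) (measurable_prodMk_left hGm)).2 h1
  obtain ⟨θ, ha, hb⟩ := (h3.and h2).exists
  exact hb ha
end
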